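/- arXiv:2511.17002 — 2 statements merged into one kernel-verified Lean document; each statement's English description precedes it below -/
import Mathlib

section
/- Equation (E) posed in ℝ^N∖{0} (i.e. with Ω = ℝ^N) admits at least one positive solution if and only if f_ρ(β) > 0. -/
open MeasureTheory Filter Topology Real RealInnerProductSpace

noncomputable section

/-- The gradient factor `G_τ(x,z,ξ) = z^τ ‖ξ‖^(1-τ) / ‖x‖^(τ+1)`.
For `τ = 0` this equals `‖ξ‖ / ‖x‖`, since `z ^ (0:ℝ) = 1` for real powers. -/
def Gt {N : ℕ} (τ : ℝ) (x : EuclideanSpace ℝ (Fin N)) (z : ℝ)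
    (ξ : EuclideanSpace ℝ (Fin N)) : ℝ :=
  z ^ τ * ‖ξ‖ ^ (1 - τ) / ‖x‖ ^ (τ + 1)

/-- Test functions: `C¹` functions with compact support contained in `Ω \ {0}`. -/
def IsTestFun {N : ℕ} (Ω : Set (EuclideanSpace ℝ (Fin N)))
    (φ : EuclideanSpace ℝ (Fin N) → ℝ) : Prop :=
  ContDiff ℝ 1 φ ∧ HasCompactSupport φ ∧ tsupport φ ⊆ Ω \ {0}

/-- The distributional pairing of equation (E) with a test function `φ`:
`∫ ∇u·∇φ + (N-2+2ρ) ∫ ((x·∇u)/|x|²) φ - λ ∫ G_τ(x,u,∇u) φ + ∫ |x|^θ u^q φ`. -/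
def weakE (N : ℕ) (ρ lam τ θ q : ℝ) (Ω : Set (EuclideanSpace ℝ (Fin N)))
    (u φ : EuclideanSpace ℝ (Fin N) → ℝ) : ℝ :=
  (∫ x in Ω \ {0}, ⟪gradient u x, gradient φ x⟫)
    + ((N : ℝ) - 2 + 2 * ρ) * (∫ x in Ω \ {0}, ⟪x, gradient u x⟫ / ‖x‖ ^ 2 * φ x)
    - lam * (∫ x in Ω \ {0}, Gt τ x (u x) (gradient u x) * φ x)
    + ∫ x in Ω \ {0}, ‖x‖ ^ θ * u x ^ q * φ x

/-- A positive `C¹` function on `Ω \ {0}`. -/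
def PosC1 {N : ℕ} (Ω : Set (EuclideanSpace ℝ (Fin N)))
    (u : EuclideanSpace ℝ (Fin N) → ℝ) : Prop :=
  ContDiffOn ℝ 1 u (Ω \ {0}) ∧ ∀ x ∈ Ω \ {0}, 0 < u x

/-- Positive distributional solution of equation (E) in `Ω \ {0}`. -/
def IsSolutionE (N : ℕ) (ρ lam τ θ q : ℝ) (Ω : Set (EuclideanSpace ℝ (Fin N)))
    (u : EuclideanSpace ℝ (Fin N) → ℝ) : Prop :=
  PosC1 Ω u ∧ ∀ φ, IsTestFun Ω φ → weakE N ρ lam τ θ q Ω u φ = 0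

/-- Positive sub-solution of equation (E) in `Ω \ {0}`. -/
def IsSubSolutionE (N : ℕ) (ρ lam τ θ q : ℝ) (Ω : Set (EuclideanSpace ℝ (Fin N)))
    (u : EuclideanSpace ℝ (Fin N) → ℝ) : Prop :=
  PosC1 Ω u ∧ ∀ φ, IsTestFun Ω φ → (∀ x, 0 ≤ φ x) → weakE N ρ lam τ θ q Ω u φ ≤ 0

/-- Positive super-solution of equation (E) in `Ω \ {0}`. -/
def IsSuperSolutionE (N : ℕ) (ρ lam τ θ q : ℝ) (Ω : Set (EuclideanSpace ℝ (Fin N)))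
    (u : EuclideanSpace ℝ (Fin N) → ℝ) : Prop :=
  PosC1 Ω u ∧ ∀ φ, IsTestFun Ω φ → (∀ x, 0 ≤ φ x) → 0 ≤ weakE N ρ lam τ θ q Ω u φ

/-- `f_ρ(t) = t (t + 2ρ) + λ |t|^(1-τ)`. -/
def fRho (ρ lam τ t : ℝ) : ℝ := t * (t + 2 * ρ) + lam * |t| ^ (1 - τ)

/-- `Υ = ((τ+1)/(2τ)) (λτ)^(1/(τ+1))`. -/
def Upsilon (lam τ : ℝ) : ℝ := ((τ + 1) / (2 * τ)) * (lam * τ) ^ (1 / (τ + 1))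

/-- Case [N₀]: (a) `τ = 0` and `λ ≥ 2ρ`, or (b) `λ > 0`, `τ ∈ (0,1)` and `ρ < Υ`. -/
def CaseN0 (ρ lam τ : ℝ) : Prop :=
  (τ = 0 ∧ 2 * ρ ≤ lam) ∨ (0 < lam ∧ 0 < τ ∧ τ < 1 ∧ ρ < Upsilon lam τ)

/-- Case [N₁]: (a) `τ = 0` and `λ < 2ρ`, or (b) `λ < 0` and `τ ∈ (0,1)`. -/
def CaseN1 (ρ lam τ : ℝ) : Prop :=
  (τ = 0 ∧ lam < 2 * ρ) ∨ (lam < 0 ∧ 0 < τ ∧ τ < 1)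

/-- Case [N₂]: `λ > 0`, `τ ∈ (0,1)` and `ρ ≥ Υ`. -/
def CaseN2 (ρ lam τ : ℝ) : Prop :=
  0 < lam ∧ 0 < τ ∧ τ < 1 ∧ Upsilon lam τ ≤ ρ

/-- `w` is the smallest negative root of `f_ρ` (i.e. `w = ϖ₁`). -/
def IsMinNegRoot (ρ lam τ w : ℝ) : Prop :=
  w < 0 ∧ fRho ρ lam τ w = 0 ∧ ∀ t, t < 0 → fRho ρ lam τ t = 0 → w ≤ t

/-- `w` is the largest negative root of `f_ρ` (i.e. `w = ϖ₂`). -/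
def IsMaxNegRoot (ρ lam τ w : ℝ) : Prop :=
  w < 0 ∧ fRho ρ lam τ w = 0 ∧ ∀ t, t < 0 → fRho ρ lam τ t = 0 → t ≤ w

/-- `Φ_{ϖ₂}(r)`: equal to `r^(-ϖ₂)` if `ρ > Υ` and to `r^(-ϖ₂) |log r|^(2/(1+τ))` if `ρ = Υ`. -/
def Phi2 (ρ lam τ w2 r : ℝ) : ℝ :=
  if ρ = Upsilon lam τ then r ^ (-w2) * |Real.log r| ^ (2 / (1 + τ)) else r ^ (-w2)

/-- `Ψ_{ϖ₁}(t)`: equal to `t^(-ϖ₁)` if `ρ > Υ` and to `t^(-ϖ₁) (log t)^(2/(1+τ))` if `ρ = Υ`. -/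
def Psi1 (ρ lam τ w1 t : ℝ) : ℝ :=
  if ρ = Upsilon lam τ then t ^ (-w1) * (Real.log t) ^ (2 / (1 + τ)) else t ^ (-w1)

/-- The radial operator `L_{ρ,λ,τ}[P](r) = P'' + (1-2ρ) P'/r + λ P^τ |P'|^(1-τ)/r^(1+τ)`. -/
def Lrad (ρ lam τ : ℝ) (P : ℝ → ℝ) (r : ℝ) : ℝ :=
  deriv (deriv P) r + (1 - 2 * ρ) * deriv P r / r
    + lam * P r ^ τ * |deriv P r| ^ (1 - τ) / r ^ (1 + τ)

/-- The Laplacian of `u` at `x`, as the trace of the second derivative. -/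
def lapl {N : ℕ} (u : EuclideanSpace ℝ (Fin N) → ℝ) (x : EuclideanSpace ℝ (Fin N)) : ℝ :=
  ∑ i : Fin N, iteratedFDeriv ℝ 2 u x ![EuclideanSpace.single i 1, EuclideanSpace.single i 1]

section CompactlySupported

variable {N : ℕ}

local notation "𝔼" => EuclideanSpace ℝ (Fin N)

/-- A function vanishing off a compact set and continuous at its points is continuous. -/
theorem continuous_of_continuousAt_of_eq_zero_off_compact {K : Set 𝔼} (hK : IsCompact K) {f : 𝔼 → ℝ}
    (h0 : ∀ x ∉ K, f x = 0) (hf : ∀ x ∈ K, ContinuousAt f x) : Continuous f := by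
  refine continuous_iff_continuousAt.2 fun x => ?_
  by_cases hx : x ∈ K
  · exact hf x hx
  · have : f =ᶠ[𝓝 x] fun _ => 0 := by
      filter_upwards [hK.isClosed.isOpen_compl.mem_nhds hx] with y hy using h0 y hy
    exact continuousAt_const.congr this.symm

theorem integrable_of_continuousAt_of_eq_zero_off_compact {K : Set 𝔼} (hK : IsCompact K) {f : 𝔼 → ℝ}
    (h0 : ∀ x ∉ K, f x = 0) (hf : ∀ x ∈ K, ContinuousAt f x) : Integrable f :=
  (continuous_of_continuousAt_of_eq_zero_off_compact hK h0 hf).integrable_of_hasCompactSupport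
    (HasCompactSupport.intro hK h0)

theorem fderiv_eq_zero_of_notMem_tsupport {φ : 𝔼 → ℝ} {x : 𝔼} (hx : x ∉ tsupport φ) :
    fderiv ℝ φ x = 0 := by
  by_contra h
  exact hx (support_fderiv_subset ℝ h)

theorem continuousAt_fderiv_apply {φ : 𝔼 → ℝ} (hφ : ContDiff ℝ 1 φ) {B : 𝔼 → 𝔼} {x : 𝔼}
    (hB : ContinuousAt B x) : ContinuousAt (fun x => fderiv ℝ φ x (B x)) x :=
  (hφ.continuous_fderiv one_ne_zero).continuousAt.clm_apply hB

theorem integrable_fderiv_apply {φ : 𝔼 → ℝ} (hφ : ContDiff ℝ 1 φ) (hc : HasCompactSupport φ)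
    {B : 𝔼 → 𝔼} (hB : ∀ x ∈ tsupport φ, ContinuousAt B x) :
    Integrable (fun x => fderiv ℝ φ x (B x)) :=
  integrable_of_continuousAt_of_eq_zero_off_compact hc
    (fun x hx => by simp [fderiv_eq_zero_of_notMem_tsupport hx])
    (fun x hx => continuousAt_fderiv_apply hφ (hB x hx))

theorem integrable_mul_of_continuousAt_tsupport {φ : 𝔼 → ℝ} (hφ : Continuous φ)
    (hc : HasCompactSupport φ) {F : 𝔼 → ℝ} (hF : ∀ x ∈ tsupport φ, ContinuousAt F x) :
    Integrable (fun x => F x * φ x) :=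
  integrable_of_continuousAt_of_eq_zero_off_compact hc
    (fun x hx => by simp [image_eq_zero_of_notMem_tsupport hx])
    (fun x hx => (hF x hx).mul hφ.continuousAt)

/-- The divergence theorem for the field `φ(x) (x - y)`. -/
theorem integral_fderiv_apply_sub_eq {φ : 𝔼 → ℝ} (hφ : ContDiff ℝ 1 φ) (hc : HasCompactSupport φ)
    (y : 𝔼) : ∫ x, fderiv ℝ φ x (x - y) = -((N : ℝ) * ∫ x, φ x) := by
  have hcoord (i : Fin N) (x : 𝔼) :
      HasFDerivAt (fun x : 𝔼 => (x - y) i) (EuclideanSpace.proj i : 𝔼 →L[ℝ] ℝ) x :=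
    ((EuclideanSpace.proj i : 𝔼 →L[ℝ] ℝ).hasFDerivAt (x := x)).sub_const (y i)
  have hfd (i : Fin N) (x : 𝔼) :
      fderiv ℝ (fun x : 𝔼 => (x - y) i) x (EuclideanSpace.single i 1) = 1 := by
    rw [(hcoord i x).fderiv]; simp
  have hI (i : Fin N) : Integrable
      (fun x : 𝔼 => (x - y) i * fderiv ℝ φ x (EuclideanSpace.single i 1)) := by
    have := integrable_fderiv_apply hφ hc (B := fun x => (x - y) i • EuclideanSpace.single i 1)
      (fun x _ => ((hcoord i x).continuousAt).smul continuousAt_const)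
    simpa using this
  have hφI : Integrable φ := hφ.continuous.integrable_of_hasCompactSupport hc
  have hparts (i : Fin N) :
      ∫ x : 𝔼, (x - y) i * fderiv ℝ φ x (EuclideanSpace.single i 1) = -∫ x, φ x := by
    rw [integral_mul_fderiv_eq_neg_fderiv_mul_of_integrable _ (hI i) _
      (fun x _ => (hcoord i x).differentiableAt)
      (fun x _ => (hφ.differentiable one_ne_zero).differentiableAt)]
    · simp only [hfd, one_mul]
    · simpa only [hfd, one_mul] using hφI
    · exact integrable_mul_of_continuousAt_tsupport hφ.continuous hc
        (fun x _ => (hcoord i x).continuousAt)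
  have hsum (x : 𝔼) : fderiv ℝ φ x (x - y)
      = ∑ i, (x - y) i * fderiv ℝ φ x (EuclideanSpace.single i 1) := by
    conv_lhs => rw [← (EuclideanSpace.basisFun (Fin N) ℝ).sum_repr (x - y)]
    simp [map_sum]
  simp_rw [hsum]
  rw [integral_finsetSum _ (fun i _ => hI i), Finset.sum_congr rfl fun i _ => hparts i]
  simp

/-- Weak form of `div (c x) = N c + x · ∇c`. -/
theorem integral_fderiv_apply_smul_eq {φ c : 𝔼 → ℝ} (hφ : ContDiff ℝ 1 φ)
    (hs : HasCompactSupport φ) (hcd : ∀ x ∈ tsupport φ, ContDiffAt ℝ 1 c x) :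
    ∫ x, fderiv ℝ φ x (c x • x) = -∫ x, ((N : ℝ) * c x + fderiv ℝ c x x) * φ x := by
  have hψ : ContDiff ℝ 1 (fun x => c x * φ x) := by
    refine contDiff_iff_contDiffAt.2 fun x => ?_
    by_cases hx : x ∈ tsupport φ
    · exact (hcd x hx).mul hφ.contDiffAt
    · have : (fun x => c x * φ x) =ᶠ[𝓝 x] fun _ => 0 := by
        filter_upwards [notMem_tsupport_iff_eventuallyEq.1 hx] with y hy
        simp [hy]
      exact contDiffAt_const.congr_of_eventuallyEq this
  have hψs : HasCompactSupport (fun x => c x * φ x) := hs.mul_left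
  have key := integral_fderiv_apply_sub_eq hψ hψs 0
  have hfd (x : 𝔼) : fderiv ℝ (fun x => c x * φ x) x (x - 0)
      = fderiv ℝ φ x (c x • x) + fderiv ℝ c x x * φ x := by
    by_cases hx : x ∈ tsupport φ
    · rw [fderiv_fun_mul ((hcd x hx).differentiableAt one_ne_zero)
        (hφ.differentiable one_ne_zero).differentiableAt]
      simp; ring
    · have : (fun x => c x * φ x) =ᶠ[𝓝 x] fun _ => 0 := by
        filter_upwards [notMem_tsupport_iff_eventuallyEq.1 hx] with y hy
        simp [hy]
      rw [this.fderiv_eq, fderiv_eq_zero_of_notMem_tsupport hx,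
        image_eq_zero_of_notMem_tsupport hx]
      simp
  have hI1 : Integrable (fun x => fderiv ℝ φ x (c x • x)) :=
    integrable_fderiv_apply hφ hs fun x hx => (hcd x hx).continuousAt.smul continuousAt_id
  have hI2 : Integrable (fun x => fderiv ℝ c x x * φ x) :=
    integrable_mul_of_continuousAt_tsupport hφ.continuous hs fun x hx =>
      ((hcd x hx).fderiv_right (m := 0) le_rfl).continuousAt.clm_apply continuousAt_id
  have hI3 : Integrable (fun x => c x * φ x) :=
    hψ.continuous.integrable_of_hasCompactSupport hψs
  simp_rw [hfd] at key
  rw [integral_add hI1 hI2] at key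
  have h2 : ∫ x, ((N : ℝ) * c x + fderiv ℝ c x x) * φ x
      = (N : ℝ) * (∫ x, c x * φ x) + ∫ x, fderiv ℝ c x x * φ x := by
    rw [← integral_const_mul, ← integral_add (hI3.const_mul _) hI2]
    congr 1; ext x; ring
  rw [h2]; linarith

end CompactlySupported

section Touching

variable {N : ℕ}

local notation "𝔼" => EuclideanSpace ℝ (Fin N)

theorem PosC1.contDiffAt {u : 𝔼 → ℝ} (hu : PosC1 Set.univ u) {x : 𝔼} (hx : x ≠ 0) :
    ContDiffAt ℝ 1 u x :=
  hu.1.contDiffAt ((isOpen_univ.sdiff isClosed_singleton).mem_nhds ⟨trivial, hx⟩)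

theorem PosC1.pos {u : 𝔼 → ℝ} (hu : PosC1 Set.univ u) {x : 𝔼} (hx : x ≠ 0) : 0 < u x :=
  hu.2 x ⟨trivial, hx⟩

theorem ContDiffAt.continuousAt_gradient {u : 𝔼 → ℝ} {x : 𝔼} (hu : ContDiffAt ℝ 1 u x) :
    ContinuousAt (gradient u) x :=
  (InnerProductSpace.toDual ℝ 𝔼).symm.continuous.continuousAt.comp
    (hu.fderiv_right (m := 0) le_rfl).continuousAt

/-- If `Δu = F` weakly away from the origin, and `u` is touched from above at `x₀ ≠ 0` by a function
`h` with `∇h(x) = c(x) x`, then `F(x₀) ≤ Δh(x₀)`. -/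
theorem le_divergence_of_isLocalMax_sub {u h F c : 𝔼 → ℝ} {x₀ : 𝔼} (hx₀ : x₀ ≠ 0)
    (hu : ∀ x, x ≠ 0 → ContDiffAt ℝ 1 u x) (hF : ∀ x, x ≠ 0 → ContinuousAt F x)
    (hweak : ∀ φ, IsTestFun Set.univ φ → ∫ x, (fderiv ℝ φ x (gradient u x) + F x * φ x) = 0)
    (hgrad : ∀ᶠ x in 𝓝 x₀, HasGradientAt h (c x • x) x)
    (hcd : ∀ᶠ x in 𝓝 x₀, ContDiffAt ℝ 1 c x)
    (hmax : IsLocalMax (fun x => u x - h x) x₀) :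
    F x₀ ≤ (N : ℝ) * c x₀ + fderiv ℝ c x₀ x₀ := by
  by_contra! hlt
  set D : 𝔼 → ℝ := fun x => (N : ℝ) * c x + fderiv ℝ c x x with hD
  obtain ⟨δ, hδ, hδlt⟩ : ∃ δ > 0, 2 * N * δ < F x₀ - D x₀ := by
    refine ⟨(F x₀ - D x₀) / (2 * N + 1), div_pos (sub_pos.2 hlt) (by positivity), ?_⟩
    have : 0 < F x₀ - D x₀ := sub_pos.2 hlt
    rw [mul_div_assoc', div_lt_iff₀ (by positivity)]
    nlinarith
  have hDc (x : 𝔼) (hx : ContDiffAt ℝ 1 c x) : ContinuousAt D x :=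
    (continuousAt_const.mul hx.continuousAt).add
      ((hx.fderiv_right (m := 0) le_rfl).continuousAt.clm_apply continuousAt_id)
  have hpos : ∀ᶠ x in 𝓝 x₀, 2 * N * δ < F x - D x :=
    ((hF x₀ hx₀).sub (hDc x₀ hcd.self_of_nhds)).eventually_const_lt hδlt
  obtain ⟨r, hr, hball⟩ := Metric.eventually_nhds_iff_ball.1
    (((hgrad.and hcd).and (hmax.and hpos)).and (eventually_ne_nhds hx₀))
  have hgrad' (x) (hx : x ∈ Metric.ball x₀ r) := (hball x hx).1.1.1
  have hcd' (x) (hx : x ∈ Metric.ball x₀ r) := (hball x hx).1.1.2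
  have hmax' (x) (hx : x ∈ Metric.ball x₀ r) := (hball x hx).1.2.1
  have hpos' (x) (hx : x ∈ Metric.ball x₀ r) := (hball x hx).1.2.2
  have hne (x) (hx : x ∈ Metric.ball x₀ r) := (hball x hx).2
  -- the strictly concave perturbation `V`, shifted so that `V x₀ > 0` and `V ≤ 0` off `ball x₀ (r/2)`
  set V : 𝔼 → ℝ := fun x => u x - h x - (u x₀ - h x₀) - δ * ‖x - x₀‖ ^ 2 + δ * (r / 2) ^ 2 with hV
  set B : 𝔼 → 𝔼 := fun x => gradient u x - c x • x - (2 * δ) • (x - x₀) with hB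
  have hVgrad (x) (hx : x ∈ Metric.ball x₀ r) :
      HasFDerivAt V (InnerProductSpace.toDual ℝ 𝔼 (B x)) x := by
    have h1 := ((hu x (hne x hx)).differentiableAt one_ne_zero).hasGradientAt.hasFDerivAt
    have h2 := (hgrad' x hx).hasFDerivAt
    have h3 : HasFDerivAt (fun x : 𝔼 => ‖x - x₀‖ ^ 2) _ x :=
      ((hasFDerivAt_id x).sub_const x₀).norm_sq
    have h4 := ((((h1.sub h2).sub_const (u x₀ - h x₀)).sub (h3.const_mul δ)).add_const
      (δ * (r / 2) ^ 2))
    refine h4.congr_fderiv ?_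
    ext v
    simp [hB]
    ring
  have hBc (x) (hx : x ∈ Metric.ball x₀ r) : ContinuousAt B x :=
    (((hu x (hne x hx)).continuousAt_gradient).sub
      ((hcd' x hx).continuousAt.smul continuousAt_id)).sub
      (by fun_prop)
  have hVC1 (x) (hx : x ∈ Metric.ball x₀ r) : ContDiffAt ℝ 1 V x := by
    refine contDiffAt_one_iff.2 ⟨fun x => InnerProductSpace.toDual ℝ 𝔼 (B x),
      Metric.ball x₀ r, Metric.isOpen_ball.mem_nhds hx, fun y hy => ?_, hVgrad⟩
    exact ((InnerProductSpace.toDual ℝ 𝔼).continuous.continuousAt.comp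
      (hBc y hy)).continuousWithinAt
  have hVle (x) (hx : x ∈ Metric.ball x₀ r) (hx' : x ∉ Metric.closedBall x₀ (r / 2)) :
      V x ≤ 0 := by
    have h1 := hmax' x hx
    have h2 : r / 2 < ‖x - x₀‖ := by simpa [dist_eq_norm] using hx'
    have h3 : (r / 2) ^ 2 ≤ ‖x - x₀‖ ^ 2 := by gcongr
    have h4 := mul_le_mul_of_nonneg_left h3 hδ.le
    simp only [hV]
    linarith
  classical
  set φ : 𝔼 → ℝ := fun x => if x ∈ Metric.ball x₀ r then expNegInvGlue (V x) else 0 with hφ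
  have hφoff (x) (hx : x ∉ Metric.closedBall x₀ (r / 2)) : φ x = 0 := by
    by_cases hxb : x ∈ Metric.ball x₀ r
    · simp only [hφ, if_pos hxb, expNegInvGlue.zero_of_nonpos (hVle x hxb hx)]
    · simp only [hφ, if_neg hxb]
  have hφev (x) (hx : x ∈ Metric.ball x₀ r) : φ =ᶠ[𝓝 x] fun y => expNegInvGlue (V y) := by
    filter_upwards [Metric.isOpen_ball.mem_nhds hx] with y hy
    simp only [hφ, if_pos hy]
  have hsub : Metric.closedBall x₀ (r / 2) ⊆ Metric.ball x₀ r :=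
    Metric.closedBall_subset_ball (by linarith)
  have hglue : ContDiff ℝ 1 expNegInvGlue := expNegInvGlue.contDiff (n := 1)
  have hφC1 : ContDiff ℝ 1 φ := by
    refine contDiff_iff_contDiffAt.2 fun x => ?_
    by_cases hx : x ∈ Metric.closedBall x₀ (r / 2)
    · exact (hglue.contDiffAt.comp x (hVC1 x (hsub hx))).congr_of_eventuallyEq (hφev x (hsub hx))
    · have : φ =ᶠ[𝓝 x] fun _ => 0 := by
        filter_upwards [Metric.isClosed_closedBall.isOpen_compl.mem_nhds hx] with y hy
          using hφoff y hy
      exact contDiffAt_const.congr_of_eventuallyEq this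
  have hφs : HasCompactSupport φ := HasCompactSupport.intro (isCompact_closedBall _ _) hφoff
  have hts : tsupport φ ⊆ Metric.closedBall x₀ (r / 2) := by
    refine closure_minimal (fun x hx => ?_) Metric.isClosed_closedBall
    by_contra hx'
    exact hx (hφoff x hx')
  have hts' : tsupport φ ⊆ Metric.ball x₀ r := hts.trans hsub
  have hφnn (x) : 0 ≤ φ x := by
    simp only [hφ]
    split_ifs
    · exact expNegInvGlue.nonneg _
    · exact le_rfl
  have hφfd (x) : 0 ≤ fderiv ℝ φ x (B x) := by
    by_cases hx : x ∈ tsupport φ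
    · have hxb := hts' hx
      have h1 : HasFDerivAt (fun y => expNegInvGlue (V y)) _ x :=
        ((hglue.differentiable one_ne_zero).differentiableAt.hasDerivAt).comp_hasFDerivAt x
          (hVgrad x hxb)
      rw [(hφev x hxb).fderiv_eq, h1.fderiv]
      simpa using mul_nonneg expNegInvGlue.monotone.deriv_nonneg (sq_nonneg ‖B x‖)
    · simp [fderiv_eq_zero_of_notMem_tsupport hx]
  have e1 := hweak φ ⟨hφC1, hφs, fun x hx => ⟨trivial, hne x (hts' hx)⟩⟩
  have e2 := integral_fderiv_apply_smul_eq hφC1 hφs (fun x hx => hcd' x (hts' hx))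
  have e3 := integral_fderiv_apply_sub_eq hφC1 hφs x₀
  have I1 : Integrable (fun x => fderiv ℝ φ x (gradient u x)) :=
    integrable_fderiv_apply hφC1 hφs fun x hx => (hu x (hne x (hts' hx))).continuousAt_gradient
  have I2 : Integrable (fun x => F x * φ x) :=
    integrable_mul_of_continuousAt_tsupport hφC1.continuous hφs fun x hx => hF x (hne x (hts' hx))
  have I3 : Integrable (fun x => fderiv ℝ φ x (c x • x)) :=
    integrable_fderiv_apply hφC1 hφs fun x hx =>
      (hcd' x (hts' hx)).continuousAt.smul continuousAt_id
  have I4 : Integrable (fun x => D x * φ x) :=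
    integrable_mul_of_continuousAt_tsupport hφC1.continuous hφs fun x hx => hDc x (hcd' x (hts' hx))
  have I5 : Integrable (fun x => fderiv ℝ φ x (x - x₀)) :=
    integrable_fderiv_apply hφC1 hφs fun x _ => continuousAt_id.sub continuousAt_const
  have I6 : Integrable φ := hφC1.continuous.integrable_of_hasCompactSupport hφs
  have hsplit : ∫ x, (fderiv ℝ φ x (B x) + (F x - D x - 2 * N * δ) * φ x) = 0 := by
    have : ∀ x, fderiv ℝ φ x (B x) + (F x - D x - 2 * N * δ) * φ x
        = (fderiv ℝ φ x (gradient u x) + F x * φ x)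
          - (fderiv ℝ φ x (c x • x) + D x * φ x)
          - 2 * δ * (fderiv ℝ φ x (x - x₀) + N * φ x) := by
      intro x
      simp only [hB, map_sub, map_smul, smul_eq_mul]
      ring
    simp_rw [this]
    rw [integral_sub, integral_sub, integral_const_mul, e1, integral_add I3 I4,
      integral_add I5 (I6.const_mul _), e2, e3, integral_const_mul]
    · ring
    · exact I1.add I2
    · exact I3.add I4
    · exact (I1.add I2).sub (I3.add I4)
    · exact (I5.add (I6.const_mul _)).const_mul _
  have hoff : ∀ x ∉ tsupport φ, fderiv ℝ φ x (B x) + (F x - D x - 2 * N * δ) * φ x = 0 := by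
    intro x hx
    simp [fderiv_eq_zero_of_notMem_tsupport hx, image_eq_zero_of_notMem_tsupport hx]
  have hcont := continuous_of_continuousAt_of_eq_zero_off_compact hφs hoff fun x hx =>
    (continuousAt_fderiv_apply hφC1 (hBc x (hts' hx))).add
      ((((hF x (hne x (hts' hx))).sub (hDc x (hcd' x (hts' hx)))).sub
        continuousAt_const).mul hφC1.continuous.continuousAt)
  have hnn : ∀ x, 0 ≤ fderiv ℝ φ x (B x) + (F x - D x - 2 * N * δ) * φ x := by
    intro x
    by_cases hx : x ∈ tsupport φ
    · exact add_nonneg (hφfd x)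
        (mul_nonneg (sub_nonneg.2 (hpos' x (hts' hx)).le) (hφnn x))
    · exact (hoff x hx).ge
  have hx₀b : x₀ ∈ Metric.ball x₀ r := Metric.mem_ball_self hr
  have hφ₀ : 0 < φ x₀ := by
    have : 0 < V x₀ := by simp only [hV]; simp; positivity
    simpa only [hφ, if_pos hx₀b] using expNegInvGlue.pos_of_pos this
  have hval : fderiv ℝ φ x₀ (B x₀) + (F x₀ - D x₀ - 2 * N * δ) * φ x₀ ≠ 0 :=
    (add_pos_of_nonneg_of_pos (hφfd x₀)
      (mul_pos (sub_pos.2 (hpos' x₀ hx₀b)) hφ₀)).ne'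
  exact (hcont.integral_pos_of_hasCompactSupport_nonneg_nonzero (μ := volume)
    (HasCompactSupport.intro hφs hoff) hnn hval).ne' hsplit

end Touching

section Radial

variable {N : ℕ}

local notation "𝔼" => EuclideanSpace ℝ (Fin N)

/-- The lower order part of the equation, so that (E) reads `Δu = lowerOrder u`. -/
def lowerOrder (ρ lam τ θ q : ℝ) (u : 𝔼 → ℝ) (x : 𝔼) : ℝ :=
  ((N : ℝ) - 2 + 2 * ρ) * (⟪x, gradient u x⟫ / ‖x‖ ^ 2)
    - lam * Gt τ x (u x) (gradient u x) + ‖x‖ ^ θ * u x ^ q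

theorem continuousAt_inner_gradient_div {u : 𝔼 → ℝ} (hu : PosC1 Set.univ u) {x : 𝔼} (hx : x ≠ 0) :
    ContinuousAt (fun x => ⟪x, gradient u x⟫ / ‖x‖ ^ 2) x :=
  (continuousAt_id.inner (𝕜 := ℝ) (hu.contDiffAt hx).continuousAt_gradient).div
    (by fun_prop) (by simpa using hx)

theorem continuousAt_Gt {τ : ℝ} (hτ1 : τ < 1) {u : 𝔼 → ℝ} (hu : PosC1 Set.univ u) {x : 𝔼}
    (hx : x ≠ 0) : ContinuousAt (fun x => Gt τ x (u x) (gradient u x)) x := by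
  have hx' : ‖x‖ ≠ 0 := by simpa using hx
  refine ContinuousAt.div (ContinuousAt.mul ?_ ?_) ?_ ?_
  · exact (hu.contDiffAt hx).continuousAt.rpow_const (Or.inl (hu.pos hx).ne')
  · exact (hu.contDiffAt hx).continuousAt_gradient.norm.rpow_const (Or.inr (by linarith))
  · exact continuousAt_id.norm.rpow_const (Or.inl hx')
  · exact (rpow_pos_of_pos (norm_pos_iff.2 hx) _).ne'

theorem continuousAt_absorption {θ q : ℝ} {u : 𝔼 → ℝ} (hu : PosC1 Set.univ u) {x : 𝔼}
    (hx : x ≠ 0) : ContinuousAt (fun x => ‖x‖ ^ θ * u x ^ q) x :=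
  (continuousAt_id.norm.rpow_const (Or.inl (by simpa using hx))).mul
    ((hu.contDiffAt hx).continuousAt.rpow_const (Or.inl (hu.pos hx).ne'))

theorem continuousAt_lowerOrder {ρ lam τ θ q : ℝ} (hτ1 : τ < 1) {u : 𝔼 → ℝ}
    (hu : PosC1 Set.univ u) {x : 𝔼} (hx : x ≠ 0) :
    ContinuousAt (lowerOrder ρ lam τ θ q u) x :=
  ((continuousAt_const.mul (continuousAt_inner_gradient_div hu hx)).sub
    (continuousAt_const.mul (continuousAt_Gt hτ1 hu hx))).add (continuousAt_absorption hu hx)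

theorem weakE_univ_eq_integral (hN : 2 ≤ N) {ρ lam τ θ q : ℝ} (hτ1 : τ < 1) {u φ : 𝔼 → ℝ}
    (hu : PosC1 Set.univ u) (hφ : IsTestFun Set.univ φ) :
    weakE N ρ lam τ θ q Set.univ u φ
      = ∫ x, (fderiv ℝ φ x (gradient u x) + lowerOrder ρ lam τ θ q u x * φ x) := by
  have : Nonempty (Fin N) := ⟨⟨0, by omega⟩⟩
  have : Nontrivial 𝔼 := inferInstance
  obtain ⟨hC1, hs, hts⟩ := hφ
  have hne (x) (hx : x ∈ tsupport φ) : x ≠ 0 := (hts hx).2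
  have I0 : Integrable (fun x => fderiv ℝ φ x (gradient u x)) :=
    integrable_fderiv_apply hC1 hs fun x hx => (hu.contDiffAt (hne x hx)).continuousAt_gradient
  have I1 := integrable_mul_of_continuousAt_tsupport hC1.continuous hs
    fun x hx => continuousAt_inner_gradient_div hu (hne x hx)
  have I2 := integrable_mul_of_continuousAt_tsupport hC1.continuous hs
    fun x hx => continuousAt_Gt hτ1 hu (hne x hx)
  have I3 := integrable_mul_of_continuousAt_tsupport hC1.continuous hs
    fun x hx => continuousAt_absorption (θ := θ) (q := q) hu (hne x hx)
  have hres : (volume : Measure 𝔼).restrict (Set.univ \ {0}) = volume := by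
    rw [← Set.compl_eq_univ_sdiff, restrict_compl_singleton]
  have hinner : ∀ x, ⟪gradient u x, gradient φ x⟫ = fderiv ℝ φ x (gradient u x) := by
    intro x
    rw [real_inner_comm, inner_gradient_left]
  unfold weakE
  simp_rw [hres, hinner]
  have hsum : ∀ x, fderiv ℝ φ x (gradient u x) + lowerOrder ρ lam τ θ q u x * φ x
      = fderiv ℝ φ x (gradient u x)
        + ((N : ℝ) - 2 + 2 * ρ) * (⟪x, gradient u x⟫ / ‖x‖ ^ 2 * φ x)
        - lam * (Gt τ x (u x) (gradient u x) * φ x) + ‖x‖ ^ θ * u x ^ q * φ x := by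
    intro x
    simp only [lowerOrder]
    ring
  simp_rw [hsum]
  rw [integral_add _ I3, integral_sub _ (I2.const_mul _), integral_add I0 (I1.const_mul _),
    integral_const_mul, integral_const_mul]
  · exact I0.add (I1.const_mul _)
  · exact (I0.add (I1.const_mul _)).sub (I2.const_mul _)

theorem hasFDerivAt_comp_log_norm {b : ℝ → ℝ} {b' : ℝ} {x : 𝔼} (hx : x ≠ 0)
    (hb : HasDerivAt b b' (Real.log ‖x‖)) :
    HasFDerivAt (fun x => b (Real.log ‖x‖))
      ((b' / ‖x‖ ^ 2) • InnerProductSpace.toDual ℝ 𝔼 x) x := by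
  have hx' : ‖x‖ ≠ 0 := by simpa using hx
  have h1 : HasFDerivAt (fun x : 𝔼 => Real.log (‖x‖ ^ 2) / 2) _ x :=
    (((hasStrictFDerivAt_norm_sq x).hasFDerivAt).log (by positivity)).mul_const (2 : ℝ)⁻¹
  have h2 : (fun x : 𝔼 => Real.log (‖x‖ ^ 2) / 2) = fun x => Real.log ‖x‖ := by
    ext y; rw [Real.log_pow]; push_cast; ring
  rw [h2] at h1
  refine (hb.comp_hasFDerivAt x h1).congr_fderiv ?_
  ext v
  simp
  field_simp

/-- The profile `‖x‖^(-β) e^{G(log ‖x‖)}`. -/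
def radialProfile (β : ℝ) (G : ℝ → ℝ) (x : 𝔼) : ℝ :=
  Real.exp (-β * Real.log ‖x‖ + G (Real.log ‖x‖))

/-- The factor `c` in `∇(radialProfile β G)(x) = c(x) x`, as a function of `t = log ‖x‖`, where
`s = G'`. -/
def radialSlope (β : ℝ) (G s : ℝ → ℝ) (t : ℝ) : ℝ :=
  (s t - β) * Real.exp (-(β + 2) * t + G t)

theorem hasGradientAt_radialProfile {β : ℝ} {G s : ℝ → ℝ} {x : 𝔼} (hx : x ≠ 0)
    (hG : HasDerivAt G (s (Real.log ‖x‖)) (Real.log ‖x‖)) :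
    HasGradientAt (radialProfile β G) (radialSlope β G s (Real.log ‖x‖) • x) x := by
  have hx' : 0 < ‖x‖ := norm_pos_iff.2 hx
  have h1 : HasDerivAt (fun t => Real.exp (-β * t + G t)) _ (Real.log ‖x‖) :=
    (((hasDerivAt_id _).const_mul (-β)).add hG).exp
  rw [hasGradientAt_iff_hasFDerivAt]
  refine (hasFDerivAt_comp_log_norm hx h1).congr_fderiv ?_
  rw [map_smul]
  congr 1
  have h2 : ‖x‖ ^ 2 = Real.exp (2 * Real.log ‖x‖) := by
    rw [two_mul, Real.exp_add, Real.exp_log hx', sq]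
  rw [h2, radialSlope, div_eq_iff (Real.exp_pos _).ne', mul_assoc, ← Real.exp_add]
  simp only [Pi.add_apply, id]
  ring_nf

theorem hasDerivAt_radialSlope {β s' t : ℝ} {G s : ℝ → ℝ} (hG : HasDerivAt G (s t) t)
    (hs : HasDerivAt s s' t) :
    HasDerivAt (radialSlope β G s)
      ((s' + (s t - β) * (s t - β - 2)) * Real.exp (-(β + 2) * t + G t)) t := by
  have h1 : HasDerivAt (fun t => Real.exp (-(β + 2) * t + G t)) _ t :=
    (((hasDerivAt_id t).const_mul (-(β + 2))).add hG).exp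
  refine ((hs.sub_const β).mul h1).congr_deriv ?_
  simp only [Pi.add_apply, id]
  ring

theorem fderiv_radialSlope_apply {β s' : ℝ} {G s : ℝ → ℝ} {x : 𝔼} (hx : x ≠ 0)
    (hG : HasDerivAt G (s (Real.log ‖x‖)) (Real.log ‖x‖)) (hs : HasDerivAt s s' (Real.log ‖x‖)) :
    fderiv ℝ (fun x : 𝔼 => radialSlope β G s (Real.log ‖x‖)) x x
      = (s' + (s (Real.log ‖x‖) - β) * (s (Real.log ‖x‖) - β - 2))
        * Real.exp (-(β + 2) * Real.log ‖x‖ + G (Real.log ‖x‖)) := by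
  have hx' : ‖x‖ ≠ 0 := by simpa using hx
  rw [(hasFDerivAt_comp_log_norm hx (hasDerivAt_radialSlope (β := β) hG hs)).fderiv]
  simp
  field_simp

theorem contDiffAt_radialSlope {β : ℝ} {G s : ℝ → ℝ} {x : 𝔼} (hx : x ≠ 0)
    (hG : ContDiffAt ℝ 1 G (Real.log ‖x‖)) (hs : ContDiffAt ℝ 1 s (Real.log ‖x‖)) :
    ContDiffAt ℝ 1 (fun x : 𝔼 => radialSlope β G s (Real.log ‖x‖)) x := by
  have hb : ContDiffAt ℝ 1 (radialSlope β G s) (Real.log ‖x‖) :=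
    (hs.sub contDiffAt_const).mul ((contDiffAt_const.mul contDiffAt_id).add hG).exp
  exact hb.comp x ((contDiffAt_norm ℝ hx).log (by simpa using hx))

/-- The equation evaluated on a radial profile. -/
theorem lowerOrder_sub_divergence_radial {ρ lam τ θ q s' : ℝ} (hq : 1 < q)
    {G s : ℝ → ℝ} {u : 𝔼 → ℝ} {x : 𝔼} (hx : x ≠ 0)
    (hG : HasDerivAt G (s (Real.log ‖x‖)) (Real.log ‖x‖)) (hs : HasDerivAt s s' (Real.log ‖x‖))
    (hux : u x = radialProfile ((θ + 2) / (q - 1)) G x)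
    (hgu : gradient u x = radialSlope ((θ + 2) / (q - 1)) G s (Real.log ‖x‖) • x) :
    lowerOrder ρ lam τ θ q u x
        - ((N : ℝ) * radialSlope ((θ + 2) / (q - 1)) G s (Real.log ‖x‖)
          + fderiv ℝ (fun x : 𝔼 => radialSlope ((θ + 2) / (q - 1)) G s (Real.log ‖x‖)) x x)
      = Real.exp (-((θ + 2) / (q - 1) + 2) * Real.log ‖x‖ + G (Real.log ‖x‖))
        * (Real.exp ((q - 1) * G (Real.log ‖x‖))
          - (s' + fRho ρ lam τ ((θ + 2) / (q - 1) - s (Real.log ‖x‖)))) := by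
  have hx' : 0 < ‖x‖ := norm_pos_iff.2 hx
  rw [fderiv_radialSlope_apply hx hG hs, lowerOrder, Gt, hux, hgu, inner_smul_right,
    real_inner_self_eq_norm_sq, mul_div_cancel_right₀ _ (by positivity : ‖x‖ ^ 2 ≠ 0), norm_smul]
  obtain ⟨β, hβ⟩ : ∃ β, (θ + 2) / (q - 1) = β := ⟨_, rfl⟩
  have hθ : θ = β * (q - 1) - 2 := by
    rw [← hβ, div_mul_cancel₀ _ (by linarith)]; ring
  rw [hβ]
  obtain ⟨t, ht⟩ : ∃ t, Real.log ‖x‖ = t := ⟨_, rfl⟩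
  have hr : ‖x‖ = Real.exp t := by rw [← ht, Real.exp_log hx']
  simp only [radialProfile, radialSlope, fRho, ht]
  rw [hr]
  generalize G t = g
  generalize s t = σ
  have habs : |β - σ| = |σ - β| := abs_sub_comm _ _
  have hpow : (‖(σ - β) * Real.exp (-(β + 2) * t + g)‖ * Real.exp t) ^ (1 - τ)
      = |σ - β| ^ (1 - τ) * Real.exp ((-(β + 1) * t + g) * (1 - τ)) := by
    rw [norm_mul, Real.norm_eq_abs, Real.norm_eq_abs, Real.abs_exp, mul_assoc, ← Real.exp_add,
      Real.mul_rpow (abs_nonneg _) (Real.exp_pos _).le, ← Real.exp_mul]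
    ring_nf
  have hGt : Real.exp (-β * t + g) ^ τ *
      (‖(σ - β) * Real.exp (-(β + 2) * t + g)‖ * Real.exp t) ^ (1 - τ) / Real.exp t ^ (τ + 1)
      = |σ - β| ^ (1 - τ) * Real.exp (-(β + 2) * t + g) := by
    rw [hpow, ← Real.exp_mul, ← Real.exp_mul, div_eq_iff (Real.exp_pos _).ne',
      mul_left_comm, ← Real.exp_add, mul_assoc, ← Real.exp_add]
    ring_nf
  have habso : Real.exp t ^ θ * Real.exp (-β * t + g) ^ q
      = Real.exp (-(β + 2) * t + g) * Real.exp ((q - 1) * g) := by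
    rw [← Real.exp_mul, ← Real.exp_mul, ← Real.exp_add, ← Real.exp_add, hθ]
    ring_nf
  rw [hGt, habso, habs]
  ring

end Radial

section Existence

variable {N : ℕ}

local notation "𝔼" => EuclideanSpace ℝ (Fin N)

theorem exists_isSolutionE_of_fRho_pos (hN : 2 ≤ N) {ρ lam τ θ q : ℝ} (hτ1 : τ < 1) (hq : 1 < q)
    (hf : 0 < fRho ρ lam τ ((θ + 2) / (q - 1))) :
    ∃ u : 𝔼 → ℝ, IsSolutionE N ρ lam τ θ q Set.univ u := by
  set β := (θ + 2) / (q - 1) with hβ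
  set g : ℝ := Real.log (fRho ρ lam τ β) / (q - 1) with hg
  have hgrad (x : 𝔼) (hx : x ≠ 0) :
      HasGradientAt (radialProfile β fun _ => g)
        (radialSlope β (fun _ => g) (fun _ => 0) (Real.log ‖x‖) • x) x :=
    hasGradientAt_radialProfile (s := fun _ => 0) hx (hasDerivAt_const _ _)
  have hu : PosC1 Set.univ (radialProfile (N := N) β fun _ => g) := by
    refine ⟨fun x hx => ContDiffAt.contDiffWithinAt ?_, fun x _ => Real.exp_pos _⟩
    have hx0 : x ≠ 0 := hx.2
    exact ((contDiffAt_const.mul ((contDiffAt_norm ℝ hx0).log (by simpa using hx0))).add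
      contDiffAt_const).exp
  refine ⟨_, hu, fun φ hφ => ?_⟩
  have hne (x) (hx : x ∈ tsupport φ) : x ≠ 0 := (hφ.2.2 hx).2
  have hcd (x) (hx : x ∈ tsupport φ) : ContDiffAt ℝ 1
      (fun x : 𝔼 => radialSlope β (fun _ => g) (fun _ => 0) (Real.log ‖x‖)) x :=
    contDiffAt_radialSlope (hne x hx) contDiffAt_const contDiffAt_const
  rw [weakE_univ_eq_integral hN hτ1 hu hφ]
  have hpt : ∀ x, fderiv ℝ φ x (gradient (radialProfile β fun _ => g) x)
      + lowerOrder ρ lam τ θ q (radialProfile β fun _ => g) x * φ x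
      = fderiv ℝ φ x (radialSlope β (fun _ => g) (fun _ => 0) (Real.log ‖x‖) • x)
        + ((N : ℝ) * radialSlope β (fun _ => g) (fun _ => 0) (Real.log ‖x‖)
          + fderiv ℝ (fun x : 𝔼 =>
            radialSlope β (fun _ => g) (fun _ => 0) (Real.log ‖x‖)) x x) * φ x := by
    intro x
    by_cases hx : x ∈ tsupport φ
    · have hx0 := hne x hx
      have key := lowerOrder_sub_divergence_radial (ρ := ρ) (lam := lam) (τ := τ) (θ := θ) hq
        (G := fun _ => g) (s := fun _ => 0) hx0 (hasDerivAt_const _ _)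
        (hasDerivAt_const _ _) rfl (hgrad x hx0).gradient
      have hexp : Real.exp ((q - 1) * g) = fRho ρ lam τ β := by
        rw [hg, mul_div_cancel₀ _ (by linarith : q - 1 ≠ 0), Real.exp_log hf]
      rw [hexp, sub_zero, ← hβ, zero_add, sub_self, mul_zero, sub_eq_zero] at key
      rw [key, (hgrad x hx0).gradient]
    · simp [fderiv_eq_zero_of_notMem_tsupport hx, image_eq_zero_of_notMem_tsupport hx]
  simp_rw [hpt]
  rw [integral_add, integral_fderiv_apply_smul_eq hφ.1 hφ.2.1 hcd, neg_add_cancel]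
  · exact integrable_fderiv_apply hφ.1 hφ.2.1 fun x hx =>
      (hcd x hx).continuousAt.smul continuousAt_id
  · exact integrable_mul_of_continuousAt_tsupport hφ.1.continuous hφ.2.1 fun x hx =>
      (continuousAt_const.mul (hcd x hx).continuousAt).add
        (((hcd x hx).fderiv_right (m := 0) le_rfl).continuousAt.clm_apply continuousAt_id)

end Existence

section Nonexistence

variable {N : ℕ}

local notation "𝔼" => EuclideanSpace ℝ (Fin N)

theorem abs_abs_sub_rpow_sub_abs_rpow_le {p : ℝ} (hp : 0 ≤ p) (hp1 : p ≤ 1) (a b : ℝ) :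
    |(|a - b| ^ p - |a| ^ p)| ≤ |b| ^ p := by
  have h1 : |a - b| ^ p ≤ |a| ^ p + |b| ^ p :=
    (Real.rpow_le_rpow (abs_nonneg _) (abs_sub a b) hp).trans
      (Real.rpow_add_le_add_rpow (abs_nonneg _) (abs_nonneg _) hp hp1)
  have h2 : |a| ^ p ≤ |a - b| ^ p + |b| ^ p := by
    refine (Real.rpow_le_rpow (abs_nonneg _) ?_ hp).trans
      (Real.rpow_add_le_add_rpow (abs_nonneg _) (abs_nonneg _) hp hp1)
    simpa using abs_add_le (a - b) b
  rw [abs_le]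
  constructor <;> linarith

/-- The bound on the rescaled right-hand side for the profile `-k log (1 - ε² t²)`. -/
def cutoffBound (ρ lam τ β k ε : ℝ) : ℝ :=
  6 * k * ε ^ 2 + (2 * k * ε) ^ 2 + 2 * |β + ρ| * (2 * k * ε) + |lam| * (2 * k * ε) ^ (1 - τ)

theorem sq_mul_add_fRho_le_cutoffBound {ρ lam τ β k ε t η : ℝ} (hτ0 : 0 ≤ τ) (hτ1 : τ < 1)
    (hk : 0 < k) (hε : 0 < ε) (hη : η = 1 - ε ^ 2 * t ^ 2) (hη0 : 0 < η)
    (hf : fRho ρ lam τ β ≤ 0) :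
    η ^ 2 * (2 * k * ε ^ 2 / η + 4 * k * ε ^ 4 * t ^ 2 / η ^ 2
      + fRho ρ lam τ (β - 2 * k * ε ^ 2 * t / η)) ≤ cutoffBound ρ lam τ β k ε := by
  have hη1 : η ≤ 1 := by rw [hη]; nlinarith [mul_nonneg (sq_nonneg ε) (sq_nonneg t)]
  have ht : ε ^ 2 * t ^ 2 ≤ 1 := by linarith
  have hεt : |ε * t| ≤ 1 := by
    rw [← sq_le_one_iff_abs_le_one, mul_pow]; exact ht
  obtain ⟨s, hs⟩ : ∃ s, 2 * k * ε ^ 2 * t / η = s := ⟨_, rfl⟩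
  obtain ⟨y, hy⟩ : ∃ y, 2 * k * ε ^ 2 * t = y := ⟨_, rfl⟩
  have hys : y = η * s := by rw [← hs, ← hy]; field_simp
  have hyY : |y| ≤ 2 * k * ε := by
    rw [← hy, show 2 * k * ε ^ 2 * t = (2 * k * ε) * (ε * t) by ring, abs_mul,
      abs_of_pos (by positivity)]
    exact mul_le_of_le_one_right (by positivity) hεt
  have hfirst : η ^ 2 * (2 * k * ε ^ 2 / η + 4 * k * ε ^ 4 * t ^ 2 / η ^ 2) ≤ 6 * k * ε ^ 2 := by
    have : η ^ 2 * (2 * k * ε ^ 2 / η + 4 * k * ε ^ 4 * t ^ 2 / η ^ 2)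
        = 2 * k * ε ^ 2 * η + 4 * k * ε ^ 2 * (ε ^ 2 * t ^ 2) := by field_simp
    rw [this]
    have h1 : 2 * k * ε ^ 2 * η ≤ 2 * k * ε ^ 2 := mul_le_of_le_one_right (by positivity) hη1
    have h2 : 4 * k * ε ^ 2 * (ε ^ 2 * t ^ 2) ≤ 4 * k * ε ^ 2 :=
      mul_le_of_le_one_right (by positivity) ht
    linarith
  have hsqr : y ^ 2 ≤ (2 * k * ε) ^ 2 :=
    sq_le_sq' (by linarith [neg_abs_le y]) ((le_abs_self y).trans hyY)
  have hlin : -(2 * (β + ρ) * (η * y)) ≤ 2 * |β + ρ| * (2 * k * ε) := by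
    refine (neg_le_abs _).trans ?_
    rw [abs_mul, abs_mul, abs_two, abs_mul, abs_of_pos hη0]
    have : η * |y| ≤ 2 * k * ε := (mul_le_of_le_one_left (abs_nonneg y) hη1).trans hyY
    gcongr
  have hpow : lam * (η ^ 2 * (|β - s| ^ (1 - τ) - |β| ^ (1 - τ)))
      ≤ |lam| * (2 * k * ε) ^ (1 - τ) := by
    refine (le_abs_self _).trans ?_
    rw [abs_mul, abs_mul, abs_of_nonneg (sq_nonneg η)]
    refine mul_le_mul_of_nonneg_left ?_ (abs_nonneg _)
    have h1 := abs_abs_sub_rpow_sub_abs_rpow_le (p := 1 - τ) (by linarith) (by linarith) β s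
    have h2 : η ^ 2 ≤ η ^ (1 - τ) := by
      rw [← Real.rpow_natCast]
      exact Real.rpow_le_rpow_of_exponent_ge hη0 hη1 (by push_cast; linarith)
    calc η ^ 2 * |(|β - s| ^ (1 - τ) - |β| ^ (1 - τ))|
        ≤ η ^ (1 - τ) * |s| ^ (1 - τ) := by gcongr
      _ = |y| ^ (1 - τ) := by
        rw [hys, abs_mul, abs_of_pos hη0, Real.mul_rpow hη0.le (abs_nonneg _)]
      _ ≤ (2 * k * ε) ^ (1 - τ) := Real.rpow_le_rpow (abs_nonneg _) hyY (by linarith)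
  have hneg : η ^ 2 * fRho ρ lam τ β ≤ 0 := mul_nonpos_of_nonneg_of_nonpos (sq_nonneg η) hf
  have hexpand : η ^ 2 * fRho ρ lam τ (β - s) = η ^ 2 * fRho ρ lam τ β + y ^ 2
      + -(2 * (β + ρ) * (η * y)) + lam * (η ^ 2 * (|β - s| ^ (1 - τ) - |β| ^ (1 - τ))) := by
    rw [hys]; simp only [fRho]; ring
  rw [hs, mul_add, hexpand, cutoffBound]
  linarith

/-- Keller–Osserman type estimate at a point of the unit sphere, from comparison with
`M ‖x‖^(-β) (1 - ε² log² ‖x‖)^(-2/(q-1))`. -/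
theorem IsSolutionE.rpow_le_cutoffBound (hN : 2 ≤ N) {ρ lam τ θ q : ℝ} (hτ0 : 0 ≤ τ)
    (hτ1 : τ < 1) (hq : 1 < q) (hf : fRho ρ lam τ ((θ + 2) / (q - 1)) ≤ 0) {u : 𝔼 → ℝ}
    (hsol : IsSolutionE N ρ lam τ θ q Set.univ u) {e : 𝔼} (he : ‖e‖ = 1) {ε : ℝ} (hε : 0 < ε) :
    u e ^ (q - 1) ≤ cutoffBound ρ lam τ ((θ + 2) / (q - 1)) (2 / (q - 1)) ε := by
  obtain ⟨hu, hweakE⟩ := hsol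
  set β := (θ + 2) / (q - 1) with hβ
  have hq1 : 0 < q - 1 := by linarith
  set k : ℝ := 2 / (q - 1) with hkdef
  have hk : 0 < k := by positivity
  set η : ℝ → ℝ := fun t => 1 - ε ^ 2 * t ^ 2 with hη
  have hηc : Continuous η := by fun_prop
  set K : Set 𝔼 := Metric.closedBall 0 (Real.exp ε⁻¹) \ Metric.ball 0 (Real.exp (-ε⁻¹)) with hK
  have hKc : IsCompact K := (isCompact_closedBall _ _).diff Metric.isOpen_ball
  have hKmem (x : 𝔼) : x ∈ K ↔ Real.exp (-ε⁻¹) ≤ ‖x‖ ∧ ‖x‖ ≤ Real.exp ε⁻¹ := by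
    simp [hK, and_comm]
  have hK0 (x) (hx : x ∈ K) : x ≠ 0 := by
    have := (Real.exp_pos (-ε⁻¹)).trans_le ((hKmem x).1 hx).1
    exact norm_pos_iff.1 this
  have hηnn (x) (hx : x ∈ K) : 0 ≤ η (Real.log ‖x‖) := by
    have hpos : 0 < ‖x‖ := norm_pos_iff.2 (hK0 x hx)
    have h1 : -ε⁻¹ ≤ Real.log ‖x‖ := (Real.le_log_iff_exp_le hpos).2 ((hKmem x).1 hx).1
    have h2 : Real.log ‖x‖ ≤ ε⁻¹ := (Real.log_le_iff_le_exp hpos).2 ((hKmem x).1 hx).2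
    have h3 : Real.log ‖x‖ ^ 2 ≤ ε⁻¹ ^ 2 := sq_le_sq' h1 h2
    have h4 : ε ^ 2 * Real.log ‖x‖ ^ 2 ≤ ε ^ 2 * ε⁻¹ ^ 2 := by gcongr
    have h5 : ε ^ 2 * ε⁻¹ ^ 2 = 1 := by field_simp
    simp only [hη]; linarith
  have hηpos (x : 𝔼) (hx : x ≠ 0) (h : 0 < η (Real.log ‖x‖)) : x ∈ K := by
    have hpos : 0 < ‖x‖ := norm_pos_iff.2 hx
    have h1 : (ε * Real.log ‖x‖) ^ 2 ≤ 1 := by simp only [hη] at h; nlinarith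
    have h2 := abs_le.1 ((sq_le_one_iff_abs_le_one _).1 h1)
    rw [hKmem, ← Real.le_log_iff_exp_le hpos, ← Real.log_le_iff_le_exp hpos,
      inv_eq_one_div, le_div_iff₀ hε, ← neg_div, div_le_iff₀ hε]
    constructor <;> linarith [h2.1, h2.2]
  have he0 : e ≠ 0 := norm_pos_iff.1 (by rw [he]; exact one_pos)
  have heK : e ∈ K := hηpos e he0 (by simp [hη, he])
  have hlogc (x : 𝔼) (hx : x ≠ 0) : ContinuousAt (fun x : 𝔼 => Real.log ‖x‖) x :=
    continuousAt_id.norm.log (by simpa using hx)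
  set W : 𝔼 → ℝ := fun x => u x * Real.exp (β * Real.log ‖x‖) * η (Real.log ‖x‖) ^ k with hW
  have hWc : ContinuousOn W K := fun x hx => ContinuousAt.continuousWithinAt <|
    ((hu.contDiffAt (hK0 x hx)).continuousAt.mul
      (continuousAt_const.mul (hlogc x (hK0 x hx))).rexp).mul
      ((hηc.continuousAt.comp (hlogc x (hK0 x hx))).rpow_const (Or.inr hk.le))
  obtain ⟨x₀, hx₀K, hx₀max⟩ := hKc.exists_isMaxOn ⟨e, heK⟩ hWc
  have hx₀ := hK0 x₀ hx₀K
  have hWe : W e = u e := by simp [hW, hη, he]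
  have hue : 0 < u e := hu.pos he0
  obtain ⟨M, hM⟩ : ∃ M, W x₀ = M := ⟨_, rfl⟩
  have hMe : u e ≤ M := by rw [← hM, ← hWe]; exact hx₀max heK
  have hMpos : 0 < M := hue.trans_le hMe
  have hη₀ : 0 < η (Real.log ‖x₀‖) := by
    refine (hηnn x₀ hx₀K).lt_of_ne fun h => hMpos.ne' ?_
    rw [← hM]; simp [hW, ← h, Real.zero_rpow hk.ne']
  set G : ℝ → ℝ := fun t => Real.log M - k * Real.log (η t) with hG
  set s : ℝ → ℝ := fun t => 2 * k * ε ^ 2 * t / η t with hs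
  have hηd (t : ℝ) : HasDerivAt η (-(2 * ε ^ 2 * t)) t := by
    have := (((hasDerivAt_id t).pow 2).const_mul (ε ^ 2)).const_sub 1
    refine this.congr_deriv ?_
    simp; ring
  have hGd (t : ℝ) (ht : 0 < η t) : HasDerivAt G (s t) t := by
    refine ((((hηd t).log ht.ne').const_mul k).const_sub (Real.log M)).congr_deriv ?_
    simp only [hs]; field_simp
  have hsd (t : ℝ) (ht : 0 < η t) : HasDerivAt s
      (2 * k * ε ^ 2 / η t + 4 * k * ε ^ 4 * t ^ 2 / η t ^ 2) t := by
    refine (((hasDerivAt_id t).const_mul (2 * k * ε ^ 2)).div (hηd t) ht.ne').congr_deriv ?_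
    have := ht.ne'
    simp only [id]; field_simp; ring
  have hηC1 (t : ℝ) : ContDiffAt ℝ 1 η t := by
    simp only [hη]; fun_prop
  have hGC1 (t : ℝ) (ht : 0 < η t) : ContDiffAt ℝ 1 G t :=
    contDiffAt_const.sub (contDiffAt_const.mul ((hηC1 t).log ht.ne'))
  have hsC1 (t : ℝ) (ht : 0 < η t) : ContDiffAt ℝ 1 s t :=
    (contDiffAt_const.mul contDiffAt_id).div (hηC1 t) ht.ne'
  have hWu (x : 𝔼) (h : 0 < η (Real.log ‖x‖)) :
      radialProfile β G x * (Real.exp (β * Real.log ‖x‖) * η (Real.log ‖x‖) ^ k) = M := by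
    rw [radialProfile, Real.rpow_def_of_pos h, ← Real.exp_add, ← Real.exp_add]
    simp only [hG]
    rw [← Real.exp_log hMpos]
    simp only [Real.log_exp]
    ring_nf
  have hev : ∀ᶠ x in 𝓝 x₀, x ≠ 0 ∧ 0 < η (Real.log ‖x‖) :=
    (eventually_ne_nhds hx₀).and ((hηc.continuousAt.comp (hlogc x₀ hx₀)).eventually_const_lt hη₀)
  have hfac (x : 𝔼) (h : 0 < η (Real.log ‖x‖)) :
      0 < Real.exp (β * Real.log ‖x‖) * η (Real.log ‖x‖) ^ k :=
    mul_pos (Real.exp_pos _) (Real.rpow_pos_of_pos h _)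
  have heq : u x₀ = radialProfile β G x₀ := by
    refine mul_right_cancel₀ (hfac x₀ hη₀).ne' ?_
    rw [hWu x₀ hη₀, ← hM, ← mul_assoc]
  have hmax : IsLocalMax (fun x => u x - radialProfile β G x) x₀ := by
    filter_upwards [hev] with x hx
    rw [heq, sub_self, sub_nonpos]
    refine le_of_mul_le_mul_right ?_ (hfac x hx.2)
    rw [hWu x hx.2, ← hM, ← mul_assoc]
    exact hx₀max (hηpos x hx.1 hx.2)
  have hgradh (x : 𝔼) (hx : x ≠ 0 ∧ 0 < η (Real.log ‖x‖)) :
      HasGradientAt (radialProfile β G) (radialSlope β G s (Real.log ‖x‖) • x) x :=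
    hasGradientAt_radialProfile hx.1 (hGd _ hx.2)
  have hgu : gradient u x₀ = radialSlope β G s (Real.log ‖x₀‖) • x₀ := by
    have h1 := ((hu.contDiffAt hx₀).differentiableAt one_ne_zero).hasGradientAt.hasFDerivAt
    have h2 := (hgradh x₀ ⟨hx₀, hη₀⟩).hasFDerivAt
    have h3 := hmax.hasFDerivAt_eq_zero (h1.sub h2)
    rwa [sub_eq_zero, (InnerProductSpace.toDual ℝ 𝔼).injective.eq_iff] at h3
  have htouch := le_divergence_of_isLocalMax_sub hx₀ (fun x hx => hu.contDiffAt hx)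
    (fun x hx => continuousAt_lowerOrder (ρ := ρ) (lam := lam) (θ := θ) (q := q) hτ1 hu hx)
    (fun φ hφ => (weakE_univ_eq_integral hN hτ1 hu hφ).symm.trans (hweakE φ hφ))
    (hev.mono hgradh)
    (hev.mono fun x hx => contDiffAt_radialSlope (β := β) hx.1 (hGC1 _ hx.2) (hsC1 _ hx.2)) hmax
  have hid := lowerOrder_sub_divergence_radial (ρ := ρ) (lam := lam) (τ := τ) (θ := θ) hq hx₀
    (hGd _ hη₀) (hsd _ hη₀) heq hgu
  have hle := (hid.symm.trans_le (sub_nonpos.2 htouch))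
  have hle' := sub_nonpos.1 (nonpos_of_mul_nonpos_right hle (Real.exp_pos _))
  have hexp : Real.exp ((q - 1) * G (Real.log ‖x₀‖))
      = M ^ (q - 1) / η (Real.log ‖x₀‖) ^ 2 := by
    rw [Real.rpow_def_of_pos hMpos, ← Real.exp_log (pow_pos hη₀ 2), ← Real.exp_sub, Real.log_pow]
    simp only [hG, hkdef]
    congr 1
    push_cast
    field_simp
  rw [hexp, div_le_iff₀ (by positivity), mul_comm] at hle'
  calc u e ^ (q - 1) ≤ M ^ (q - 1) := Real.rpow_le_rpow hue.le hMe hq1.le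
    _ ≤ _ := hle'
    _ ≤ _ := sq_mul_add_fRho_le_cutoffBound hτ0 hτ1 hk hε rfl hη₀ hf

theorem tendsto_cutoffBound_zero {ρ lam τ β k : ℝ} (hτ1 : τ < 1) :
    Tendsto (cutoffBound ρ lam τ β k) (𝓝[>] 0) (𝓝 0) := by
  have hc : Continuous (cutoffBound ρ lam τ β k) := by
    have : Continuous fun ε : ℝ => (2 * k * ε) ^ (1 - τ) :=
      (by fun_prop : Continuous fun ε : ℝ => 2 * k * ε).rpow_const fun _ => Or.inr (by linarith)
    unfold cutoffBound
    fun_prop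
  have h0 : cutoffBound ρ lam τ β k 0 = 0 := by
    simp [cutoffBound, Real.zero_rpow (by linarith : 1 - τ ≠ 0)]
  simpa only [h0] using (hc.tendsto 0).mono_left nhdsWithin_le_nhds

end Nonexistence

/-- Equation (E) posed in `ℝ^N \ {0}` admits at least one positive solution
if and only if `f_ρ(β) > 0`, where `β = (θ+2)/(q-1)`. -/
theorem stmt0_existence_iff_fRho_beta_pos
    (N : ℕ) (hN : 2 ≤ N) (ρ lam τ θ q : ℝ)
    (hτ0 : 0 ≤ τ) (hτ1 : τ < 1) (hq : 1 < q) :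
    (∃ u : EuclideanSpace ℝ (Fin N) → ℝ, IsSolutionE N ρ lam τ θ q Set.univ u) ↔
      0 < fRho ρ lam τ ((θ + 2) / (q - 1)) := by
  refine ⟨fun ⟨u, hu⟩ => ?_, exists_isSolutionE_of_fRho_pos hN hτ1 hq⟩
  by_contra! hf
  have he : ‖(EuclideanSpace.single ⟨0, by omega⟩ 1 : EuclideanSpace ℝ (Fin N))‖ = 1 := by simp
  have hpos := hu.1.pos (norm_pos_iff.1 (he.symm ▸ one_pos))
  have hle := ge_of_tendsto (tendsto_cutoffBound_zero hτ1)
    (eventually_mem_nhdsWithin.mono fun ε hε =>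
      hu.rpow_le_cutoffBound hN hτ0 hτ1 hq hf he hε)
  exact (Real.rpow_pos_of_pos hpos (q - 1)).not_ge hle

end
end

section
/- Assume θ < −2 and f_ρ(β) > 0. Then every positive solution u of equation (E) in ℝ^N∖{0} is radially symmetric: there exists a C¹ function v on (0,∞) with u(x) = v(|x|) for all x ∈ ℝ^N∖{0}, v'(r) > 0 for all r > 0, and v(r) → 0 as r → 0⁺. -/
open MeasureTheory Filter Topology Real RealInnerProductSpace

noncomputable section

section GradientCalculus

variable {E : Type*} [NormedAddCommGroup E] [InnerProductSpace ℝ E] [CompleteSpace E]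

lemma HasDerivAt.comp_hasGradientAt {g : ℝ → ℝ} {g' : ℝ} {f : E → ℝ} {v x : E}
    (hg : HasDerivAt g g' (f x)) (hf : HasGradientAt f v x) :
    HasGradientAt (fun y => g (f y)) (g' • v) x := by
  rw [hasGradientAt_iff_hasFDerivAt] at hf ⊢
  rw [map_smul]
  exact hg.comp_hasFDerivAt x hf

lemma HasGradientAt.fun_add {f g : E → ℝ} {v w x : E}
    (hf : HasGradientAt f v x) (hg : HasGradientAt g w x) :
    HasGradientAt (fun y => f y + g y) (v + w) x := by
  rw [hasGradientAt_iff_hasFDerivAt] at hf hg ⊢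
  rw [map_add]
  exact hf.add hg

lemma HasGradientAt.fun_sub {f g : E → ℝ} {v w x : E}
    (hf : HasGradientAt f v x) (hg : HasGradientAt g w x) :
    HasGradientAt (fun y => f y - g y) (v - w) x := by
  rw [hasGradientAt_iff_hasFDerivAt] at hf hg ⊢
  rw [map_sub]
  exact hf.sub hg

lemma HasGradientAt.fun_mul {f g : E → ℝ} {v w x : E}
    (hf : HasGradientAt f v x) (hg : HasGradientAt g w x) :
    HasGradientAt (fun y => f y * g y) (f x • w + g x • v) x := by
  rw [hasGradientAt_iff_hasFDerivAt] at hf hg ⊢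
  rw [map_add, map_smul, map_smul]
  exact hf.mul hg

lemma HasGradientAt.fun_const_mul {f : E → ℝ} {v x : E} (c : ℝ)
    (hf : HasGradientAt f v x) : HasGradientAt (fun y => c * f y) (c • v) x := by
  rw [hasGradientAt_iff_hasFDerivAt] at hf ⊢
  rw [map_smul]
  exact hf.const_mul c

lemma hasGradientAt_inner_const (e x : E) : HasGradientAt (fun y => ⟪y, e⟫) e x := by
  rw [hasGradientAt_iff_hasFDerivAt]
  refine (InnerProductSpace.toDual ℝ E e).hasFDerivAt.congr_of_eventuallyEq
    (Eventually.of_forall fun y => ?_)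
  simp [real_inner_comm]

lemma hasGradientAt_norm_sub_sq (a x : E) :
    HasGradientAt (fun y => ‖y - a‖ ^ 2) ((2 : ℝ) • (x - a)) x := by
  rw [hasGradientAt_iff_hasFDerivAt]
  have h : HasFDerivAt (fun y => ‖y - a‖ ^ 2) _ x := ((hasFDerivAt_id x).sub_const a).norm_sq
  refine h.congr_fderiv ?_
  ext y
  simp [two_smul]

lemma hasGradientAt_log_norm {x : E} (hx : x ≠ 0) :
    HasGradientAt (fun y => Real.log ‖y‖) ((‖x‖ ^ 2)⁻¹ • x) x := by
  have h := hasGradientAt_norm_sub_sq (0 : E) x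
  simp only [sub_zero] at h
  have h2 : HasDerivAt (fun t : ℝ => (1 / 2 : ℝ) * Real.log t) ((1 / 2 : ℝ) * (‖x‖ ^ 2)⁻¹)
      (‖x‖ ^ 2) :=
    (Real.hasDerivAt_log (by positivity)).const_mul _
  have h3 := h2.comp_hasGradientAt (f := fun y => ‖y‖ ^ 2) h
  convert h3 using 1
  · ext y; rw [Real.log_pow]; push_cast; ring
  · rw [smul_smul]; congr 1; ring

lemma ContDiffOn.continuousOn_gradient {f : E → ℝ} {U : Set E} (hU : IsOpen U)
    (hf : ContDiffOn ℝ 1 f U) : ContinuousOn (gradient f) U :=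
  (InnerProductSpace.toDual ℝ E).symm.continuous.comp_continuousOn
    (hf.continuousOn_fderiv_of_isOpen hU le_rfl)

lemma ContDiffOn.hasGradientAt {f : E → ℝ} {U : Set E} (hU : IsOpen U)
    (hf : ContDiffOn ℝ 1 f U) {x : E} (hx : x ∈ U) : HasGradientAt f (gradient f x) x :=
  ((hf.differentiableOn one_ne_zero).differentiableAt (hU.mem_nhds hx)).hasGradientAt

lemma ContDiff.continuous_gradient {f : E → ℝ} (hf : ContDiff ℝ 1 f) :
    Continuous (gradient f) :=
  (InnerProductSpace.toDual ℝ E).symm.continuous.comp (hf.continuous_fderiv one_ne_zero)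

lemma contDiffOn_one_of_hasGradientAt {f : E → ℝ} {V : E → E} {U : Set E} (hU : IsOpen U)
    (hf : ∀ x ∈ U, HasGradientAt f (V x) x) (hV : ContinuousOn V U) : ContDiffOn ℝ 1 f U := by
  rw [show (1 : WithTop ℕ∞) = 0 + 1 by simp, contDiffOn_succ_iff_fderiv_of_isOpen hU]
  refine ⟨fun x hx => (hf x hx).differentiableAt.differentiableWithinAt, by simp, ?_⟩
  rw [contDiffOn_zero]
  exact ((InnerProductSpace.toDual ℝ E).continuous.comp_continuousOn hV).congr fun x hx =>
    (hasGradientAt_iff_hasFDerivAt.mp (hf x hx)).fderiv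

lemma tsupport_gradient_subset (f : E → ℝ) : tsupport (gradient f) ⊆ tsupport f := by
  refine (closure_mono fun x hx => ?_).trans (tsupport_fderiv_subset ℝ (f := f))
  rw [Function.mem_support] at hx ⊢
  intro h
  exact hx (by simp [gradient, h])

end GradientCalculus

section IntegrationByParts

variable {E : Type*} [NormedAddCommGroup E] [InnerProductSpace ℝ E]

lemma contDiff_of_contDiffAt_tsupport {f : E → ℝ}
    (h : ∀ x ∈ tsupport f, ContDiffAt ℝ 1 f x) : ContDiff ℝ 1 f := by
  rw [contDiff_iff_contDiffAt]
  intro x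
  by_cases hx : x ∈ tsupport f
  · exact h x hx
  · exact contDiffAt_const.congr_of_eventuallyEq (notMem_tsupport_iff_eventuallyEq.mp hx)

lemma continuous_mul_of_tsupport_subset {X : Type*} [TopologicalSpace X] {f g : X → ℝ}
    {U : Set X} (hU : IsOpen U) (hf : ContinuousOn f U) (hg : Continuous g) (hs : tsupport g ⊆ U) :
    Continuous fun x => f x * g x := by
  refine continuous_of_tsupport fun x hx => ?_
  have hx' : x ∈ U := hs (tsupport_mul_subset_right hx)
  exact (hf.continuousAt (hU.mem_nhds hx')).mul hg.continuousAt

variable [FiniteDimensional ℝ E] [MeasurableSpace E] [BorelSpace E]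

lemma integrable_mul_of_tsupport_subset {f g : E → ℝ} {U : Set E} (hU : IsOpen U)
    (hf : ContinuousOn f U) (hg : Continuous g) (hc : HasCompactSupport g)
    (hs : tsupport g ⊆ U) : Integrable (fun x => f x * g x) :=
  (continuous_mul_of_tsupport_subset hU hf hg hs).integrable_of_hasCompactSupport hc.mul_left

lemma integrable_inner_gradient {V : E → E} {φ : E → ℝ} {U : Set E} (hU : IsOpen U)
    (hV : ContinuousOn V U) (hφ : ContDiff ℝ 1 φ) (hc : HasCompactSupport φ)
    (hs : tsupport φ ⊆ U) : Integrable (fun x => ⟪V x, gradient φ x⟫) := by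
  have hsub : tsupport (fun x => ⟪V x, gradient φ x⟫) ⊆ tsupport φ := by
    refine (closure_mono fun x hx => ?_).trans (tsupport_gradient_subset φ)
    rw [Function.mem_support] at hx ⊢
    intro h
    exact hx (by simp [h])
  refine Continuous.integrable_of_hasCompactSupport ?_
    (hc.of_isClosed_subset (isClosed_tsupport _) hsub)
  refine continuous_of_tsupport fun x hx => ?_
  exact (hV.continuousAt (hU.mem_nhds (hs (hsub hx)))).inner
    hφ.continuous_gradient.continuousAt

/-- Integration by parts of a `C¹` vector field against the gradient of a test function. -/
lemma integral_inner_gradient_eq_neg_integral_trace {V : E → E} {φ : E → ℝ} {U : Set E}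
    (hU : IsOpen U) (hV : ContDiffOn ℝ 1 V U) (hφ : ContDiff ℝ 1 φ)
    (hc : HasCompactSupport φ) (hs : tsupport φ ⊆ U) :
    ∫ x, ⟪V x, gradient φ x⟫ = -∫ x, LinearMap.trace ℝ E (fderiv ℝ V x : E →ₗ[ℝ] E) * φ x := by
  set b := stdOrthonormalBasis ℝ E
  have hd : ContinuousOn (fderiv ℝ V) U := hV.continuousOn_fderiv_of_isOpen hU le_rfl
  have hdiff : ∀ x ∈ U, DifferentiableAt ℝ V x := fun x hx =>
    (hV.differentiableOn one_ne_zero).differentiableAt (hU.mem_nhds hx)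
  have hfd : ∀ i, ∀ x ∈ U, fderiv ℝ (fun y => ⟪V y, b i⟫) x (b i) = ⟪fderiv ℝ V x (b i), b i⟫ := by
    intro i x hx
    rw [fderiv_inner_apply ℝ (hdiff x hx) (differentiableAt_const _)]
    simp
  have hi1 : ∀ i, Integrable fun x => ⟪V x, b i⟫ * fderiv ℝ φ x (b i) := fun i =>
    integrable_mul_of_tsupport_subset hU (hV.continuousOn.inner continuousOn_const)
      ((hφ.continuous_fderiv one_ne_zero).clm_apply continuous_const)
      (hc.fderiv_apply ℝ (b i))
      ((tsupport_fderiv_apply_subset ℝ (b i)).trans hs)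
  have hi2 : ∀ i, Integrable fun x => ⟪fderiv ℝ V x (b i), b i⟫ * φ x := fun i =>
    integrable_mul_of_tsupport_subset hU
      ((hd.clm_apply continuousOn_const).inner continuousOn_const) hφ.continuous hc hs
  have hi2' : ∀ i, (fun x => fderiv ℝ (fun y => ⟪V y, b i⟫) x (b i) * φ x)
      = fun x => ⟪fderiv ℝ V x (b i), b i⟫ * φ x := by
    intro i
    ext x
    by_cases hx : x ∈ tsupport φ
    · rw [hfd i x (hs hx)]
    · simp [image_eq_zero_of_notMem_tsupport hx]
  have key : ∀ i, ∫ x, ⟪V x, b i⟫ * fderiv ℝ φ x (b i)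
      = -∫ x, ⟪fderiv ℝ V x (b i), b i⟫ * φ x := by
    intro i
    rw [integral_mul_fderiv_eq_neg_fderiv_mul_of_integrable (by rw [hi2']; exact hi2 i) (hi1 i)
      (integrable_mul_of_tsupport_subset hU (hV.continuousOn.inner continuousOn_const)
        hφ.continuous hc hs)
      (fun x hx => (hdiff x (hs hx)).inner ℝ (differentiableAt_const _))
      (fun x _ => hφ.differentiable one_ne_zero x), hi2']
  calc ∫ x, ⟪V x, gradient φ x⟫ = ∫ x, ∑ i, ⟪V x, b i⟫ * fderiv ℝ φ x (b i) := by
        refine integral_congr_ae (Eventually.of_forall fun x => ?_)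
        simp only
        rw [← b.sum_inner_mul_inner]
        refine Finset.sum_congr rfl fun i _ => ?_
        rw [real_inner_comm (gradient φ x) (b i), inner_gradient_left]
    _ = ∑ i, -∫ x, ⟪fderiv ℝ V x (b i), b i⟫ * φ x := by
        rw [integral_finsetSum _ fun i _ => hi1 i]
        exact Finset.sum_congr rfl fun i _ => key i
    _ = -∫ x, ∑ i, ⟪fderiv ℝ V x (b i), b i⟫ * φ x := by
        rw [integral_finsetSum _ fun i _ => hi2 i, Finset.sum_neg_distrib]
    _ = _ := by
        congr 1
        refine integral_congr_ae (Eventually.of_forall fun x => ?_)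
        simp only
        rw [← Finset.sum_mul, LinearMap.trace_eq_sum_inner _ b]
        congr 1
        refine Finset.sum_congr rfl fun i _ => ?_
        rw [real_inner_comm]
        rfl

end IntegrationByParts

section WeakLaplacian

variable {E : Type*} [NormedAddCommGroup E] [InnerProductSpace ℝ E] [FiniteDimensional ℝ E]
  [MeasurableSpace E] [BorelSpace E]

/-- `f` is `C¹` away from the origin and its distributional Laplacian there is the continuous
function `F`. -/
def HasWeakLaplacian (f F : E → ℝ) : Prop :=
  ContDiffOn ℝ 1 f {0}ᶜ ∧ ContinuousOn F {0}ᶜ ∧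
    ∀ φ : E → ℝ, ContDiff ℝ 1 φ → HasCompactSupport φ → tsupport φ ⊆ {0}ᶜ →
      ∫ x, ⟪gradient f x, gradient φ x⟫ = -∫ x, F x * φ x

lemma hasDerivAt_posPart_sq (t : ℝ) : HasDerivAt (fun s : ℝ => (max s 0) ^ 2) (2 * max t 0) t := by
  rcases lt_trichotomy t 0 with h | h | h
  · have : (fun s : ℝ => (max s 0) ^ 2) =ᶠ[𝓝 t] fun _ => 0 := by
      filter_upwards [Iio_mem_nhds h] with s hs
      simp [max_eq_right (Set.mem_Iio.mp hs).le]
    rw [max_eq_right h.le, mul_zero]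
    exact (hasDerivAt_const t (0 : ℝ)).congr_of_eventuallyEq this
  · subst h
    rw [hasDerivAt_iff_isLittleO]
    simp only [max_self, sub_zero, mul_zero, smul_zero]
    have : (fun s : ℝ => (max s 0) ^ 2 - 0 ^ 2) =O[𝓝 0] fun s : ℝ => s ^ 2 := by
      refine Asymptotics.IsBigO.of_bound 1 (Eventually.of_forall fun s => ?_)
      rcases le_total s 0 with hs | hs
      · simp [max_eq_right hs, sq_nonneg]
      · simp [max_eq_left hs]
    refine this.trans_isLittleO ?_
    simpa using (Asymptotics.isLittleO_pow_pow (𝕜 := ℝ) (m := 1) (n := 2) one_lt_two)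
  · have : (fun s : ℝ => (max s 0) ^ 2) =ᶠ[𝓝 t] fun s => s ^ 2 := by
      filter_upwards [Ioi_mem_nhds h] with s hs
      simp [max_eq_left (Set.mem_Ioi.mp hs).le]
    rw [max_eq_left h.le]
    simpa using (hasDerivAt_pow 2 t).congr_of_eventuallyEq this

lemma contDiff_posPart_sq : ContDiff ℝ 1 fun s : ℝ => (max s 0) ^ 2 := by
  rw [contDiff_one_iff_deriv]
  refine ⟨fun t => (hasDerivAt_posPart_sq t).differentiableAt, ?_⟩
  rw [funext fun t => (hasDerivAt_posPart_sq t).deriv]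
  fun_prop

lemma trace_fderiv_add_smul_sub {E : Type*} [NormedAddCommGroup E] [InnerProductSpace ℝ E]
    [FiniteDimensional ℝ E] {V : E → E} {x : E}
    (hV : DifferentiableAt ℝ V x) (η : ℝ) (a : E) :
    LinearMap.trace ℝ E (fderiv ℝ (fun y => V y + η • (y - a)) x : E →ₗ[ℝ] E)
      = LinearMap.trace ℝ E (fderiv ℝ V x : E →ₗ[ℝ] E) + η * Module.finrank ℝ E := by
  have h : fderiv ℝ (fun y => V y + η • (y - a)) x
      = fderiv ℝ V x + η • ContinuousLinearMap.id ℝ E := by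
    have := hV.hasFDerivAt.add (((hasFDerivAt_id x).sub_const a).const_smul η)
    exact this.fderiv
  rw [h]
  have h2 : ((fderiv ℝ V x + η • ContinuousLinearMap.id ℝ E : E →L[ℝ] E) : E →ₗ[ℝ] E)
      = (fderiv ℝ V x : E →ₗ[ℝ] E) + η • LinearMap.id := rfl
  rw [h2, map_add, map_smul, LinearMap.trace_id, smul_eq_mul]

/-- Weak maximum principle at a touching point: if `f - ψ` has a local maximum at `x₀`, then the
weak Laplacian of `f` at `x₀` is at most the Laplacian of the `C²` function `ψ`. -/
lemma HasWeakLaplacian.le_trace_of_isLocalMax {f F ψ : E → ℝ} (hf : HasWeakLaplacian f F)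
    {x₀ : E} (hx₀ : x₀ ≠ 0) {V : E → E} (hψ : ∀ᶠ x in 𝓝 x₀, HasGradientAt ψ (V x) x)
    (hV : ContDiffAt ℝ 1 V x₀) (hmax : IsLocalMax (fun x => f x - ψ x) x₀) :
    F x₀ ≤ LinearMap.trace ℝ E (fderiv ℝ V x₀ : E →ₗ[ℝ] E) := by
  obtain ⟨hf1, hFc, hweak⟩ := hf
  by_contra! hlt
  have hopen : IsOpen ({0}ᶜ : Set E) := isOpen_compl_singleton
  set n : ℝ := (Module.finrank ℝ E : ℝ)
  have hn : 0 ≤ n := Nat.cast_nonneg _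
  set T : E → ℝ := fun x => LinearMap.trace ℝ E (fderiv ℝ V x : E →ₗ[ℝ] E) with hT
  obtain ⟨η, hη, hηlt⟩ : ∃ η : ℝ, 0 < η ∧ T x₀ + 2 * η * n < F x₀ := by
    refine ⟨(F x₀ - T x₀) / (2 * (2 * n + 1)), by
      have : 0 < F x₀ - T x₀ := sub_pos.mpr hlt
      positivity, ?_⟩
    have h0 : 0 < F x₀ - T x₀ := sub_pos.mpr hlt
    have h1 : 2 * ((F x₀ - T x₀) / (2 * (2 * n + 1))) * n = (F x₀ - T x₀) * (n / (2 * n + 1)) := by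
      field_simp
    have h2 : n / (2 * n + 1) < 1 := by
      rw [div_lt_one (by positivity)]; linarith
    nlinarith
  have hVe : ∀ᶠ x in 𝓝 x₀, ContDiffAt ℝ 1 V x := hV.eventually (by simp)
  obtain ⟨U, hUo, hx₀U, hUV⟩ : ∃ U : Set E, IsOpen U ∧ x₀ ∈ U ∧
      ∀ x ∈ U, HasGradientAt ψ (V x) x ∧ ContDiffAt ℝ 1 V x ∧ x ∈ ({0}ᶜ : Set E)
        ∧ f x - ψ x ≤ f x₀ - ψ x₀ := by
    have := hψ.and (hVe.and ((hopen.eventually_mem hx₀).and hmax))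
    obtain ⟨U, h1, h2, h3⟩ := eventually_nhds_iff.mp this
    exact ⟨U, h2, h3, h1⟩
  have hVU : ContDiffOn ℝ 1 V U := fun x hx => (hUV x hx).2.1.contDiffWithinAt
  have hTc : ContinuousOn T U := by
    have h1 := hVU.continuousOn_fderiv_of_isOpen hUo le_rfl
    have h2 : Continuous fun L : E →L[ℝ] E => LinearMap.trace ℝ E (L : E →ₗ[ℝ] E) :=
      LinearMap.continuous_of_finiteDimensional
        ((LinearMap.trace ℝ E) ∘ₗ (ContinuousLinearMap.coeLM ℝ))
    exact h2.comp_continuousOn h1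
  have hU0 : U ⊆ {0}ᶜ := fun x hx => (hUV x hx).2.2.1
  obtain ⟨r, hr, hball⟩ : ∃ r > 0, Metric.ball x₀ r ⊆ U ∩ {x | T x + 2 * η * n < F x} := by
    have hc : ContinuousAt (fun x => F x - T x) x₀ :=
      ((hFc.mono hU0).sub hTc).continuousAt (hUo.mem_nhds hx₀U)
    have : ∀ᶠ x in 𝓝 x₀, 2 * η * n < F x - T x :=
      hc.eventually (lt_mem_nhds (by linarith))
    obtain ⟨r, hr, h⟩ := Metric.eventually_nhds_iff_ball.mp (this.and (hUo.eventually_mem hx₀U))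
    exact ⟨r, hr, fun x hx => ⟨(h x hx).2, lt_sub_iff_add_lt'.mp (h x hx).1⟩⟩
  set d : E → ℝ := fun x => f x - ψ x - η * ‖x - x₀‖ ^ 2 - (f x₀ - ψ x₀ - η * r ^ 2 / 2) with hd
  set W : E → E := fun x => V x + (2 * η) • (x - x₀) with hW
  have hdg : ∀ x ∈ U, HasGradientAt d (gradient f x - W x) x := by
    intro x hx
    have h1 := ((hf1.hasGradientAt hopen (hU0 hx)).fun_sub (hUV x hx).1).fun_sub
      ((hasGradientAt_norm_sub_sq x₀ x).fun_const_mul η)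
    have h2 := h1.fun_sub (hasGradientAt_const x (f x₀ - ψ x₀ - η * r ^ 2 / 2))
    convert h2 using 1
    simp only [hW, smul_smul, mul_comm η 2, sub_zero, sub_sub]
  have hdc : ContDiffOn ℝ 1 d U := by
    refine contDiffOn_one_of_hasGradientAt hUo hdg ?_
    refine ((hf1.continuousOn_gradient hopen).mono hU0).sub ?_
    exact hVU.continuousOn.add (by fun_prop)
  classical
  set φ : E → ℝ := fun x => if x ∈ Metric.ball x₀ r then (max (d x) 0) ^ 2 else 0 with hφ
  have hsupp : Function.support φ ⊆ Metric.closedBall x₀ (r * (3 / 4)) := by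
    intro x hx
    rw [Function.mem_support] at hx
    by_cases hxb : x ∈ Metric.ball x₀ r
    · have hpos : 0 < d x := by
        by_contra! hle
        exact hx (by simp [hφ, max_eq_right hle])
      have h1 := (hUV x (hball hxb).1).2.2.2
      have h2 : η * ‖x - x₀‖ ^ 2 < η * (r ^ 2 / 2) := by
        simp only [hd] at hpos; linarith
      have h3 : ‖x - x₀‖ ^ 2 < r ^ 2 / 2 := lt_of_mul_lt_mul_left h2 hη.le
      rw [Metric.mem_closedBall, dist_eq_norm]
      nlinarith [norm_nonneg (x - x₀)]
    · exact absurd (by simp only [hφ, if_neg hxb]) hx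
  have htsupp : tsupport φ ⊆ Metric.closedBall x₀ (r * (3 / 4)) :=
    closure_minimal hsupp Metric.isClosed_closedBall
  have htb : tsupport φ ⊆ Metric.ball x₀ r :=
    htsupp.trans (Metric.closedBall_subset_ball (by linarith))
  have htU : tsupport φ ⊆ U := fun x hx => (hball (htb hx)).1
  have hcs : HasCompactSupport φ :=
    (isCompact_closedBall x₀ (r * (3 / 4))).of_isClosed_subset (isClosed_tsupport _) htsupp
  have heq : ∀ x ∈ Metric.ball x₀ r, φ =ᶠ[𝓝 x] fun y => (max (d y) 0) ^ 2 := by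
    intro x hx
    filter_upwards [Metric.isOpen_ball.mem_nhds hx] with y hy
    simp only [hφ, if_pos hy]
  have hφc : ContDiff ℝ 1 φ := by
    refine contDiff_of_contDiffAt_tsupport fun x hx => ?_
    have hxU := hUo.mem_nhds (htU hx)
    exact (contDiff_posPart_sq.contDiffAt.comp x (hdc.contDiffAt hxU)).congr_of_eventuallyEq
      (heq x (htb hx))
  have hφg : ∀ x ∈ tsupport φ, gradient φ x = (2 * max (d x) 0) • (gradient f x - W x) := by
    intro x hx
    rw [(heq x (htb hx)).gradient_eq]
    exact ((hasDerivAt_posPart_sq (d x)).comp_hasGradientAt (hdg x (htU hx))).gradient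
  have hWc : ContDiffOn ℝ 1 W U := hVU.add (by fun_prop)
  have hWT : ∀ x ∈ U, LinearMap.trace ℝ E (fderiv ℝ W x : E →ₗ[ℝ] E) = T x + 2 * η * n :=
    fun x hx => trace_fderiv_add_smul_sub ((hUV x hx).2.1.differentiableAt one_ne_zero) _ _
  have hnn : 0 ≤ ∫ x, ⟪gradient f x - W x, gradient φ x⟫ := by
    refine integral_nonneg fun x => ?_
    by_cases hx : x ∈ tsupport φ
    · simp only [Pi.zero_apply]
      rw [hφg x hx, inner_smul_right]
      exact mul_nonneg (by positivity) real_inner_self_nonneg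
    · have : gradient φ x = 0 :=
        image_eq_zero_of_notMem_tsupport fun h => hx (tsupport_gradient_subset φ h)
      simp [this]
  have hval : ∫ x, ⟪gradient f x - W x, gradient φ x⟫
      = -∫ x, (F x - LinearMap.trace ℝ E (fderiv ℝ W x : E →ₗ[ℝ] E)) * φ x := by
    simp only [inner_sub_left, sub_mul]
    have hTW : ContinuousOn (fun x => LinearMap.trace ℝ E (fderiv ℝ W x : E →ₗ[ℝ] E)) U :=
      (hTc.add continuousOn_const).congr hWT
    rw [integral_sub (integrable_inner_gradient hopen (hf1.continuousOn_gradient hopen) hφc hcs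
        (htU.trans hU0)) (integrable_inner_gradient hUo hWc.continuousOn hφc hcs htU),
      integral_sub (integrable_mul_of_tsupport_subset hopen hFc hφc.continuous hcs (htU.trans hU0))
        (integrable_mul_of_tsupport_subset hUo hTW hφc.continuous hcs htU),
      hweak φ hφc hcs (htU.trans hU0),
      integral_inner_gradient_eq_neg_integral_trace hUo hWc hφc hcs htU]
    ring
  have hφnn : ∀ x, 0 ≤ φ x := by
    intro x
    simp only [hφ]
    split_ifs <;> positivity
  have hpos : 0 < ∫ x, (F x - LinearMap.trace ℝ E (fderiv ℝ W x : E →ₗ[ℝ] E)) * φ x := by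
    have hTW : ContinuousOn (fun x => F x - LinearMap.trace ℝ E (fderiv ℝ W x : E →ₗ[ℝ] E)) U :=
      (hFc.mono hU0).sub ((hTc.add continuousOn_const).congr hWT)
    refine Continuous.integral_pos_of_hasCompactSupport_nonneg_nonzero (x := x₀)
      (continuous_mul_of_tsupport_subset hUo hTW hφc.continuous htU) hcs.mul_left ?_ ?_
    · intro x
      by_cases hx : x ∈ tsupport φ
      · refine mul_nonneg ?_ (hφnn x)
        rw [hWT x (htU hx)]
        have : T x + 2 * η * n < F x := (hball (htb hx)).2
        linarith
      · simp [image_eq_zero_of_notMem_tsupport hx]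
    · have h1 : φ x₀ ≠ 0 := by
        have : d x₀ = η * r ^ 2 / 2 := by simp [hd]
        simp only [hφ, Metric.mem_ball_self hr, if_true, this]
        have : 0 < η * r ^ 2 / 2 := by positivity
        rw [max_eq_left this.le]
        positivity
      refine mul_ne_zero ?_ h1
      rw [hWT x₀ hx₀U]
      linarith
  linarith

end WeakLaplacian

section WeakLaplacianAlgebra

variable {E : Type*} [NormedAddCommGroup E] [InnerProductSpace ℝ E] [FiniteDimensional ℝ E]
  [MeasurableSpace E] [BorelSpace E]

lemma HasWeakLaplacian.sub_const_mul {f F g G : E → ℝ} (hf : HasWeakLaplacian f F)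
    (hg : HasWeakLaplacian g G) (c : ℝ) :
    HasWeakLaplacian (fun x => f x - c * g x) (fun x => F x - c * G x) := by
  have hopen : IsOpen ({0}ᶜ : Set E) := isOpen_compl_singleton
  refine ⟨hf.1.sub (contDiffOn_const.mul hg.1), hf.2.1.sub (continuousOn_const.mul hg.2.1), ?_⟩
  intro φ hφ hc hs
  have h1 : ∫ x, ⟪gradient (fun x => f x - c * g x) x, gradient φ x⟫
      = ∫ x, (⟪gradient f x, gradient φ x⟫ - c * ⟪gradient g x, gradient φ x⟫) := by
    refine integral_congr_ae (Eventually.of_forall fun x => ?_)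
    simp only
    by_cases hx : x ∈ tsupport φ
    · rw [((hf.1.hasGradientAt hopen (hs hx)).fun_sub
        ((hg.1.hasGradientAt hopen (hs hx)).fun_const_mul c)).gradient, inner_sub_left,
        real_inner_smul_left]
    · have : gradient φ x = 0 :=
        image_eq_zero_of_notMem_tsupport fun h => hx (tsupport_gradient_subset φ h)
      simp [this]
  have hi := integrable_inner_gradient hopen (hf.1.continuousOn_gradient hopen) hφ hc hs
  have hj := integrable_inner_gradient hopen (hg.1.continuousOn_gradient hopen) hφ hc hs
  rw [h1, integral_sub hi (hj.const_mul c), integral_const_mul, hf.2.2 φ hφ hc hs,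
    hg.2.2 φ hφ hc hs]
  simp only [sub_mul, mul_assoc]
  rw [integral_sub (integrable_mul_of_tsupport_subset hopen hf.2.1 hφ.continuous hc hs)
    ((integrable_mul_of_tsupport_subset hopen hg.2.1 hφ.continuous hc hs).const_mul c),
    integral_const_mul]
  ring

lemma HasWeakLaplacian.zero : HasWeakLaplacian (fun _ : E => 0) (fun _ => 0) := by
  refine ⟨contDiffOn_const, continuousOn_const, fun φ _ _ _ => ?_⟩
  simp

lemma HasWeakLaplacian.neg {f F : E → ℝ} (hf : HasWeakLaplacian f F) :
    HasWeakLaplacian (fun x => -f x) (fun x => -F x) := by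
  simpa using HasWeakLaplacian.zero.sub_const_mul hf 1

lemma HasGradientAt.comp_linearIsometryEquiv {E : Type*} [NormedAddCommGroup E]
    [InnerProductSpace ℝ E] [CompleteSpace E] {f : E → ℝ} {v x : E} (O : E ≃ₗᵢ[ℝ] E)
    (hf : HasGradientAt f v (O x)) : HasGradientAt (fun y => f (O y)) (O.symm v) x := by
  rw [hasGradientAt_iff_hasFDerivAt] at hf ⊢
  have h := hf.comp x O.toContinuousLinearEquiv.hasFDerivAt
  refine h.congr_fderiv ?_
  ext y
  simp only [ContinuousLinearMap.comp_apply, InnerProductSpace.toDual_apply_apply]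
  rw [← O.symm.inner_map_map v]
  simp

lemma HasWeakLaplacian.comp_linearIsometryEquiv {f F : E → ℝ} (hf : HasWeakLaplacian f F)
    (O : E ≃ₗᵢ[ℝ] E) : HasWeakLaplacian (fun x => f (O x)) (fun x => F (O x)) := by
  have hopen : IsOpen ({0}ᶜ : Set E) := isOpen_compl_singleton
  have hmaps : Set.MapsTo O {0}ᶜ {0}ᶜ := fun x hx => by simpa using hx
  refine ⟨hf.1.comp O.contDiff.contDiffOn hmaps, hf.2.1.comp O.continuous.continuousOn hmaps, ?_⟩
  intro φ hφ hc hs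
  set χ : E → ℝ := fun y => φ (O.symm y) with hχ
  have hχ1 : ContDiff ℝ 1 χ := hφ.comp O.symm.contDiff
  have hχc : HasCompactSupport χ := hc.comp_homeomorph O.symm.toHomeomorph
  have hχs : tsupport χ ⊆ {0}ᶜ := by
    have h1 : tsupport χ ⊆ O.symm ⁻¹' tsupport φ :=
      tsupport_comp_subset_preimage φ O.symm.continuous
    intro y hy
    simpa using hs (h1 hy)
  have h1 := hf.2.2 χ hχ1 hχc hχs
  have h2 : ∫ x, ⟪gradient (fun x => f (O x)) x, gradient φ x⟫
      = ∫ x, ⟪gradient f (O x), gradient χ (O x)⟫ := by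
    refine integral_congr_ae (Eventually.of_forall fun x => ?_)
    simp only
    by_cases hx : x ∈ tsupport φ
    · rw [(HasGradientAt.comp_linearIsometryEquiv O
        (hf.1.hasGradientAt hopen (hmaps (hs hx)))).gradient]
      have h3 : HasGradientAt χ (O (gradient φ x)) (O x) := by
        have h4 : HasGradientAt φ (gradient φ x) (O.symm (O x)) := by
          rw [O.symm_apply_apply]
          exact (hφ.differentiable one_ne_zero x).hasGradientAt
        exact h4.comp_linearIsometryEquiv O.symm
      rw [h3.gradient, ← O.inner_map_map, O.apply_symm_apply]
    · have h5 : gradient φ x = 0 :=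
        image_eq_zero_of_notMem_tsupport fun h => hx (tsupport_gradient_subset φ h)
      have h6 : O x ∉ tsupport χ := fun h =>
        hx (by simpa using tsupport_comp_subset_preimage φ O.symm.continuous h)
      have h7 : gradient χ (O x) = 0 :=
        image_eq_zero_of_notMem_tsupport fun h => h6 (tsupport_gradient_subset χ h)
      rw [h5, h7, inner_zero_right, inner_zero_right]
  have h3 : ∫ x, F (O x) * φ x = ∫ x, F (O x) * χ (O x) := by simp [hχ]
  have hO := O.measurePreserving
  have hemb : MeasurableEmbedding O := O.toHomeomorph.measurableEmbedding
  rw [h2, h3, hO.integral_comp hemb (fun y => ⟪gradient f y, gradient χ y⟫),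
    hO.integral_comp hemb (fun y => F y * χ y), h1]

end WeakLaplacianAlgebra

section TouchingFunctions

variable {E : Type*} [NormedAddCommGroup E] [InnerProductSpace ℝ E] [FiniteDimensional ℝ E]

/-- The cosine of the angle between `x` and the unit vector `e`. -/
noncomputable def angleCos (e x : E) : ℝ := ⟪x, e⟫ * ‖x‖⁻¹

/-- The gradient of `x ↦ g (log ‖x‖) + A (3 h - h ^ 2)` with `h = angleCos e x` and `g' = g₁`. -/
noncomputable def touchField (g₁ : ℝ → ℝ) (A : ℝ) (e x : E) : E :=
  ((g₁ (Real.log ‖x‖) - A * ((3 - 2 * angleCos e x) * angleCos e x)) * (‖x‖⁻¹ * ‖x‖⁻¹)) • x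
    + (A * (3 - 2 * angleCos e x) * ‖x‖⁻¹) • e

lemma hasGradientAt_inv_norm {x : E} (hx : x ≠ 0) :
    HasGradientAt (fun y : E => ‖y‖⁻¹) (-(‖x‖⁻¹ * (‖x‖⁻¹ * ‖x‖⁻¹)) • x) x := by
  have h1 : HasDerivAt (fun t : ℝ => Real.exp (-t)) (Real.exp (-Real.log ‖x‖) * (-1))
      (Real.log ‖x‖) := (hasDerivAt_neg _).exp
  have h2 := h1.comp_hasGradientAt (f := fun y : E => Real.log ‖y‖)
    (hasGradientAt_log_norm hx)
  have hpos : 0 < ‖x‖ := norm_pos_iff.mpr hx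
  have h3 : HasGradientAt (fun y : E => ‖y‖⁻¹)
      ((Real.exp (-Real.log ‖x‖) * (-1)) • (‖x‖ ^ 2)⁻¹ • x) x := by
    refine h2.congr_of_eventuallyEq ?_
    filter_upwards [isOpen_compl_singleton.mem_nhds hx] with y hy
    rw [Real.exp_neg, Real.exp_log (norm_pos_iff.mpr hy)]
  convert h3 using 1
  rw [Real.exp_neg, Real.exp_log hpos, smul_smul]
  congr 1
  field_simp

lemma hasGradientAt_angleCos (e : E) {x : E} (hx : x ≠ 0) :
    HasGradientAt (angleCos e)
      (‖x‖⁻¹ • e - (angleCos e x * (‖x‖⁻¹ * ‖x‖⁻¹)) • x) x := by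
  have h := (hasGradientAt_inner_const e x).fun_mul (hasGradientAt_inv_norm hx)
  convert h using 1
  · rfl
  · rw [angleCos]
    module

lemma hasGradientAt_touchField {g g₁ : ℝ → ℝ} {A : ℝ} {e x : E} (hx : x ≠ 0)
    (hg : HasDerivAt g (g₁ (Real.log ‖x‖)) (Real.log ‖x‖)) :
    HasGradientAt (fun y => g (Real.log ‖y‖) + A * (3 * angleCos e y - angleCos e y ^ 2))
      (touchField g₁ A e x) x := by
  have h1 := hg.comp_hasGradientAt (f := fun y : E => Real.log ‖y‖)
    (hasGradientAt_log_norm hx)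
  have h2 : HasDerivAt (fun t : ℝ => A * (3 * t - t ^ 2)) (A * (3 - 2 * angleCos e x))
      (angleCos e x) := by
    have := (((hasDerivAt_id (angleCos e x)).const_mul 3).sub
      (hasDerivAt_pow 2 (angleCos e x))).const_mul A
    simpa using this
  have h3 := h1.fun_add (h2.comp_hasGradientAt (hasGradientAt_angleCos e hx))
  convert h3 using 1
  have hpos : 0 < ‖x‖ := norm_pos_iff.mpr hx
  rw [touchField]
  have e1 : (‖x‖ ^ 2)⁻¹ = ‖x‖⁻¹ * ‖x‖⁻¹ := by rw [sq, mul_inv]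
  rw [e1]
  module

lemma contDiffAt_angleCos {E : Type*} [NormedAddCommGroup E] [InnerProductSpace ℝ E] (e : E)
    {x : E} (hx : x ≠ 0) : ContDiffAt ℝ 1 (angleCos e) x := by
  unfold angleCos
  exact (contDiffAt_id.inner ℝ contDiffAt_const).mul
    ((contDiffAt_norm ℝ hx).inv (norm_ne_zero_iff.mpr hx))

lemma contDiffAt_touchField {E : Type*} [NormedAddCommGroup E] [InnerProductSpace ℝ E]
    {g₁ : ℝ → ℝ} {A : ℝ} {e x : E} (hx : x ≠ 0)
    (hg : ContDiffAt ℝ 1 g₁ (Real.log ‖x‖)) : ContDiffAt ℝ 1 (touchField g₁ A e) x := by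
  have hn : ContDiffAt ℝ 1 (fun y : E => ‖y‖) x := contDiffAt_norm ℝ hx
  have hi : ContDiffAt ℝ 1 (fun y : E => ‖y‖⁻¹) x := hn.inv (norm_ne_zero_iff.mpr hx)
  have hl : ContDiffAt ℝ 1 (fun y : E => g₁ (Real.log ‖y‖)) x :=
    hg.comp x (hn.log (norm_ne_zero_iff.mpr hx))
  have ha := contDiffAt_angleCos e hx
  have hb : ContDiffAt ℝ 1 (fun y => 3 - 2 * angleCos e y) x :=
    contDiffAt_const.sub (contDiffAt_const.mul ha)
  unfold touchField
  exact (((hl.sub (contDiffAt_const.mul (hb.mul ha))).mul (hi.mul hi)).smul contDiffAt_id).add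
    (((contDiffAt_const.mul hb).mul hi).smul contDiffAt_const)

lemma trace_fderiv_smul_add_smul_const {a b : E → ℝ} {x va vb : E} (e : E)
    (ha : HasGradientAt a va x) (hb : HasGradientAt b vb x) :
    LinearMap.trace ℝ E (fderiv ℝ (fun y => a y • y + b y • e) x : E →ₗ[ℝ] E)
      = ⟪va, x⟫ + a x * Module.finrank ℝ E + ⟪vb, e⟫ := by
  have h := ((hasGradientAt_iff_hasFDerivAt.mp ha).smul (hasFDerivAt_id x)).add
    ((hasGradientAt_iff_hasFDerivAt.mp hb).smul_const e)
  have h' : fderiv ℝ (fun y => a y • y + b y • e) x = _ := h.fderiv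
  rw [h']
  have h2 : ((a x • ContinuousLinearMap.id ℝ E
      + (InnerProductSpace.toDual ℝ E va).smulRight (id x)
      + (InnerProductSpace.toDual ℝ E vb).smulRight e : E →L[ℝ] E) : E →ₗ[ℝ] E)
      = a x • LinearMap.id + LinearMap.smulRight (InnerProductSpace.toDual ℝ E va : E →ₗ[ℝ] ℝ) x
        + LinearMap.smulRight (InnerProductSpace.toDual ℝ E vb : E →ₗ[ℝ] ℝ) e := rfl
  rw [h2, map_add, map_add, map_smul, LinearMap.trace_id, LinearMap.trace_smulRight,
    LinearMap.trace_smulRight, smul_eq_mul]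
  simp only [ContinuousLinearMap.coe_coe, InnerProductSpace.toDual_apply_apply]
  ring

lemma trace_fderiv_touchField {g₁ : ℝ → ℝ} {g₂ A : ℝ} {e x : E} (hx : x ≠ 0) (he : ‖e‖ = 1)
    (hg : HasDerivAt g₁ g₂ (Real.log ‖x‖)) :
    ‖x‖ ^ 2 * LinearMap.trace ℝ E (fderiv ℝ (touchField g₁ A e) x : E →ₗ[ℝ] E)
      = g₂ + (Module.finrank ℝ E - 2) * g₁ (Real.log ‖x‖)
        + A * (-2 * (1 - angleCos e x ^ 2)
          - (Module.finrank ℝ E - 1) * ((3 - 2 * angleCos e x) * angleCos e x)) := by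
  have hi := hasGradientAt_inv_norm hx
  have hh := hasGradientAt_angleCos e hx
  have hk : HasDerivAt (fun t : ℝ => A * ((3 - 2 * t) * t)) (A * (3 - 4 * angleCos e x))
      (angleCos e x) := by
    have := (((((hasDerivAt_id (angleCos e x)).const_mul 2).const_sub 3).mul
      (hasDerivAt_id (angleCos e x)))).const_mul A
    refine this.congr_deriv ?_
    simp only [id]; ring
  have hk1 : HasDerivAt (fun t : ℝ => A * (3 - 2 * t)) (A * (-2)) (angleCos e x) := by
    have := ((((hasDerivAt_id (angleCos e x)).const_mul 2).const_sub 3)).const_mul A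
    refine this.congr_deriv ?_
    ring
  have ha := ((hg.comp_hasGradientAt (f := fun y : E => Real.log ‖y‖)
    (hasGradientAt_log_norm hx)).fun_sub
    (hk.comp_hasGradientAt hh)).fun_mul (hi.fun_mul hi)
  have hb := (hk1.comp_hasGradientAt hh).fun_mul hi
  have hpos : 0 < ‖x‖ := norm_pos_iff.mpr hx
  have htr := trace_fderiv_smul_add_smul_const e ha hb
  have hxe : ⟪x, e⟫ = angleCos e x * ‖x‖ := by
    rw [angleCos]; field_simp
  unfold touchField
  rw [htr]
  simp only [inner_add_left, inner_sub_left, real_inner_smul_left, real_inner_self_eq_norm_sq,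
    real_inner_comm x e, hxe, he]
  generalize angleCos e x = h
  field_simp
  ring

variable [MeasurableSpace E] [BorelSpace E]

lemma HasWeakLaplacian.le_of_isLocalMax_sub_touch {f F : E → ℝ} (hf : HasWeakLaplacian f F)
    {x₀ e : E} (hx₀ : x₀ ≠ 0) (he : ‖e‖ = 1) {g g₁ : ℝ → ℝ} {g₂ A : ℝ}
    (hg : ∀ᶠ s in 𝓝 (Real.log ‖x₀‖), HasDerivAt g (g₁ s) s)
    (hg₁ : ContDiffAt ℝ 1 g₁ (Real.log ‖x₀‖)) (hg₂ : HasDerivAt g₁ g₂ (Real.log ‖x₀‖))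
    (hmax : IsLocalMax
      (fun x => f x - (g (Real.log ‖x‖) + A * (3 * angleCos e x - angleCos e x ^ 2))) x₀) :
    gradient f x₀ = touchField g₁ A e x₀ ∧
    ‖x₀‖ ^ 2 * F x₀ ≤ g₂ + (Module.finrank ℝ E - 2) * g₁ (Real.log ‖x₀‖)
        + A * (-2 * (1 - angleCos e x₀ ^ 2)
          - (Module.finrank ℝ E - 1) * ((3 - 2 * angleCos e x₀) * angleCos e x₀)) := by
  have hopen : IsOpen ({0}ᶜ : Set E) := isOpen_compl_singleton
  constructor
  · have h := (hf.1.hasGradientAt hopen hx₀).fun_sub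
      (hasGradientAt_touchField (A := A) (e := e) hx₀ hg.self_of_nhds)
    have h0 := hmax.hasFDerivAt_eq_zero (hasGradientAt_iff_hasFDerivAt.mp h)
    rw [LinearIsometryEquiv.map_eq_zero_iff] at h0
    exact sub_eq_zero.mp h0
  · rw [← trace_fderiv_touchField hx₀ he hg₂]
    refine mul_le_mul_of_nonneg_left ?_ (sq_nonneg _)
    refine hf.le_trace_of_isLocalMax hx₀ ?_ (contDiffAt_touchField hx₀ hg₁) hmax
    have hlog : ContinuousAt (fun x : E => Real.log ‖x‖) x₀ :=
      (hasGradientAt_log_norm hx₀).differentiableAt.continuousAt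
    filter_upwards [hlog.eventually hg, hopen.eventually_mem hx₀] with x hx1 hx2
    exact hasGradientAt_touchField hx2 hx1

end TouchingFunctions

section LogSolution

variable {E : Type*} [NormedAddCommGroup E] [InnerProductSpace ℝ E] [FiniteDimensional ℝ E]
  [MeasurableSpace E] [BorelSpace E]

/-- The equation satisfied by the logarithm `w` of a positive solution, in terms of
`w + β log ‖x‖`. -/
def IsLogSolution (ρ lam τ q β : ℝ) (w : E → ℝ) : Prop :=
  HasWeakLaplacian w fun x => (‖x‖ ^ 2)⁻¹ *
    (-(‖x‖ * ‖gradient w x‖) ^ 2 + (Module.finrank ℝ E - 2 + 2 * ρ) * ⟪x, gradient w x⟫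
      - lam * (‖x‖ * ‖gradient w x‖) ^ (1 - τ) + Real.exp ((q - 1) * (w x + β * Real.log ‖x‖)))

lemma touchField_zero {E : Type*} [NormedAddCommGroup E] [InnerProductSpace ℝ E]
    (g₁ : ℝ → ℝ) (e x : E) :
    touchField g₁ 0 e x = (g₁ (Real.log ‖x‖) * (‖x‖⁻¹ * ‖x‖⁻¹)) • x := by
  simp [touchField]

lemma norm_mul_norm_smul_inv_sq {E : Type*} [NormedAddCommGroup E] [InnerProductSpace ℝ E]
    (a : ℝ) {x : E} (hx : x ≠ 0) : ‖x‖ * ‖(a * (‖x‖⁻¹ * ‖x‖⁻¹)) • x‖ = |a| := by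
  have hpos : 0 < ‖x‖ := norm_pos_iff.mpr hx
  rw [norm_smul, norm_mul, norm_mul, norm_inv, norm_norm, Real.norm_eq_abs]
  field_simp

lemma inner_smul_inv_sq {E : Type*} [NormedAddCommGroup E] [InnerProductSpace ℝ E]
    (a : ℝ) {x : E} (hx : x ≠ 0) : ⟪x, (a * (‖x‖⁻¹ * ‖x‖⁻¹)) • x⟫ = a := by
  have hpos : 0 < ‖x‖ := norm_pos_iff.mpr hx
  rw [real_inner_smul_right, real_inner_self_eq_norm_sq]
  field_simp

variable {ρ lam τ q β : ℝ} {w : E → ℝ}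

lemma IsLogSolution.exp_le_of_isLocalMax (hw : IsLogSolution ρ lam τ q β w) {x₀ : E}
    (hx₀ : x₀ ≠ 0) {g g₁ : ℝ → ℝ} {g₂ : ℝ}
    (hg : ∀ᶠ s in 𝓝 (Real.log ‖x₀‖), HasDerivAt g (g₁ s) s)
    (hg₁ : ContDiffAt ℝ 1 g₁ (Real.log ‖x₀‖)) (hg₂ : HasDerivAt g₁ g₂ (Real.log ‖x₀‖))
    (hmax : IsLocalMax (fun x => w x - g (Real.log ‖x‖)) x₀) :
    Real.exp ((q - 1) * (w x₀ + β * Real.log ‖x₀‖)) ≤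
      g₂ + g₁ (Real.log ‖x₀‖) ^ 2 - 2 * ρ * g₁ (Real.log ‖x₀‖)
        + lam * |g₁ (Real.log ‖x₀‖)| ^ (1 - τ) := by
  have hpos : 0 < ‖x₀‖ := norm_pos_iff.mpr hx₀
  have he : ‖(‖x₀‖⁻¹ • x₀)‖ = 1 := by
    rw [norm_smul, norm_inv, norm_norm, inv_mul_cancel₀ hpos.ne']
  obtain ⟨h1, h2⟩ := HasWeakLaplacian.le_of_isLocalMax_sub_touch hw hx₀ he (A := 0) hg hg₁ hg₂
    (by simpa using hmax)
  rw [touchField_zero] at h1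
  rw [← mul_assoc, mul_inv_cancel₀ (by positivity), one_mul, h1,
    norm_mul_norm_smul_inv_sq _ hx₀, inner_smul_inv_sq _ hx₀, sq_abs] at h2
  linarith

lemma IsLogSolution.le_exp_of_isLocalMin (hw : IsLogSolution ρ lam τ q β w) {x₀ : E}
    (hx₀ : x₀ ≠ 0) {g g₁ : ℝ → ℝ} {g₂ : ℝ}
    (hg : ∀ᶠ s in 𝓝 (Real.log ‖x₀‖), HasDerivAt g (g₁ s) s)
    (hg₁ : ContDiffAt ℝ 1 g₁ (Real.log ‖x₀‖)) (hg₂ : HasDerivAt g₁ g₂ (Real.log ‖x₀‖))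
    (hmin : IsLocalMin (fun x => w x - g (Real.log ‖x‖)) x₀) :
    g₂ + g₁ (Real.log ‖x₀‖) ^ 2 - 2 * ρ * g₁ (Real.log ‖x₀‖)
        + lam * |g₁ (Real.log ‖x₀‖)| ^ (1 - τ) ≤
      Real.exp ((q - 1) * (w x₀ + β * Real.log ‖x₀‖)) := by
  have hpos : 0 < ‖x₀‖ := norm_pos_iff.mpr hx₀
  have he : ‖(‖x₀‖⁻¹ • x₀)‖ = 1 := by
    rw [norm_smul, norm_inv, norm_norm, inv_mul_cancel₀ hpos.ne']
  have hgrad : gradient (fun x => -w x) x₀ = -gradient w x₀ := by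
    simp [gradient, fderiv_fun_neg]
  obtain ⟨h1, h2⟩ := HasWeakLaplacian.le_of_isLocalMax_sub_touch (HasWeakLaplacian.neg hw) hx₀ he
    (A := 0) (g := fun s => -g s) (g₁ := fun s => -g₁ s)
    (hg.mono fun s hs => hs.neg) hg₁.neg hg₂.neg
    (by
      have := hmin.neg
      simp only [neg_sub] at this
      simpa [sub_eq_add_neg, add_comm] using this)
  rw [touchField_zero, hgrad, neg_mul, neg_smul, neg_inj] at h1
  rw [mul_neg, ← mul_assoc, mul_inv_cancel₀ (by positivity), one_mul, h1,
    norm_mul_norm_smul_inv_sq _ hx₀, inner_smul_inv_sq _ hx₀, sq_abs] at h2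
  linarith

lemma isCompact_norm_mem_Icc {E : Type*} [NormedAddCommGroup E] [InnerProductSpace ℝ E]
    [FiniteDimensional ℝ E] (a b : ℝ) : IsCompact {x : E | a ≤ ‖x‖ ∧ ‖x‖ ≤ b} := by
  refine (isCompact_closedBall (0 : E) b).of_isClosed_subset ?_ fun x hx => by
    simpa using hx.2
  exact (isClosed_le continuous_const continuous_norm).inter
    (isClosed_le continuous_norm continuous_const)

lemma abs_rpow_le_one_add {τ : ℝ} (hτ0 : 0 ≤ τ) (hτ1 : τ < 1) {a : ℝ} (ha : 0 ≤ a) :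
    a ^ (1 - τ) ≤ 1 + a := by
  rcases le_total a 1 with h | h
  · have := Real.rpow_le_one ha h (by linarith : 0 ≤ 1 - τ)
    linarith
  · have := Real.rpow_le_rpow_of_exponent_le h (by linarith : 1 - τ ≤ 1)
    rw [Real.rpow_one] at this
    linarith

/-- The Keller–Osserman upper bound. -/
lemma IsLogSolution.exists_upper_bound (hw : IsLogSolution ρ lam τ q β w) (hτ0 : 0 ≤ τ)
    (hτ1 : τ < 1) (hq : 1 < q) : ∃ c, ∀ x ≠ 0, w x + β * Real.log ‖x‖ ≤ c := by
  have hq' : 0 < q - 1 := by linarith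
  set γ : ℝ := 2 / (q - 1) with hγ
  have hγ0 : 0 < γ := by positivity
  set M : ℝ := |β| + 2 * γ with hM
  have hM0 : 0 ≤ M := by positivity
  set K : ℝ := 4 * γ + M ^ 2 + 2 * |ρ| * M + |lam| * (1 + M) with hK
  have hK0 : 0 < K := by positivity
  refine ⟨Real.log K / (q - 1), fun x₁ hx₁ => ?_⟩
  have hr₁ : 0 < ‖x₁‖ := norm_pos_iff.mpr hx₁
  set s₁ := Real.log ‖x₁‖ with hs₁
  set S : Set E := {x | Real.exp (s₁ - 1) ≤ ‖x‖ ∧ ‖x‖ ≤ Real.exp (s₁ + 1)} with hS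
  have hSc : IsCompact S := isCompact_norm_mem_Icc _ _
  have hS0 : ∀ x ∈ S, x ≠ 0 := fun x hx =>
    norm_pos_iff.mp ((Real.exp_pos _).trans_le hx.1)
  have hx₁S : x₁ ∈ S := by
    constructor
    · rw [← Real.le_log_iff_exp_le hr₁]; linarith
    · rw [← Real.log_le_iff_le_exp hr₁]; linarith
  have hwc : ContinuousOn w {0}ᶜ := hw.1.continuousOn
  have hlogc : ContinuousOn (fun x : E => Real.log ‖x‖) {0}ᶜ := fun x hx =>
    (hasGradientAt_log_norm hx).differentiableAt.continuousAt.continuousWithinAt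
  set Ψ : E → ℝ := fun x => Real.exp (w x + β * Real.log ‖x‖) *
    (1 - (Real.log ‖x‖ - s₁) ^ 2) ^ γ with hΨ
  have hΨc : ContinuousOn Ψ S := by
    have h1 : ContinuousOn w S := hwc.mono hS0
    have h2 : ContinuousOn (fun x : E => Real.log ‖x‖) S := hlogc.mono hS0
    refine (h1.add (continuousOn_const.mul h2)).rexp.mul ?_
    exact ContinuousOn.rpow_const (by fun_prop) fun x _ => Or.inr hγ0.le
  obtain ⟨x₀, hx₀S, hx₀max⟩ := hSc.exists_isMaxOn ⟨x₁, hx₁S⟩ hΨc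
  have hx₀ : x₀ ≠ 0 := hS0 x₀ hx₀S
  have hr₀ : 0 < ‖x₀‖ := norm_pos_iff.mpr hx₀
  have hΨ₁ : Ψ x₁ = Real.exp (w x₁ + β * s₁) := by simp [hΨ, hs₁]
  have hΨ₀ : 0 < Ψ x₀ := lt_of_lt_of_le (by rw [hΨ₁]; positivity) (hx₀max hx₁S)
  set t := Real.log ‖x₀‖ - s₁ with ht
  have ht1 : |t| ≤ 1 := by
    have h1 := (Real.le_log_iff_exp_le hr₀).mpr hx₀S.1
    have h2 := (Real.log_le_iff_le_exp hr₀).mpr hx₀S.2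
    rw [abs_le]; constructor <;> linarith
  have htlt : t ^ 2 < 1 := by
    refine lt_of_le_of_ne ((sq_le_one_iff_abs_le_one t).mpr ht1) fun h => ?_
    have : Ψ x₀ = 0 := by
      simp only [hΨ, ← ht, h, sub_self, Real.zero_rpow hγ0.ne', mul_zero]
    linarith
  set D : ℝ := 1 - t ^ 2 with hD
  have hD0 : 0 < D := by linarith
  have hD1 : D ≤ 1 := by nlinarith [sq_nonneg t]
  set g : ℝ → ℝ := fun s => -β * s - γ * Real.log (1 - (s - s₁) ^ 2) with hg
  set g₁ : ℝ → ℝ := fun s => -β + γ * (2 * (s - s₁) / (1 - (s - s₁) ^ 2)) with hg1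
  have hpoly : ∀ s : ℝ, HasDerivAt (fun s => 1 - (s - s₁) ^ 2) (-(2 * (s - s₁))) s := by
    intro s
    have := (((hasDerivAt_id s).sub_const s₁).pow 2).const_sub 1
    simpa using this
  have hdg : ∀ s : ℝ, 1 - (s - s₁) ^ 2 ≠ 0 → HasDerivAt g (g₁ s) s := by
    intro s hs
    have h := ((hasDerivAt_id s).const_mul (-β)).sub (((hpoly s).log hs).const_mul γ)
    refine h.congr_deriv ?_
    simp only [hg1]; ring
  have hD0' : 1 - (Real.log ‖x₀‖ - s₁) ^ 2 ≠ 0 := hD0.ne'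
  have hcont : Continuous fun s : ℝ => 1 - (s - s₁) ^ 2 := by fun_prop
  have hge : ∀ᶠ s in 𝓝 (Real.log ‖x₀‖), HasDerivAt g (g₁ s) s :=
    (hcont.continuousAt.eventually_ne hD0').mono hdg
  have hg1c : ContDiffAt ℝ 1 g₁ (Real.log ‖x₀‖) := by
    refine contDiffAt_const.add (contDiffAt_const.mul (ContDiffAt.div ?_ ?_ hD0')) <;> fun_prop
  have hg2 : HasDerivAt g₁ (γ * ((2 + 2 * t ^ 2) / D ^ 2)) (Real.log ‖x₀‖) := by
    have h1 : HasDerivAt (fun s : ℝ => 2 * (s - s₁)) 2 (Real.log ‖x₀‖) := by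
      simpa using ((hasDerivAt_id (Real.log ‖x₀‖)).sub_const s₁).const_mul 2
    have h := ((h1.div (hpoly _) hD0').const_mul γ).const_add (-β)
    refine h.congr_deriv ?_
    rw [← ht, ← hD]
    congr 2
    rw [hD]; ring
  have hlocal : IsLocalMax (fun x => w x - g (Real.log ‖x‖)) x₀ := by
    have hlogat : ContinuousAt (fun x : E => Real.log ‖x‖) x₀ :=
      hlogc.continuousAt (isOpen_compl_singleton.mem_nhds hx₀)
    have hev : ∀ᶠ x in 𝓝 x₀, 0 < 1 - (Real.log ‖x‖ - s₁) ^ 2 :=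
      (hcont.continuousAt.comp hlogat).eventually (lt_mem_nhds hD0)
    filter_upwards [hev, isOpen_compl_singleton.mem_nhds hx₀] with x hx hxne
    have hrx : 0 < ‖x‖ := norm_pos_iff.mpr hxne
    have hxS : x ∈ S := by
      have h1 : |Real.log ‖x‖ - s₁| ≤ 1 := (sq_le_one_iff_abs_le_one _).mp (by linarith)
      rw [abs_le] at h1
      exact ⟨(Real.le_log_iff_exp_le hrx).mp (by linarith),
        (Real.log_le_iff_le_exp hrx).mp (by linarith)⟩
    have h1 : Ψ x ≤ Ψ x₀ := hx₀max hxS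
    have h2 : ∀ y : E, 0 < 1 - (Real.log ‖y‖ - s₁) ^ 2 →
        Real.log (Ψ y) = w y - g (Real.log ‖y‖) := by
      intro y hy
      simp only [hΨ, hg]
      rw [Real.log_mul (Real.exp_pos _).ne' (Real.rpow_pos_of_pos hy γ).ne', Real.log_exp,
        Real.log_rpow hy]
      ring
    have hΨx : 0 < Ψ x := mul_pos (Real.exp_pos _) (Real.rpow_pos_of_pos hx γ)
    rw [← h2 x hx, ← h2 x₀ hD0]
    exact Real.log_le_log hΨx h1
  have hmain := hw.exp_le_of_isLocalMax hx₀ hge hg1c hg2 hlocal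
  set a := g₁ (Real.log ‖x₀‖) with ha
  have haD : |a| * D ≤ M := by
    have h1 : a * D = -β * D + 2 * γ * t := by
      simp only [ha, hg1, ← ht, ← hD]
      field_simp
    calc |a| * D = |a * D| := by rw [abs_mul, abs_of_pos hD0]
      _ = |-β * D + 2 * γ * t| := by rw [h1]
      _ ≤ |-β * D| + |2 * γ * t| := abs_add_le _ _
      _ = |β| * D + 2 * γ * |t| := by
        rw [abs_mul, abs_neg, abs_of_pos hD0, abs_mul, abs_of_pos (by positivity : 0 < 2 * γ)]
      _ ≤ |β| * 1 + 2 * γ * 1 := by gcongr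
      _ = M := by rw [hM]; ring
  have hbound : Real.exp ((q - 1) * (w x₀ + β * Real.log ‖x₀‖)) * D ^ 2 ≤ K := by
    have hrp := abs_rpow_le_one_add hτ0 hτ1 (abs_nonneg a)
    have hrp0 : 0 ≤ |a| ^ (1 - τ) := Real.rpow_nonneg (abs_nonneg a) _
    have h1 : Real.exp ((q - 1) * (w x₀ + β * Real.log ‖x₀‖)) ≤
        γ * ((2 + 2 * t ^ 2) / D ^ 2) + |a| ^ 2 + 2 * |ρ| * |a| + |lam| * (1 + |a|) := by
      have h2 : -(2 * ρ * a) ≤ 2 * |ρ| * |a| := by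
        have := neg_abs_le (ρ * a)
        rw [abs_mul] at this
        linarith
      have h3 : lam * |a| ^ (1 - τ) ≤ |lam| * (1 + |a|) := by
        have := le_abs_self lam
        gcongr
      rw [sq_abs]
      linarith
    calc _ ≤ (γ * ((2 + 2 * t ^ 2) / D ^ 2) + |a| ^ 2 + 2 * |ρ| * |a| + |lam| * (1 + |a|))
          * D ^ 2 :=
          mul_le_mul_of_nonneg_right h1 (sq_nonneg _)
      _ = γ * (2 + 2 * t ^ 2) + (|a| * D) ^ 2 + 2 * |ρ| * (|a| * D) * D
          + |lam| * (D + |a| * D) * D := by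
          field_simp
      _ ≤ γ * (2 + 2 * 1) + M ^ 2 + 2 * |ρ| * M * 1 + |lam| * (1 + M) * 1 := by gcongr
      _ = K := by rw [hK]; ring
  have hΨK : Real.exp ((q - 1) * (w x₁ + β * s₁)) ≤ K := by
    have h1 : Real.exp (w x₁ + β * s₁) ≤ Ψ x₀ := hΨ₁ ▸ hx₀max hx₁S
    calc Real.exp ((q - 1) * (w x₁ + β * s₁)) = Real.exp (w x₁ + β * s₁) ^ (q - 1) := by
          rw [← Real.exp_mul, mul_comm]
      _ ≤ Ψ x₀ ^ (q - 1) := Real.rpow_le_rpow (Real.exp_pos _).le h1 hq'.le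
      _ = Real.exp ((q - 1) * (w x₀ + β * Real.log ‖x₀‖)) * D ^ 2 := by
          simp only [hΨ, ← ht, ← hD]
          rw [Real.mul_rpow (Real.exp_pos _).le (Real.rpow_nonneg hD0.le _), ← Real.exp_mul,
            ← Real.rpow_mul hD0.le, mul_comm (q - 1), hγ, div_mul_cancel₀ _ hq'.ne']
          norm_num
      _ ≤ K := hbound
  rw [le_div_iff₀ hq', Real.le_log_iff_exp_le hK0, mul_comm]
  exact hΨK

end LogSolution

section LowerBound

variable {E : Type*} [NormedAddCommGroup E] [InnerProductSpace ℝ E] [FiniteDimensional ℝ E]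
  [MeasurableSpace E] [BorelSpace E] {ρ lam τ q β : ℝ} {w : E → ℝ}

lemma continuousOn_log_norm {E : Type*} [NormedAddCommGroup E] :
    ContinuousOn (fun x : E => Real.log ‖x‖) {0}ᶜ :=
  continuous_norm.continuousOn.log fun _ hx => norm_ne_zero_iff.mpr hx

lemma IsLogSolution.lower_bound_of_upper_bound (hw : IsLogSolution ρ lam τ q β w) (hτ0 : 0 ≤ τ)
    (hτ1 : τ < 1) (hq : 1 < q) {c m ε T k : ℝ} (hc : ∀ x ≠ 0, w x + β * Real.log ‖x‖ ≤ c)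
    (hm : ∀ x, ‖x‖ = 1 → m ≤ w x) (hε : ε = 1 ∨ ε = -1) (hT : 0 < T)
    (hk : k = 2 * |ρ| + 2 * |lam| + Real.exp ((q - 1) * c) + 1) {x₁ : E} (hx₁ : x₁ ≠ 0)
    (h0 : 0 ≤ ε * Real.log ‖x₁‖) (h1T : ε * Real.log ‖x₁‖ < T) :
    m + 2 * Real.log (1 - ε * Real.log ‖x₁‖ / T) - k * (ε * Real.log ‖x₁‖) ≤ w x₁ := by
  have hεsq : ε ^ 2 = 1 := by rcases hε with rfl | rfl <;> norm_num
  have hεabs : |ε| = 1 := by rcases hε with rfl | rfl <;> norm_num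
  have hwc : ContinuousOn w {0}ᶜ := hw.1.continuousOn
  set S : Set E := {x | Real.exp (-T) ≤ ‖x‖ ∧ ‖x‖ ≤ Real.exp T} ∩
    {x | 0 ≤ ε * Real.log ‖x‖ ∧ ε * Real.log ‖x‖ ≤ T} with hS
  have hA0 : ∀ x ∈ {x : E | Real.exp (-T) ≤ ‖x‖ ∧ ‖x‖ ≤ Real.exp T}, x ≠ 0 := fun x hx =>
    norm_pos_iff.mp ((Real.exp_pos _).trans_le hx.1)
  have hmemS : ∀ x : E, x ≠ 0 → 0 ≤ ε * Real.log ‖x‖ → ε * Real.log ‖x‖ ≤ T → x ∈ S := by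
    intro x hx h1 h2
    have hr : 0 < ‖x‖ := norm_pos_iff.mpr hx
    refine ⟨⟨?_, ?_⟩, h1, h2⟩
    · rw [← Real.le_log_iff_exp_le hr]
      rcases hε with rfl | rfl <;> linarith
    · rw [← Real.log_le_iff_le_exp hr]
      rcases hε with rfl | rfl <;> linarith
  have hSc : IsCompact S := by
    have hcA := isCompact_norm_mem_Icc (E := E) (Real.exp (-T)) (Real.exp T)
    refine hcA.of_isClosed_subset ?_ Set.inter_subset_left
    have hcl := (continuousOn_const (c := ε)).mul
      ((continuousOn_log_norm (E := E)).mono (fun x hx => hA0 x hx))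
    exact hcl.preimage_isClosed_of_isClosed hcA.isClosed isClosed_Icc
  have hS0 : ∀ x ∈ S, x ≠ 0 := fun x hx => hA0 x hx.1
  set Ψ : E → ℝ := fun x => Real.exp (m - k * (ε * Real.log ‖x‖) - w x) *
    (1 - ε * Real.log ‖x‖ / T) ^ 2 with hΨ
  have hΨc : ContinuousOn Ψ S := by
    have h1 : ContinuousOn w S := hwc.mono hS0
    have h2 : ContinuousOn (fun x : E => Real.log ‖x‖) S := continuousOn_log_norm.mono hS0
    fun_prop
  have hx₁S : x₁ ∈ S := hmemS x₁ hx₁ h0 h1T.le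
  obtain ⟨x₀, hx₀S, hx₀max⟩ := hSc.exists_isMaxOn ⟨x₁, hx₁S⟩ hΨc
  have hx₀ : x₀ ≠ 0 := hS0 x₀ hx₀S
  have hlogΨ : ∀ y : E, 0 < 1 - ε * Real.log ‖y‖ / T →
      Real.log (Ψ y) = m + 2 * Real.log (1 - ε * Real.log ‖y‖ / T)
        - k * (ε * Real.log ‖y‖) - w y := by
    intro y hy
    simp only [hΨ]
    rw [Real.log_mul (Real.exp_pos _).ne' (by positivity), Real.log_exp, Real.log_pow]
    push_cast
    ring
  have hpos₁ : 0 < 1 - ε * Real.log ‖x₁‖ / T := by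
    rw [sub_pos, div_lt_one hT]; exact h1T
  suffices hle : Ψ x₀ ≤ 1 by
    have h1 : Ψ x₁ ≤ 1 := (hx₀max hx₁S).trans hle
    have h2 : 0 < Ψ x₁ := by simp only [hΨ]; positivity
    have h3 := Real.log_nonpos h2.le h1
    rw [hlogΨ x₁ hpos₁] at h3
    linarith
  by_contra! hgt
  set s := Real.log ‖x₀‖ with hs
  have hsT : ε * s < T := by
    refine lt_of_le_of_ne hx₀S.2.2 fun h => ?_
    have : Ψ x₀ = 0 := by
      simp only [hΨ, ← hs, h, div_self hT.ne', sub_self]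
      norm_num
    linarith
  have hs0 : 0 < ε * s := by
    refine lt_of_le_of_ne hx₀S.2.1 fun h => ?_
    have hs' : s = 0 := by
      rcases hε with rfl | rfl <;> simp_all
    have hn1 : ‖x₀‖ = 1 := by
      have hr : 0 < ‖x₀‖ := norm_pos_iff.mpr hx₀
      rw [← Real.exp_log hr, ← hs, hs', Real.exp_zero]
    have : Ψ x₀ = Real.exp (m - w x₀) := by
      simp only [hΨ, ← hs, hs']
      norm_num
    rw [this, Real.one_lt_exp_iff] at hgt
    have := hm x₀ hn1
    linarith
  have hTs : 0 < T - ε * s := by linarith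
  have hpos₀ : 0 < 1 - ε * s / T := by
    rw [sub_pos, div_lt_one hT]; exact hsT
  set g : ℝ → ℝ := fun s => 2 * Real.log (1 - ε * s / T) - k * (ε * s) with hg
  set g₁ : ℝ → ℝ := fun s => -ε * (2 / (T - ε * s) + k) with hg1
  have hdg : ∀ s : ℝ, 0 < T - ε * s → HasDerivAt g (g₁ s) s := by
    intro s hs
    have hpos : 1 - ε * s / T ≠ 0 := by
      have : 0 < 1 - ε * s / T := by
        rw [sub_pos, div_lt_one hT]; linarith
      exact this.ne'
    have hlin : HasDerivAt (fun s => 1 - ε * s / T) (-(ε / T)) s := by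
      have := (((hasDerivAt_id s).const_mul ε).div_const T).const_sub 1
      simpa using this
    have h := ((hlin.log hpos).const_mul 2).sub (((hasDerivAt_id s).const_mul ε).const_mul k)
    refine h.congr_deriv ?_
    simp only [hg1]
    have h2 : 1 - ε * s / T = (T - ε * s) / T := by field_simp
    rw [h2]
    field_simp
    ring
  have hcont : Continuous fun s : ℝ => T - ε * s := by fun_prop
  have hge : ∀ᶠ s in 𝓝 s, HasDerivAt g (g₁ s) s :=
    (hcont.continuousAt.eventually (lt_mem_nhds hTs)).mono hdg
  have hg1c : ContDiffAt ℝ 1 g₁ s := by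
    have h1 : ContDiffAt ℝ 1 (fun s : ℝ => T - ε * s) s := by fun_prop
    exact contDiffAt_const.mul ((contDiffAt_const.div h1 hTs.ne').add contDiffAt_const)
  set y : ℝ := 2 / (T - ε * s) with hy
  have hy0 : 0 < y := by positivity
  have hg2 : HasDerivAt g₁ (-(y ^ 2 / 2)) s := by
    have h1 : HasDerivAt (fun s : ℝ => T - ε * s) (-ε) s := by
      simpa using ((hasDerivAt_id s).const_mul ε).const_sub T
    have h := ((((hasDerivAt_const s (2 : ℝ)).div h1 hTs.ne').add_const k)).const_mul (-ε)
    refine h.congr_deriv ?_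
    simp only [hy]
    field_simp
    linear_combination (-2) * hεsq
  have hlocal : IsLocalMin (fun x => w x - g (Real.log ‖x‖)) x₀ := by
    have hlogat : ContinuousAt (fun x : E => ε * Real.log ‖x‖) x₀ :=
      continuousAt_const.mul
        (continuousOn_log_norm.continuousAt (isOpen_compl_singleton.mem_nhds hx₀))
    filter_upwards [hlogat.eventually (lt_mem_nhds hs0), hlogat.eventually (gt_mem_nhds hsT),
      isOpen_compl_singleton.mem_nhds hx₀] with x hx1 hx2 hxne
    have hxS : x ∈ S := hmemS x hxne hx1.le hx2.le
    have hposx : 0 < 1 - ε * Real.log ‖x‖ / T := by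
      rw [sub_pos, div_lt_one hT]; exact hx2
    have h1 : Ψ x ≤ Ψ x₀ := hx₀max hxS
    have hΨx : 0 < Ψ x := by simp only [hΨ]; positivity
    have h2 := Real.log_le_log hΨx h1
    rw [hlogΨ x hposx, hlogΨ x₀ hpos₀] at h2
    simp only [hg, ← hs] at h2 ⊢
    linarith
  have hmain := hw.le_exp_of_isLocalMin hx₀ hge hg1c hg2 hlocal
  have hz : Real.exp ((q - 1) * (w x₀ + β * s)) ≤ Real.exp ((q - 1) * c) := by
    have := hc x₀ hx₀
    have hq' : 0 ≤ q - 1 := by linarith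
    gcongr
  have hk1 : 1 ≤ k := by
    have := Real.exp_pos ((q - 1) * c)
    rw [hk]
    linarith [abs_nonneg ρ, abs_nonneg lam]
  have hval : g₁ s = -ε * (y + k) := rfl
  have habs : |g₁ s| = y + k := by
    rw [hval, abs_mul, abs_neg, hεabs, one_mul, abs_of_pos (by linarith)]
  have hsq : g₁ s ^ 2 = (y + k) ^ 2 := by rw [hval, mul_pow, neg_sq, hεsq, one_mul]
  rw [← hs, habs, hsq] at hmain
  have h1 : 2 * ρ * g₁ s ≤ 2 * |ρ| * (y + k) := by
    rw [← habs]
    have := le_abs_self (ρ * g₁ s)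
    rw [abs_mul] at this
    linarith
  have hrp := abs_rpow_le_one_add hτ0 hτ1 (a := y + k) (by linarith)
  have h2 : -(|lam| * (1 + (y + k))) ≤ lam * (y + k) ^ (1 - τ) := by
    have h3 : |lam| * (y + k) ^ (1 - τ) ≤ |lam| * (1 + (y + k)) := by gcongr
    have h4 := neg_abs_le lam
    have h5 : 0 ≤ (y + k) ^ (1 - τ) := Real.rpow_nonneg (by linarith) _
    nlinarith
  set X := Real.exp ((q - 1) * c)
  have hX : 0 < X := Real.exp_pos _
  have h6 : y ^ 2 / 2 + 2 * y * k + k ^ 2 - 2 * |ρ| * (y + k) - |lam| * (1 + (y + k)) ≤ X := by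
    linarith
  have h7 : (2 * |ρ| + |lam|) * y ≤ k * y := by
    refine mul_le_mul_of_nonneg_right ?_ hy0.le
    rw [hk]; linarith [abs_nonneg lam]
  have h8 : k * (k - (2 * |ρ| + |lam|)) ≥ 1 * (|lam| + X + 1) := by
    refine mul_le_mul hk1 ?_ (by positivity) (by linarith)
    rw [hk]; linarith
  nlinarith

/-- A linear lower bound in `log ‖x‖` for the logarithm of a solution. -/
lemma IsLogSolution.exists_lower_bound [Nontrivial E] (hw : IsLogSolution ρ lam τ q β w)
    (hτ0 : 0 ≤ τ) (hτ1 : τ < 1) (hq : 1 < q) :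
    ∃ C k, 0 ≤ k ∧ ∀ x ≠ 0, -C - k * |Real.log ‖x‖| ≤ w x := by
  obtain ⟨c, hc⟩ := hw.exists_upper_bound hτ0 hτ1 hq
  obtain ⟨m, hm⟩ : ∃ m, ∀ x, ‖x‖ = 1 → m ≤ w x := by
    have hwc : ContinuousOn w (Metric.sphere 0 1) := hw.1.continuousOn.mono fun x hx => by
      have : ‖x‖ = 1 := by simpa using hx
      intro h
      simp_all
    obtain ⟨x, -, hx⟩ := (isCompact_sphere (0 : E) 1).exists_isMinOn
      (NormedSpace.sphere_nonempty.mpr zero_le_one) hwc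
    exact ⟨w x, fun y hy => hx (by simpa using hy)⟩
  set k : ℝ := 2 * |ρ| + 2 * |lam| + Real.exp ((q - 1) * c) + 1 with hk
  refine ⟨2 * Real.log 2 - m, k, by positivity, fun x hx => ?_⟩
  set a := |Real.log ‖x‖| with ha
  have ha0 : 0 ≤ a := abs_nonneg _
  obtain ⟨ε, hε, hεa⟩ : ∃ ε : ℝ, (ε = 1 ∨ ε = -1) ∧ ε * Real.log ‖x‖ = a := by
    rcases le_total 0 (Real.log ‖x‖) with h | h
    · exact ⟨1, Or.inl rfl, by rw [ha, abs_of_nonneg h, one_mul]⟩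
    · exact ⟨-1, Or.inr rfl, by rw [ha, abs_of_nonpos h]; ring⟩
  have h := hw.lower_bound_of_upper_bound hτ0 hτ1 hq hc hm hε (T := 2 * a + 1) (by linarith) hk hx
    (by rw [hεa]; exact ha0) (by rw [hεa]; linarith)
  rw [hεa] at h
  have h2 : Real.log (1 / 2) ≤ Real.log (1 - a / (2 * a + 1)) := by
    refine Real.log_le_log (by norm_num) ?_
    have : a / (2 * a + 1) ≤ 1 / 2 := by
      rw [div_le_iff₀ (by linarith)]; linarith
    linarith
  rw [one_div, Real.log_inv] at h2
  linarith

end LowerBound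

section DoublingReal

/-- The error term in the doubling-variables argument. -/
noncomputable def doublingError (ρ lam τ δ κ : ℝ) : ℝ :=
  κ * (1 + 2 * |ρ|) + κ ^ 2 + 2 * κ ^ 2 / δ + |lam| * κ ^ (1 - τ) + |lam| * δ + δ * lam ^ 2 / 2

lemma rpow_le_rpow_add_rpow {τ a b c : ℝ} (hτ0 : 0 ≤ τ) (hτ1 : τ < 1) (ha : 0 ≤ a) (hb : 0 ≤ b)
    (hc : 0 ≤ c) (h : a ≤ b + c) : a ^ (1 - τ) ≤ b ^ (1 - τ) + c ^ (1 - τ) :=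
  (Real.rpow_le_rpow ha h (by linarith)).trans
    (Real.rpow_add_le_add_rpow hb hc (by linarith) (by linarith))

lemma le_add_abs_of_sq_eq {P T t a b : ℝ} (hb : 0 ≤ b) (hT : 0 ≤ T)
    (h1 : a ^ 2 = (P + t) ^ 2 + T) (h2 : b ^ 2 = P ^ 2 + T) : a ≤ b + |t| := by
  have hP : |P| ≤ b := abs_le_of_sq_le_sq (by linarith) hb
  refine le_of_sq_le_sq ?_ (by positivity)
  have h3 : P * t ≤ b * |t| := by
    calc P * t ≤ |P * t| := le_abs_self _
      _ = |P| * |t| := abs_mul _ _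
      _ ≤ b * |t| := by gcongr
  nlinarith [sq_abs t]

lemma le_doublingError {ρ lam τ δ κ A g₁ g₂ a b P T D : ℝ} (hτ0 : 0 ≤ τ) (hτ1 : τ < 1)
    (hδ0 : 0 < δ) (hδ1 : δ < 1) (hκ : 0 ≤ κ) (ha : 0 ≤ a) (hb : 0 ≤ b) (hT : 0 ≤ T)
    (h1 : a ^ 2 = (P + g₁) ^ 2 + T) (h2 : b ^ 2 = P ^ 2 + T) (hg₁ : |g₁| ≤ κ) (hg₂ : g₂ ≤ κ)
    (hD : 0 ≤ D)
    (h : -a ^ 2 + b ^ 2 / (1 - δ) + 2 * ρ * g₁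
      - lam * (a ^ (1 - τ) - (1 - δ) ^ τ * b ^ (1 - τ)) + D ≤ g₂ - A) :
    A ≤ doublingError ρ lam τ δ κ := by
  have hab : a ≤ b + κ := (le_add_abs_of_sq_eq hb hT h1 h2).trans (by linarith)
  have hba : b ≤ a + κ := by
    have := le_add_abs_of_sq_eq (P := P + g₁) (t := -g₁) ha hT (by rw [h2]; ring) h1
    rw [abs_neg] at this
    linarith
  have hr1 := rpow_le_rpow_add_rpow hτ0 hτ1 ha hb hκ hab
  have hr2 := rpow_le_rpow_add_rpow hτ0 hτ1 hb ha hκ hba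
  have hb1 := abs_rpow_le_one_add hτ0 hτ1 hb
  have hb0 : 0 ≤ b ^ (1 - τ) := Real.rpow_nonneg hb _
  have hδτ1 : (1 - δ) ^ τ ≤ 1 := Real.rpow_le_one (by linarith) (by linarith) hτ0
  have hδτ2 : 1 - δ ≤ (1 - δ) ^ τ := by
    have := Real.rpow_le_rpow_of_exponent_ge (by linarith : 0 < 1 - δ) (by linarith) hτ1.le
    rwa [Real.rpow_one] at this
  have hlam : lam * (a ^ (1 - τ) - (1 - δ) ^ τ * b ^ (1 - τ))
      ≤ |lam| * (κ ^ (1 - τ) + δ * (1 + b)) := by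
    refine (le_abs_self _).trans ?_
    rw [abs_mul]
    refine mul_le_mul_of_nonneg_left ?_ (abs_nonneg _)
    have h3 : (1 - (1 - δ) ^ τ) * b ^ (1 - τ) ≤ δ * (1 + b) := by
      refine mul_le_mul (by linarith) hb1 hb0 hδ0.le
    have h4 : 0 ≤ (1 - (1 - δ) ^ τ) * b ^ (1 - τ) := mul_nonneg (by linarith) hb0
    rw [abs_le]
    constructor
    · have : 0 ≤ δ * (1 + b) := by positivity
      nlinarith
    · nlinarith
  have hbδ : b ^ 2 + δ * b ^ 2 ≤ b ^ 2 / (1 - δ) := by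
    rw [le_div_iff₀ (by linarith)]
    nlinarith [sq_nonneg (δ * b)]
  have hP : P * g₁ ≤ b * κ := by
    have hP : |P| ≤ b := abs_le_of_sq_le_sq (by linarith) hb
    calc P * g₁ ≤ |P * g₁| := le_abs_self _
      _ = |P| * |g₁| := abs_mul _ _
      _ ≤ b * κ := by gcongr
  have hg2 : g₁ ^ 2 ≤ κ ^ 2 := sq_le_sq' (by linarith [(abs_le.mp hg₁).1]) (abs_le.mp hg₁).2
  have hρ : -(2 * ρ * g₁) ≤ 2 * |ρ| * κ := by
    have h5 : |ρ * g₁| ≤ |ρ| * κ := by rw [abs_mul]; gcongr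
    linarith [neg_abs_le (ρ * g₁)]
  have hy1 : 2 * κ * b ≤ δ * b ^ 2 / 2 + 2 * κ ^ 2 / δ := by
    have : δ * b ^ 2 / 2 + 2 * κ ^ 2 / δ - 2 * κ * b = (δ * b - 2 * κ) ^ 2 / (2 * δ) := by
      field_simp
      ring
    have h6 : 0 ≤ (δ * b - 2 * κ) ^ 2 / (2 * δ) := by positivity
    linarith
  have hy2 : |lam| * δ * b ≤ δ * b ^ 2 / 2 + δ * lam ^ 2 / 2 := by
    nlinarith [mul_nonneg hδ0.le (sq_nonneg (b - |lam|)), sq_abs lam]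
  unfold doublingError
  nlinarith

end DoublingReal

section Doubling

variable {E : Type*} [NormedAddCommGroup E] [InnerProductSpace ℝ E]

/-- The squared sine of half the angle between `x` and `y`. -/
noncomputable def sinHalfSq (x y : E) : ℝ := (1 - ⟪x, y⟫ * (‖x‖⁻¹ * ‖y‖⁻¹)) / 2

/-- The angular penalty in the doubling-variables argument. -/
noncomputable def anglePenalty (x y : E) : ℝ := 3 * √(sinHalfSq x y) - sinHalfSq x y

/-- The doubled functional with angular penalty and radial localisation. -/
noncomputable def doubling (w : E → ℝ) (δ A κ s₀ : ℝ) (x y : E) : ℝ :=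
  w x - (1 - δ) * w y - A * anglePenalty x y - κ * (√(1 + (Real.log ‖x‖ - s₀) ^ 2) - 1)

lemma sinHalfSq_mem_Icc (x y : E) : 0 ≤ sinHalfSq x y ∧ sinHalfSq x y ≤ 1 := by
  have h : |⟪x, y⟫ * (‖x‖⁻¹ * ‖y‖⁻¹)| ≤ 1 := by
    have h1 := abs_real_inner_div_norm_mul_norm_le_one x y
    rwa [div_eq_mul_inv, mul_inv] at h1
  rw [abs_le] at h
  unfold sinHalfSq
  constructor <;> linarith

lemma anglePenalty_nonneg (x y : E) : 0 ≤ anglePenalty x y := by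
  obtain ⟨h0, h1⟩ := sinHalfSq_mem_Icc x y
  have h2 := Real.sq_sqrt h0
  have h3 : √(sinHalfSq x y) ≤ 1 := Real.sqrt_le_one.mpr h1
  unfold anglePenalty
  nlinarith [Real.sqrt_nonneg (sinHalfSq x y)]

lemma anglePenalty_le_two (x y : E) : anglePenalty x y ≤ 2 := by
  obtain ⟨h0, h1⟩ := sinHalfSq_mem_Icc x y
  have h2 := Real.sq_sqrt h0
  have h3 : √(sinHalfSq x y) ≤ 1 := Real.sqrt_le_one.mpr h1
  unfold anglePenalty
  nlinarith [Real.sqrt_nonneg (sinHalfSq x y)]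

lemma abs_sub_one_le_sqrt (t : ℝ) : |t| - 1 ≤ √(1 + t ^ 2) - 1 := by
  have : |t| ≤ √(1 + t ^ 2) := Real.abs_le_sqrt (by linarith)
  linarith

lemma hasDerivAt_sqrt_one_add_sq (t : ℝ) :
    HasDerivAt (fun t : ℝ => √(1 + t ^ 2) - 1) (t / √(1 + t ^ 2)) t := by
  have h1 : HasDerivAt (fun t : ℝ => 1 + t ^ 2) (2 * t) t := by
    simpa using (hasDerivAt_pow 2 t).const_add 1
  have h := (h1.sqrt (by positivity)).sub_const 1
  refine h.congr_deriv ?_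
  field_simp

lemma hasDerivAt_div_sqrt_one_add_sq (t : ℝ) :
    ∃ d ≤ 1, HasDerivAt (fun t : ℝ => t / √(1 + t ^ 2)) d t := by
  have h1 : HasDerivAt (fun t : ℝ => 1 + t ^ 2) (2 * t) t := by
    simpa using (hasDerivAt_pow 2 t).const_add 1
  have hR : 0 < √(1 + t ^ 2) := Real.sqrt_pos.mpr (by positivity)
  have h := (hasDerivAt_id t).div (h1.sqrt (by positivity)) hR.ne'
  refine ⟨_, ?_, h⟩
  have hR2 : √(1 + t ^ 2) ^ 2 = 1 + t ^ 2 := Real.sq_sqrt (by positivity)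
  have hR1 : 1 ≤ √(1 + t ^ 2) := Real.one_le_sqrt.mpr (by nlinarith [sq_nonneg t])
  rw [div_le_one (by positivity)]
  have h3 : 0 ≤ id t * (2 * t / (2 * √(1 + t ^ 2))) := by
    have : id t * (2 * t / (2 * √(1 + t ^ 2))) = t ^ 2 / √(1 + t ^ 2) := by
      simp only [id]; field_simp
    rw [this]; positivity
  nlinarith

lemma abs_div_sqrt_one_add_sq_le (t : ℝ) : |t / √(1 + t ^ 2)| ≤ 1 := by
  have hR : 0 < √(1 + t ^ 2) := Real.sqrt_pos.mpr (by positivity)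
  rw [abs_div, abs_of_pos hR, div_le_one hR]
  exact Real.abs_le_sqrt (by linarith)

end Doubling

section DoublingFirstOrder

variable {E : Type*} [NormedAddCommGroup E] [InnerProductSpace ℝ E]

lemma reflection_orthogonal_singleton_apply {e : E} (he : ‖e‖ = 1) (x : E) :
    (ℝ ∙ e)ᗮ.reflection x = x - (2 * ⟪x, e⟫) • e := by
  rw [Submodule.reflection_orthogonal_apply, Submodule.reflection_singleton_apply, he,
    real_inner_comm]
  simp only [RCLike.ofReal_real_eq_id, id, one_pow, div_one]
  module

lemma sinHalfSq_reflection {e : E} (he : ‖e‖ = 1) {x : E} (hx : x ≠ 0) :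
    sinHalfSq x ((ℝ ∙ e)ᗮ.reflection x) = angleCos e x ^ 2 := by
  have hpos : 0 < ‖x‖ := norm_pos_iff.mpr hx
  rw [sinHalfSq, angleCos, LinearIsometryEquiv.norm_map, reflection_orthogonal_singleton_apply he,
    inner_sub_right, real_inner_smul_right, real_inner_self_eq_norm_sq]
  field_simp
  ring

lemma anglePenalty_reflection {e : E} (he : ‖e‖ = 1) {x : E} (hx : x ≠ 0)
    (h : 0 ≤ angleCos e x) :
    anglePenalty x ((ℝ ∙ e)ᗮ.reflection x) = 3 * angleCos e x - angleCos e x ^ 2 := by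
  rw [anglePenalty, sinHalfSq_reflection he hx, Real.sqrt_sq h]

lemma sinHalfSq_norm_smul {ν : E} (hν : ‖ν‖ = 1) {x : E} (hx : x ≠ 0) :
    sinHalfSq x (‖x‖ • ν) = (1 - angleCos ν x) / 2 := by
  have hpos : 0 < ‖x‖ := norm_pos_iff.mpr hx
  rw [sinHalfSq, angleCos, norm_smul, hν, norm_norm, real_inner_smul_right]
  field_simp

lemma gradient_eq_of_doubling_max [FiniteDimensional ℝ E] {w : E → ℝ} (hw : ContDiffOn ℝ 1 w {0}ᶜ)
    {δ A κ s₀ : ℝ} {x₀ ν : E} (hx₀ : x₀ ≠ 0) (hν : ‖ν‖ = 1)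
    (hs : 0 < sinHalfSq x₀ (‖x₀‖ • ν))
    (hmax : ∀ x, x ≠ 0 → doubling w δ A κ s₀ x (‖x‖ • ν) ≤ doubling w δ A κ s₀ x₀ (‖x₀‖ • ν)) :
    ∃ a : ℝ, gradient w x₀ = a • x₀
      - (A * ((3 - 2 * √(sinHalfSq x₀ (‖x₀‖ • ν))) / (4 * √(sinHalfSq x₀ (‖x₀‖ • ν)))) * ‖x₀‖⁻¹)
        • ν := by
  have hopen : IsOpen ({0}ᶜ : Set E) := isOpen_compl_singleton
  have hpos : 0 < ‖x₀‖ := norm_pos_iff.mpr hx₀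
  have hν0 : ν ≠ 0 := by rintro rfl; simp at hν
  have hyne : Real.exp (Real.log ‖x₀‖) • ν ≠ 0 := smul_ne_zero (Real.exp_pos _).ne' hν0
  obtain ⟨d, hd⟩ : ∃ d, HasDerivAt (fun s => (1 - δ) * w (Real.exp s • ν)
      + κ * (√(1 + (s - s₀) ^ 2) - 1)) d (Real.log ‖x₀‖) := by
    have h1 : DifferentiableAt ℝ w (Real.exp (Real.log ‖x₀‖) • ν) :=
      (hw.contDiffAt (hopen.mem_nhds hyne)).differentiableAt one_ne_zero
    have h2 : DifferentiableAt ℝ (fun s => w (Real.exp s • ν)) (Real.log ‖x₀‖) :=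
      h1.comp (Real.log ‖x₀‖) (f := fun s : ℝ => Real.exp s • ν)
        ((Real.differentiableAt_exp).smul_const ν)
    have h3 : DifferentiableAt ℝ (fun s => √(1 + (s - s₀) ^ 2) - 1) (Real.log ‖x₀‖) :=
      ((hasDerivAt_sqrt_one_add_sq (Real.log ‖x₀‖ - s₀)).comp_sub_const _ s₀).differentiableAt
    exact ⟨_, ((h2.const_mul (1 - δ)).add (h3.const_mul κ)).hasDerivAt⟩
  set h := √(sinHalfSq x₀ (‖x₀‖ • ν)) with hh
  have hh0 : 0 < h := Real.sqrt_pos.mpr hs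
  have hp : HasDerivAt (fun c : ℝ => A * (3 * √((1 - c) / 2) - (1 - c) / 2))
      (A * (-(3 - 2 * h) / (4 * h))) (angleCos ν x₀) := by
    have h1 : HasDerivAt (fun c : ℝ => (1 - c) / 2) (-1 / 2) (angleCos ν x₀) := by
      simpa using ((hasDerivAt_id (angleCos ν x₀)).const_sub 1).div_const 2
    have hne : (1 - angleCos ν x₀) / 2 ≠ 0 := by
      rw [← sinHalfSq_norm_smul hν hx₀]; exact hs.ne'
    have h2 := (((h1.sqrt hne).const_mul 3).sub h1).const_mul A
    refine h2.congr_deriv ?_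
    rw [← sinHalfSq_norm_smul hν hx₀, ← hh]
    field_simp
    ring
  have hgrad := ((((hw.hasGradientAt hopen hx₀).fun_sub
    (hd.comp_hasGradientAt (f := fun y : E => Real.log ‖y‖) (hasGradientAt_log_norm hx₀)))).fun_sub
    (hp.comp_hasGradientAt (hasGradientAt_angleCos ν hx₀)))
  have hloc : IsLocalMax (fun x => w x - ((1 - δ) * w (Real.exp (Real.log ‖x‖) • ν)
      + κ * (√(1 + (Real.log ‖x‖ - s₀) ^ 2) - 1))
      - A * (3 * √((1 - angleCos ν x) / 2) - (1 - angleCos ν x) / 2)) x₀ := by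
    filter_upwards [hopen.mem_nhds hx₀] with x hx
    have h1 := hmax x hx
    unfold doubling anglePenalty at h1
    rw [sinHalfSq_norm_smul hν hx, sinHalfSq_norm_smul hν hx₀] at h1
    rw [Real.exp_log hpos, Real.exp_log (norm_pos_iff.mpr hx)]
    linarith
  have hz : gradient w x₀ - d • (‖x₀‖ ^ 2)⁻¹ • x₀ - (A * (-(3 - 2 * h) / (4 * h))) •
      (‖x₀‖⁻¹ • ν - (angleCos ν x₀ * (‖x₀‖⁻¹ * ‖x₀‖⁻¹)) • x₀) = 0 := by
    have := hloc.hasFDerivAt_eq_zero (hasGradientAt_iff_hasFDerivAt.mp hgrad)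
    exact (InnerProductSpace.toDual ℝ E).map_eq_zero_iff.mp this
  refine ⟨d * (‖x₀‖ ^ 2)⁻¹ + A * ((3 - 2 * h) / (4 * h)) *
    (angleCos ν x₀ * (‖x₀‖⁻¹ * ‖x₀‖⁻¹)), ?_⟩
  rw [sub_sub, sub_eq_zero] at hz
  rw [hz, neg_div]
  module

end DoublingFirstOrder

section DoublingMax

lemma norm_mul_norm_smul_add_smul_sq {E : Type*} [NormedAddCommGroup E] [InnerProductSpace ℝ E]
    {x e : E} (hx : x ≠ 0) (he : ‖e‖ = 1) (a B : ℝ) :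
    (‖x‖ * ‖a • x + (B * ‖x‖⁻¹) • e‖) ^ 2
      = (a * ‖x‖ ^ 2 + B * angleCos e x) ^ 2 + B ^ 2 * (1 - angleCos e x ^ 2) := by
  have hpos : 0 < ‖x‖ := norm_pos_iff.mpr hx
  rw [mul_pow, norm_add_sq_real, norm_smul, norm_smul, he, mul_one, mul_pow, Real.norm_eq_abs,
    Real.norm_eq_abs, sq_abs, sq_abs, real_inner_smul_left, real_inner_smul_right, angleCos]
  field_simp
  ring

lemma angleCos_mem_Icc {E : Type*} [NormedAddCommGroup E] [InnerProductSpace ℝ E]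
    {e : E} (he : ‖e‖ = 1) (x : E) : -1 ≤ angleCos e x ∧ angleCos e x ≤ 1 := by
  rw [← abs_le]
  have h := abs_real_inner_div_norm_mul_norm_le_one x e
  rwa [he, mul_one, div_eq_mul_inv] at h

variable {E : Type*} [NormedAddCommGroup E] [InnerProductSpace ℝ E] [FiniteDimensional ℝ E]
  [MeasurableSpace E] [BorelSpace E] {ρ lam τ q β : ℝ} {w : E → ℝ}

set_option maxHeartbeats 1000000 in
lemma IsLogSolution.le_doublingError_of_max (hw : IsLogSolution ρ lam τ q β w)
    (hE : 2 ≤ Module.finrank ℝ E) (hτ0 : 0 ≤ τ) (hτ1 : τ < 1) (hq : 1 < q)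
    {δ A κ s₀ : ℝ} (hδ0 : 0 < δ) (hδ1 : δ < 1) (hκ : 0 ≤ κ) (hA : 0 < A) {x₀ y₀ : E}
    (hx₀ : x₀ ≠ 0) (hxy : ‖y₀‖ = ‖x₀‖) (hlt : w y₀ < w x₀)
    (hmax : ∀ x y, x ≠ 0 → ‖y‖ = ‖x‖ →
      doubling w δ A κ s₀ x y ≤ doubling w δ A κ s₀ x₀ y₀) :
    A ≤ doublingError ρ lam τ δ κ := by
  have hopen : IsOpen ({0}ᶜ : Set E) := isOpen_compl_singleton
  have hpos : 0 < ‖x₀‖ := norm_pos_iff.mpr hx₀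
  have hne : x₀ - y₀ ≠ 0 := by
    intro h
    rw [sub_eq_zero] at h
    rw [h] at hlt
    exact lt_irrefl _ hlt
  have hnpos : 0 < ‖x₀ - y₀‖ := norm_pos_iff.mpr hne
  set e : E := ‖x₀ - y₀‖⁻¹ • (x₀ - y₀) with he_def
  have he : ‖e‖ = 1 := by
    rw [he_def, norm_smul, norm_inv, norm_norm, inv_mul_cancel₀ hnpos.ne']
  have hsq : 2 * ⟪x₀, x₀ - y₀⟫ = ‖x₀ - y₀‖ ^ 2 := by
    rw [norm_sub_sq_real, inner_sub_right, real_inner_self_eq_norm_sq, hxy]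
    ring
  set O : E ≃ₗᵢ[ℝ] E := (ℝ ∙ e)ᗮ.reflection with hO_def
  have hOx : ∀ x, O x = x - (2 * ⟪x, e⟫) • e := reflection_orthogonal_singleton_apply he
  have hOO : ∀ x, O (O x) = x := fun x => Submodule.reflection_reflection _ x
  have hsymm : ∀ x, O.symm x = O x := fun x => rfl
  have hxe : ⟪x₀, e⟫ = ‖x₀ - y₀‖ / 2 := by
    rw [he_def, real_inner_smul_right]
    field_simp
    linarith
  have hOx₀ : O x₀ = y₀ := by
    rw [hOx, hxe, he_def, smul_smul]
    have : 2 * (‖x₀ - y₀‖ / 2) * ‖x₀ - y₀‖⁻¹ = 1 := by field_simp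
    rw [this]
    module
  set h : ℝ := angleCos e x₀ with hh
  have hh0 : 0 < h := by
    rw [hh, angleCos, hxe]
    positivity
  have hh1 : h ≤ 1 := (angleCos_mem_Icc he x₀).2
  have hy₀ : y₀ = x₀ - (2 * (h * ‖x₀‖)) • e := by
    rw [← hOx₀, hOx, hh, angleCos, inv_mul_cancel_right₀ hpos.ne']
  have hsin : sinHalfSq x₀ y₀ = h ^ 2 := by
    rw [← hOx₀, sinHalfSq_reflection he hx₀]
  set g : ℝ → ℝ := fun s => κ * (√(1 + (s - s₀) ^ 2) - 1) with hg_def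
  set g₁ : ℝ → ℝ := fun s => κ * ((s - s₀) / √(1 + (s - s₀) ^ 2)) with hg₁_def
  have hg : ∀ s, HasDerivAt g (g₁ s) s := fun s =>
    ((hasDerivAt_sqrt_one_add_sq (s - s₀)).comp_sub_const s s₀).const_mul κ
  have hg₁c : ContDiff ℝ 1 g₁ := by
    have h1 : ContDiff ℝ 1 fun s : ℝ => 1 + (s - s₀) ^ 2 := by fun_prop
    have h2 : ContDiff ℝ 1 fun s : ℝ => s - s₀ := by fun_prop
    exact contDiff_const.mul (h2.div (h1.sqrt fun s => by positivity)
      fun s => (Real.sqrt_pos.mpr (by positivity)).ne')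
  obtain ⟨d, hd1, hd⟩ := hasDerivAt_div_sqrt_one_add_sq (Real.log ‖x₀‖ - s₀)
  have hg₂ : HasDerivAt g₁ (κ * d) (Real.log ‖x₀‖) :=
    (hd.comp_sub_const (Real.log ‖x₀‖) s₀).const_mul κ
  set t := g₁ (Real.log ‖x₀‖) with ht
  have htκ : |t| ≤ κ := by
    rw [ht, hg₁_def, abs_mul, abs_of_nonneg hκ]
    exact mul_le_of_le_one_right hκ (abs_div_sqrt_one_add_sq_le _)
  have hlap := HasWeakLaplacian.sub_const_mul hw (HasWeakLaplacian.comp_linearIsometryEquiv hw O)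
    (1 - δ)
  obtain ⟨hgr, hineq⟩ := hlap.le_of_isLocalMax_sub_touch hx₀ he (A := A)
    (Eventually.of_forall hg) hg₁c.contDiffAt hg₂ (by
      have hev : ∀ᶠ x in 𝓝 x₀, 0 < angleCos e x :=
        (contDiffAt_angleCos e hx₀).continuousAt.eventually_const_lt hh0
      filter_upwards [hev, hopen.mem_nhds hx₀] with x hx1 hx2
      have h1 := hmax x (O x) hx2 (O.norm_map x)
      rw [← hOx₀] at h1
      unfold doubling at h1
      rw [anglePenalty_reflection he hx₀ hh0.le, anglePenalty_reflection he hx2 hx1.le] at h1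
      simp only [hg_def]
      linarith)
  have hgw : HasGradientAt w (gradient w x₀) x₀ := hw.1.hasGradientAt hopen hx₀
  have hgy : HasGradientAt w (gradient w (O x₀)) (O x₀) :=
    hw.1.hasGradientAt hopen (by simpa using hx₀)
  have hgf : gradient (fun x => w x - (1 - δ) * w (O x)) x₀
      = gradient w x₀ - (1 - δ) • O (gradient w y₀) := by
    have := (hgw.fun_sub ((hgy.comp_linearIsometryEquiv O).fun_const_mul (1 - δ))).gradient
    rw [this, hOx₀, hsymm]
  rw [hgf] at hgr
  set B : ℝ := A * (3 - 2 * h) / 2 with hB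
  obtain ⟨a, ha⟩ : ∃ a : ℝ, gradient w x₀ = a • x₀ + (B * ‖x₀‖⁻¹) • e := by
    have hν : ‖(‖x₀‖⁻¹ • y₀)‖ = 1 := by
      rw [norm_smul, norm_inv, norm_norm, hxy, inv_mul_cancel₀ hpos.ne']
    have hνy : ‖x₀‖ • ‖x₀‖⁻¹ • y₀ = y₀ := by
      rw [smul_smul, mul_inv_cancel₀ hpos.ne', one_smul]
    obtain ⟨a, ha⟩ := gradient_eq_of_doubling_max hw.1 (δ := δ) (A := A) (κ := κ) (s₀ := s₀)
      hx₀ hν (by rw [hνy, hsin]; positivity) (fun x hx => by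
        rw [hνy]
        exact hmax x _ hx (by rw [norm_smul, hν, norm_norm, mul_one]))
    rw [hνy, hsin, Real.sqrt_sq hh0.le] at ha
    refine ⟨a - A * ((3 - 2 * h) / (4 * h)) * ‖x₀‖⁻¹ * ‖x₀‖⁻¹, ?_⟩
    have hBe : B * ‖x₀‖⁻¹ = A * ((3 - 2 * h) / (4 * h)) * ‖x₀‖⁻¹ * ‖x₀‖⁻¹ * (2 * (h * ‖x₀‖)) := by
      rw [hB]; field_simp; ring
    rw [ha, hBe]
    rw [show (‖x₀‖⁻¹ • y₀ : E) = ‖x₀‖⁻¹ • (x₀ - (2 * (h * ‖x₀‖)) • e) by rw [← hy₀]]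
    module
  have hq' : (1 - δ) • O (gradient w y₀)
      = (a - (t - 2 * B * h) * (‖x₀‖⁻¹ * ‖x₀‖⁻¹)) • x₀ + ((-B) * ‖x₀‖⁻¹) • e := by
    have h1 : (1 - δ) • O (gradient w y₀) = gradient w x₀ - touchField g₁ A e x₀ := by
      rw [← hgr]; abel
    rw [h1, ha, touchField, ← hh, ← ht]
    have h2 : A * (3 - 2 * h) = 2 * B := by rw [hB]; ring
    have h3 : A * ((3 - 2 * h) * h) = 2 * B * h := by rw [hB]; ring
    rw [h2, h3]
    module
  have hδ : 0 < 1 - δ := by linarith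
  set a' : ℝ := ‖x₀‖ * ‖gradient w x₀‖ with ha'
  set b' : ℝ := ‖x₀‖ * ‖(1 - δ) • O (gradient w y₀)‖ with hb'
  have hby : ‖x₀‖ * ‖gradient w y₀‖ = b' / (1 - δ) := by
    rw [hb', norm_smul, Real.norm_eq_abs, abs_of_pos hδ, O.norm_map]
    field_simp
  set P : ℝ := a * ‖x₀‖ ^ 2 + B * h - t with hP
  have hsq1 : a' ^ 2 = (P + t) ^ 2 + B ^ 2 * (1 - h ^ 2) := by
    rw [ha', ha, norm_mul_norm_smul_add_smul_sq hx₀ he, hP]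
    ring
  have hsq2 : b' ^ 2 = P ^ 2 + B ^ 2 * (1 - h ^ 2) := by
    rw [hb', hq', norm_mul_norm_smul_add_smul_sq hx₀ he, hP]
    have : (a - (t - 2 * B * h) * (‖x₀‖⁻¹ * ‖x₀‖⁻¹)) * ‖x₀‖ ^ 2
        = a * ‖x₀‖ ^ 2 - (t - 2 * B * h) := by field_simp
    rw [this]
    ring
  have hinner : ⟪x₀, gradient w x₀⟫ - (1 - δ) * ⟪y₀, gradient w y₀⟫ = t := by
    have h1 : ⟪y₀, gradient w y₀⟫ = ⟪x₀, O (gradient w y₀)⟫ := by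
      rw [← O.inner_map_map x₀, hOO, hOx₀]
    rw [h1, ← real_inner_smul_right, ← inner_sub_right, hgr, touchField, inner_add_right,
      real_inner_smul_right, real_inner_smul_right, real_inner_self_eq_norm_sq, ← ht, ← hh]
    have h2 : ⟪x₀, e⟫ = h * ‖x₀‖ := by rw [hh, angleCos, inv_mul_cancel_right₀ hpos.ne']
    rw [h2]
    field_simp
    ring
  have hD : 0 ≤ Real.exp ((q - 1) * (w x₀ + β * Real.log ‖x₀‖))
      - (1 - δ) * Real.exp ((q - 1) * (w y₀ + β * Real.log ‖x₀‖)) := by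
    have h1 : Real.exp ((q - 1) * (w y₀ + β * Real.log ‖x₀‖))
        ≤ Real.exp ((q - 1) * (w x₀ + β * Real.log ‖x₀‖)) :=
      Real.exp_le_exp.mpr (mul_le_mul_of_nonneg_left (by linarith) (by linarith))
    have h2 := mul_nonneg hδ0.le (Real.exp_pos ((q - 1) * (w y₀ + β * Real.log ‖x₀‖))).le
    linarith
  have hb0 : 0 ≤ b' := by positivity
  have hpow : (1 - δ) * (b' / (1 - δ)) ^ (1 - τ) = (1 - δ) ^ τ * b' ^ (1 - τ) := by
    rw [Real.div_rpow hb0 hδ.le, Real.rpow_sub hδ, Real.rpow_one]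
    have := Real.rpow_pos_of_pos hδ τ
    field_simp
  have hcoef : -2 * (1 - h ^ 2) - ((Module.finrank ℝ E : ℝ) - 1) * ((3 - 2 * h) * h) ≤ -1 := by
    have h1 : (2 : ℝ) ≤ Module.finrank ℝ E := by exact_mod_cast hE
    have h2 : 0 ≤ (3 - 2 * h) * h := mul_nonneg (by linarith) hh0.le
    have h3 := mul_le_mul_of_nonneg_right (by linarith : (1 : ℝ) ≤ Module.finrank ℝ E - 1) h2
    have h4 : 0 ≤ (4 * h + 1) * (1 - h) := mul_nonneg (by linarith) (by linarith)
    linarith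
  refine le_doublingError (g₂ := κ * d) hτ0 hτ1 hδ0 hδ1 hκ (by positivity) hb0
    (mul_nonneg (sq_nonneg B) (sub_nonneg.mpr (pow_le_one₀ hh0.le hh1))) hsq1 hsq2 htκ
    (mul_le_of_le_one_right hκ hd1) hD ?_
  rw [hOx₀, hxy, hby] at hineq
  have hscale : ∀ u v : ℝ, ‖x₀‖ ^ 2 * ((‖x₀‖ ^ 2)⁻¹ * u - (1 - δ) * ((‖x₀‖ ^ 2)⁻¹ * v))
      = u - (1 - δ) * v := fun u v => by field_simp
  rw [hscale, ← hh, ← ht] at hineq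
  have hbsq : (1 - δ) * (b' / (1 - δ)) ^ 2 = b' ^ 2 / (1 - δ) := by field_simp
  have hAc := mul_le_mul_of_nonneg_left hcoef hA.le
  have hi : ((Module.finrank ℝ E : ℝ) - 2 + 2 * ρ) * ⟪x₀, gradient w x₀⟫
      - (1 - δ) * (((Module.finrank ℝ E : ℝ) - 2 + 2 * ρ) * ⟪y₀, gradient w y₀⟫)
      = ((Module.finrank ℝ E : ℝ) - 2 + 2 * ρ) * t := by
    rw [← hinner]; ring
  rw [← hpow, ← hbsq]
  linarith

end DoublingMax

section DoublingBound

variable {E : Type*} [NormedAddCommGroup E] [InnerProductSpace ℝ E]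

lemma continuousOn_doubling {w : E → ℝ} (hw : ContinuousOn w {0}ᶜ) (δ A κ s₀ : ℝ) :
    ContinuousOn (fun p : E × E => doubling w δ A κ s₀ p.1 p.2) ({0}ᶜ ×ˢ {0}ᶜ) := by
  have h1 : ContinuousOn (fun p : E × E => w p.1) ({0}ᶜ ×ˢ {0}ᶜ) :=
    hw.comp continuousOn_fst fun p hp => hp.1
  have h2 : ContinuousOn (fun p : E × E => w p.2) ({0}ᶜ ×ˢ {0}ᶜ) :=
    hw.comp continuousOn_snd fun p hp => hp.2
  have h3 : ContinuousOn (fun p : E × E => Real.log ‖p.1‖) ({0}ᶜ ×ˢ {0}ᶜ) :=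
    continuousOn_log_norm.comp continuousOn_fst fun p hp => hp.1
  have h4 : ContinuousOn (fun p : E × E => ‖p.1‖⁻¹) ({0}ᶜ ×ˢ {0}ᶜ) :=
    continuousOn_fst.norm.inv₀ fun p hp => norm_ne_zero_iff.mpr hp.1
  have h5 : ContinuousOn (fun p : E × E => ‖p.2‖⁻¹) ({0}ᶜ ×ˢ {0}ᶜ) :=
    continuousOn_snd.norm.inv₀ fun p hp => norm_ne_zero_iff.mpr hp.2
  have h6 : ContinuousOn (fun p : E × E => sinHalfSq p.1 p.2) ({0}ᶜ ×ˢ {0}ᶜ) :=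
    (continuousOn_const.sub ((continuousOn_fst.inner continuousOn_snd).mul
      (h4.mul h5))).div_const 2
  exact ((h1.sub (continuousOn_const.mul h2)).sub (continuousOn_const.mul
    ((continuousOn_const.mul h6.sqrt).sub h6))).sub (continuousOn_const.mul
      ((continuousOn_const.add ((h3.sub continuousOn_const).pow 2)).sqrt.sub continuousOn_const))

lemma exists_doubling_max [FiniteDimensional ℝ E] {w : E → ℝ} (hw : ContinuousOn w {0}ᶜ)
    {δ A κ κ' C : ℝ} (s₀ : ℝ) (hA : 0 ≤ A) (hκ : 0 ≤ κ) (hκ' : κ' < κ)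
    (hgrow : ∀ x y : E, x ≠ 0 → ‖y‖ = ‖x‖ → w x - (1 - δ) * w y ≤ C + κ' * |Real.log ‖x‖|)
    {x₁ : E} (hx₁ : x₁ ≠ 0) :
    ∃ x₀ y₀ : E, x₀ ≠ 0 ∧ ‖y₀‖ = ‖x₀‖ ∧ ∀ x y, x ≠ 0 → ‖y‖ = ‖x‖ →
      doubling w δ A κ s₀ x y ≤ doubling w δ A κ s₀ x₀ y₀ := by
  set m := doubling w δ A κ s₀ x₁ x₁ with hm
  set R := max |Real.log ‖x₁‖| ((C + κ * |s₀| + κ - m) / (κ - κ')) with hR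
  set K : Set (E × E) := ({x : E | Real.exp (-R) ≤ ‖x‖ ∧ ‖x‖ ≤ Real.exp R} ×ˢ
    {x : E | Real.exp (-R) ≤ ‖x‖ ∧ ‖x‖ ≤ Real.exp R}) ∩ {p | ‖p.2‖ = ‖p.1‖} with hK
  have hKc : IsCompact K :=
    ((isCompact_norm_mem_Icc _ _).prod (isCompact_norm_mem_Icc _ _)).inter_right
      (isClosed_eq continuous_snd.norm continuous_fst.norm)
  have hne : ∀ x : E, Real.exp (-R) ≤ ‖x‖ → x ≠ 0 := fun x hx =>
    norm_pos_iff.mp ((Real.exp_pos _).trans_le hx)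
  have hmem : ∀ x : E, x ≠ 0 → |Real.log ‖x‖| ≤ R → Real.exp (-R) ≤ ‖x‖ ∧ ‖x‖ ≤ Real.exp R := by
    intro x hx h
    rw [abs_le] at h
    have hpos : 0 < ‖x‖ := norm_pos_iff.mpr hx
    exact ⟨(Real.le_log_iff_exp_le hpos).mp h.1, (Real.log_le_iff_le_exp hpos).mp h.2⟩
  have hx₁K : (x₁, x₁) ∈ K :=
    ⟨⟨hmem x₁ hx₁ (le_max_left _ _), hmem x₁ hx₁ (le_max_left _ _)⟩, rfl⟩
  obtain ⟨p, hpK, hp⟩ := hKc.exists_isMaxOn ⟨_, hx₁K⟩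
    ((continuousOn_doubling hw δ A κ s₀).mono fun p hp => ⟨hne _ hp.1.1.1, hne _ hp.1.2.1⟩)
  refine ⟨p.1, p.2, hne _ hpK.1.1.1, hpK.2, fun x y hx hxy => ?_⟩
  by_cases hxR : |Real.log ‖x‖| ≤ R
  · have h := hmem x hx hxR
    exact hp (⟨⟨h, by rw [← hxy] at h; exact h⟩, hxy⟩ : (x, y) ∈ K)
  · refine le_trans ?_ (hp hx₁K)
    change _ ≤ m
    push Not at hxR
    have h1 : (C + κ * |s₀| + κ - m) / (κ - κ') < |Real.log ‖x‖| :=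
      lt_of_le_of_lt (le_max_right _ _) hxR
    rw [div_lt_iff₀ (by linarith)] at h1
    have h2 := hgrow x y hx hxy
    have h3 := mul_nonneg hA (anglePenalty_nonneg x y)
    have h4 := mul_le_mul_of_nonneg_left (abs_sub_one_le_sqrt (Real.log ‖x‖ - s₀)) hκ
    have h5 := mul_le_mul_of_nonneg_left (abs_sub_abs_le_abs_sub (Real.log ‖x‖) s₀) hκ
    unfold doubling
    linarith

variable [FiniteDimensional ℝ E] [MeasurableSpace E] [BorelSpace E] {ρ lam τ q β : ℝ} {w : E → ℝ}

lemma IsLogSolution.oscillation_le (hw : IsLogSolution ρ lam τ q β w)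
    (hE : 2 ≤ Module.finrank ℝ E) (hτ0 : 0 ≤ τ) (hτ1 : τ < 1) (hq : 1 < q) {c : ℝ}
    (hc : ∀ x ≠ 0, w x + β * Real.log ‖x‖ ≤ c) {δ A κ κ' C : ℝ} (hδ0 : 0 < δ) (hδ1 : δ < 1)
    (hκβ : δ * |β| ≤ κ) (hA : 0 < A) (hAerr : doublingError ρ lam τ δ κ < A) (hκ' : κ' < κ)
    (hgrow : ∀ x y : E, x ≠ 0 → ‖y‖ = ‖x‖ → w x - (1 - δ) * w y ≤ C + κ' * |Real.log ‖x‖|)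
    {x₁ y₁ : E} (hx₁ : x₁ ≠ 0) (hxy₁ : ‖y₁‖ = ‖x₁‖) :
    (1 - δ) * (w x₁ - w y₁) ≤ 2 * A + δ * (|β| + c - (w x₁ + β * Real.log ‖x₁‖)) := by
  have hκ : 0 ≤ κ := le_trans (by positivity) hκβ
  obtain ⟨x₀, y₀, hx₀, hxy, hmax⟩ := exists_doubling_max hw.1.continuousOn (Real.log ‖x₁‖) hA.le
    hκ hκ' hgrow hx₁
  have hle : w x₀ ≤ w y₀ := by
    by_contra! hlt
    exact absurd (hw.le_doublingError_of_max hE hτ0 hτ1 hq hδ0 hδ1 hκ hA hx₀ hxy hlt hmax)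
      (not_le.mpr hAerr)
  have h1 := hmax x₁ y₁ hx₁ hxy₁
  unfold doubling at h1
  rw [sub_self, zero_pow two_ne_zero, add_zero, Real.sqrt_one, sub_self, mul_zero, sub_zero] at h1
  have h2 := mul_le_mul_of_nonneg_left (anglePenalty_le_two x₁ y₁) hA.le
  have h3 := mul_nonneg hA.le (anglePenalty_nonneg x₀ y₀)
  set t := Real.log ‖x₀‖ - Real.log ‖x₁‖ with ht
  have h4 := abs_sub_one_le_sqrt t
  have h5 : 0 ≤ √(1 + t ^ 2) - 1 := by
    linarith [Real.one_le_sqrt.mpr (by nlinarith [sq_nonneg t] : (1 : ℝ) ≤ 1 + t ^ 2)]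
  have h6 := mul_le_mul_of_nonneg_right hκβ h5
  have h7 := mul_le_mul_of_nonneg_left h4 (by positivity : 0 ≤ δ * |β|)
  have h8 : δ * w x₀ ≤ δ * (c - β * Real.log ‖x₁‖ + |β| * |t|) := by
    refine mul_le_mul_of_nonneg_left ?_ hδ0.le
    have h9 := hc x₀ hx₀
    have h10 : -(β * t) ≤ |β| * |t| := by rw [← abs_mul]; exact neg_le_abs _
    rw [ht] at h10 ⊢
    linarith
  have h11 := mul_le_mul_of_nonneg_left hle (by linarith : 0 ≤ 1 - δ)
  linarith

end DoublingBound

section Radial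

lemma doublingError_nonneg (ρ lam τ : ℝ) {δ κ : ℝ} (hδ : 0 < δ) (hκ : 0 ≤ κ) :
    0 ≤ doublingError ρ lam τ δ κ := by
  unfold doublingError
  positivity

lemma tendsto_doublingError (ρ lam : ℝ) {τ : ℝ} (hτ1 : τ < 1) (m : ℝ) :
    Tendsto (fun δ => doublingError ρ lam τ δ (δ * m)) (𝓝[>] 0) (𝓝 0) := by
  have h : Tendsto (fun δ : ℝ => δ * m * (1 + 2 * |ρ|) + (δ * m) ^ 2 + 2 * δ * m ^ 2
      + |lam| * (δ * m) ^ (1 - τ) + |lam| * δ + δ * lam ^ 2 / 2) (𝓝 0) (𝓝 0) := by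
    have hr : ContinuousAt (fun δ : ℝ => (δ * m) ^ (1 - τ)) 0 :=
      ContinuousAt.rpow_const (by fun_prop) (Or.inr (by linarith))
    have hc : ContinuousAt (fun δ : ℝ => δ * m * (1 + 2 * |ρ|) + (δ * m) ^ 2 + 2 * δ * m ^ 2
      + |lam| * (δ * m) ^ (1 - τ) + |lam| * δ + δ * lam ^ 2 / 2) 0 := by fun_prop
    have := hc.tendsto
    simpa [Real.zero_rpow (by linarith : 1 - τ ≠ 0)] using this
  refine (h.mono_left nhdsWithin_le_nhds).congr' ?_
  filter_upwards [self_mem_nhdsWithin] with δ hδ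
  have hδ' : δ ≠ 0 := (Set.mem_Ioi.mp hδ).ne'
  unfold doublingError
  have : 2 * (δ * m) ^ 2 / δ = 2 * δ * m ^ 2 := by field_simp
  rw [this]

variable {E : Type*} [NormedAddCommGroup E] [InnerProductSpace ℝ E] [FiniteDimensional ℝ E]
  [MeasurableSpace E] [BorelSpace E] {ρ lam τ q β : ℝ} {w : E → ℝ}

lemma IsLogSolution.exists_slow_oscillation (hw : IsLogSolution ρ lam τ q β w)
    (hE : 2 ≤ Module.finrank ℝ E) (hτ0 : 0 ≤ τ) (hτ1 : τ < 1) (hq : 1 < q) :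
    ∃ m, 0 ≤ m ∧ ∀ δ, 0 < δ → δ ≤ 1 / 2 → ∃ C, ∀ x y : E, x ≠ 0 → ‖y‖ = ‖x‖ →
      w x - w y ≤ C + δ * m * |Real.log ‖x‖| := by
  have : Nontrivial E := Module.nontrivial_of_finrank_pos (R := ℝ) (by omega)
  obtain ⟨c, hc⟩ := hw.exists_upper_bound hτ0 hτ1 hq
  obtain ⟨C₀, k, hk, hlow⟩ := hw.exists_lower_bound hτ0 hτ1 hq
  refine ⟨2 * (k + |β|), by positivity, fun δ hδ0 hδ2 => ?_⟩
  have hβ : ∀ x : E, -(|β| * |Real.log ‖x‖|) ≤ β * Real.log ‖x‖ := fun x => by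
    rw [← abs_mul]; exact neg_abs_le _
  set κ := |β| + k + 1 with hκ
  set A := doublingError ρ lam τ δ κ + 1 with hA
  have hA0 : 0 < A := by linarith [doublingError_nonneg ρ lam τ hδ0 (by positivity : 0 ≤ κ)]
  refine ⟨2 * (2 * A + δ * (|β| + c + C₀)), fun x y hx hxy => ?_⟩
  have hyx : y ≠ 0 := by rw [← norm_pos_iff, hxy]; exact norm_pos_iff.mpr hx
  have hosc := hw.oscillation_le hE hτ0 hτ1 hq hc (A := A) (κ := κ) (κ' := |β| + k)
    (C := c + |C₀|) hδ0 (by linarith) (by nlinarith [abs_nonneg β]) hA0 (by linarith)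
    (by linarith) (fun x y hx hxy => by
      have hy : y ≠ 0 := by rw [← norm_pos_iff, hxy]; exact norm_pos_iff.mpr hx
      have h1 := hc x hx
      have h2 := hlow y hy
      rw [hxy] at h2
      have h3 : -(1 - δ) * w y ≤ |C₀| + k * |Real.log ‖x‖| := by
        have h4 : 0 ≤ |C₀| + k * |Real.log ‖x‖| := by positivity
        have h5 : -w y ≤ |C₀| + k * |Real.log ‖x‖| := by linarith [le_abs_self C₀]
        nlinarith
      linarith [hβ x]) hx hxy
  have h1 := hlow x hx
  have h2 := hc x hx
  have h3 : 0 ≤ 2 * A + δ * (|β| + c - (w x + β * Real.log ‖x‖)) :=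
    add_nonneg (by linarith) (mul_nonneg hδ0.le (by linarith [abs_nonneg β]))
  have h4 : w x - w y ≤ 2 * (2 * A + δ * (|β| + c - (w x + β * Real.log ‖x‖))) := by
    rcases le_total (w x - w y) 0 with h | h
    · linarith
    · nlinarith
  have h5 : δ * (|β| + c - (w x + β * Real.log ‖x‖))
      ≤ δ * (|β| + c + C₀ + (k + |β|) * |Real.log ‖x‖|) :=
    mul_le_mul_of_nonneg_left (by linarith [hβ x]) hδ0.le
  linarith

lemma IsLogSolution.eq_of_norm_eq (hw : IsLogSolution ρ lam τ q β w)
    (hE : 2 ≤ Module.finrank ℝ E) (hτ0 : 0 ≤ τ) (hτ1 : τ < 1) (hq : 1 < q) {x y : E}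
    (hx : x ≠ 0) (hxy : ‖y‖ = ‖x‖) : w x = w y := by
  suffices h : ∀ x y : E, x ≠ 0 → ‖y‖ = ‖x‖ → w x ≤ w y by
    have hy : y ≠ 0 := by rw [← norm_pos_iff, hxy]; exact norm_pos_iff.mpr hx
    exact le_antisymm (h x y hx hxy) (h y x hy hxy.symm)
  clear hx hxy x y
  intro x y hx hxy
  obtain ⟨c, hc⟩ := hw.exists_upper_bound hτ0 hτ1 hq
  obtain ⟨m, hm, hosc⟩ := hw.exists_slow_oscillation hE hτ0 hτ1 hq
  have hβ : ∀ x : E, -(|β| * |Real.log ‖x‖|) ≤ β * Real.log ‖x‖ := fun x => by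
    rw [← abs_mul]; exact neg_abs_le _
  set M := m + |β| + 1 with hM
  have hM0 : 0 ≤ M := by positivity
  have key : ∀ δ ∈ Set.Ioc (0 : ℝ) (1 / 2), (1 - δ) * (w x - w y)
      ≤ 2 * (doublingError ρ lam τ δ (δ * M) + δ)
        + δ * (|β| + c - (w x + β * Real.log ‖x‖)) := by
    rintro δ ⟨hδ0, hδ2⟩
    obtain ⟨C, hC⟩ := hosc δ hδ0 hδ2
    have herr := doublingError_nonneg ρ lam τ hδ0 (by positivity : 0 ≤ δ * M)
    refine hw.oscillation_le hE hτ0 hτ1 hq hc (κ := δ * M) (κ' := δ * (m + |β|)) (C := C + δ * c)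
      hδ0 (by linarith) (mul_le_mul_of_nonneg_left (by linarith) hδ0.le) (by linarith)
      (by linarith) (mul_lt_mul_of_pos_left (by linarith) hδ0) (fun x y hx hxy => ?_) hx hxy
    have hy : y ≠ 0 := by rw [← norm_pos_iff, hxy]; exact norm_pos_iff.mpr hx
    have h1 := hC x y hx hxy
    have h2 := hc y hy
    rw [hxy] at h2
    have h3 : δ * w y ≤ δ * (c + |β| * |Real.log ‖x‖|) :=
      mul_le_mul_of_nonneg_left (by linarith [hβ x]) hδ0.le
    linarith
  have hl : Tendsto (fun δ : ℝ => (1 - δ) * (w x - w y)) (𝓝[>] 0) (𝓝 (w x - w y)) := by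
    have h : ContinuousAt (fun δ : ℝ => (1 - δ) * (w x - w y)) 0 := by fun_prop
    have := h.tendsto
    rw [sub_zero, one_mul] at this
    exact this.mono_left nhdsWithin_le_nhds
  have hr : Tendsto (fun δ : ℝ => 2 * (doublingError ρ lam τ δ (δ * M) + δ)
        + δ * (|β| + c - (w x + β * Real.log ‖x‖))) (𝓝[>] 0) (𝓝 0) := by
    have hid : Tendsto (fun δ : ℝ => δ) (𝓝[>] 0) (𝓝 0) := nhdsWithin_le_nhds
    have := (((tendsto_doublingError ρ lam hτ1 M).add hid).const_mul 2).add
      (hid.mul_const (|β| + c - (w x + β * Real.log ‖x‖)))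
    simpa using this
  have hev : ∀ᶠ δ : ℝ in 𝓝[>] 0, δ ∈ Set.Ioc (0 : ℝ) (1 / 2) := Ioc_mem_nhdsGT (by norm_num)
  have := le_of_tendsto_of_tendsto hl hr (hev.mono key)
  linarith

end Radial

section LogTransform

/-- The gradient term of (E) for `u = exp w`, divided by `u`. -/
lemma gradient_term_div {τ z r a : ℝ} (hz : 0 < z) (hr : 0 < r) (ha : 0 ≤ a) :
    z ^ τ * (z * a) ^ (1 - τ) / r ^ (τ + 1) * z⁻¹ = (r ^ 2)⁻¹ * (r * a) ^ (1 - τ) := by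
  rw [Real.mul_rpow hz.le ha, Real.mul_rpow hr.le ha, Real.rpow_sub hz, Real.rpow_sub hr,
    Real.rpow_add hr, Real.rpow_one, Real.rpow_one]
  have h1 := Real.rpow_pos_of_pos hz τ
  have h2 := Real.rpow_pos_of_pos hr τ
  field_simp

lemma absorption_term_div {θ q z r : ℝ} (hq : 1 < q) (hz : 0 < z) (hr : 0 < r) :
    r ^ θ * z ^ q * z⁻¹
      = (r ^ 2)⁻¹ * Real.exp ((q - 1) * (Real.log z + (θ + 2) / (q - 1) * Real.log r)) := by
  have hq' : q - 1 ≠ 0 := by linarith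
  have h1 : (q - 1) * (Real.log z + (θ + 2) / (q - 1) * Real.log r)
      = Real.log z * q - Real.log z + (Real.log r * θ + Real.log r + Real.log r) := by
    field_simp
    ring
  rw [h1, Real.exp_add, Real.exp_sub, Real.exp_add, Real.exp_add, Real.exp_log hz,
    Real.exp_log hr, Real.rpow_def_of_pos hr, Real.rpow_def_of_pos hz]
  field_simp

variable {N : ℕ} {ρ lam τ θ q : ℝ} {u : EuclideanSpace ℝ (Fin N) → ℝ}

lemma IsSolutionE.isLogSolution (hN : 2 ≤ N) (hτ1 : τ < 1) (hq : 1 < q)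
    (hu : IsSolutionE N ρ lam τ θ q Set.univ u) :
    IsLogSolution ρ lam τ q ((θ + 2) / (q - 1)) (fun x => Real.log (u x)) := by
  obtain ⟨⟨hu1, hu0⟩, hweak⟩ := hu
  have hset : (Set.univ \ {0} : Set (EuclideanSpace ℝ (Fin N))) = {0}ᶜ :=
    (Set.compl_eq_univ_sdiff _).symm
  unfold IsTestFun weakE at hweak
  rw [hset] at hu1 hu0 hweak
  have hopen : IsOpen ({0}ᶜ : Set (EuclideanSpace ℝ (Fin N))) := isOpen_compl_singleton
  have hfin : Module.finrank ℝ (EuclideanSpace ℝ (Fin N)) = N := by simp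
  have : Nontrivial (EuclideanSpace ℝ (Fin N)) :=
    Module.nontrivial_of_finrank_pos (R := ℝ) (by omega)
  have hae : ∀ᵐ x : EuclideanSpace ℝ (Fin N), x ∈ ({0}ᶜ : Set (EuclideanSpace ℝ (Fin N))) :=
    compl_mem_ae_iff.mpr (measure_singleton 0)
  set w : EuclideanSpace ℝ (Fin N) → ℝ := fun x => Real.log (u x) with hw_def
  have hw1 : ContDiffOn ℝ 1 w {0}ᶜ := hu1.log fun x hx => (hu0 x hx).ne'
  have hgc : ContinuousOn (gradient w) {0}ᶜ := hw1.continuousOn_gradient hopen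
  have hnc : ContinuousOn (fun x : EuclideanSpace ℝ (Fin N) => (‖x‖ ^ 2)⁻¹) {0}ᶜ :=
    (continuousOn_id.norm.pow 2).inv₀ fun x hx => pow_ne_zero 2 (norm_ne_zero_iff.mpr hx)
  have hG₁ : ContinuousOn (fun x => ‖gradient w x‖ ^ 2) {0}ᶜ := hgc.norm.pow 2
  have hG₂ : ContinuousOn (fun x => (‖x‖ ^ 2)⁻¹ * ⟪x, gradient w x⟫) {0}ᶜ :=
    hnc.mul (continuousOn_id.inner hgc)
  have hG₃ : ContinuousOn (fun x => (‖x‖ ^ 2)⁻¹ * (‖x‖ * ‖gradient w x‖) ^ (1 - τ)) {0}ᶜ :=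
    hnc.mul ((continuousOn_id.norm.mul hgc.norm).rpow_const fun x _ => Or.inr (by linarith))
  have hG₄ : ContinuousOn (fun x => (‖x‖ ^ 2)⁻¹ * Real.exp ((q - 1) *
      (w x + (θ + 2) / (q - 1) * Real.log ‖x‖))) {0}ᶜ :=
    hnc.mul (Real.continuous_exp.comp_continuousOn (continuousOn_const.mul
      (hw1.continuousOn.add (continuousOn_const.mul continuousOn_log_norm))))
  have hF : ∀ x ∈ ({0}ᶜ : Set (EuclideanSpace ℝ (Fin N))), (‖x‖ ^ 2)⁻¹ *
      (-(‖x‖ * ‖gradient w x‖) ^ 2 + (Module.finrank ℝ (EuclideanSpace ℝ (Fin N)) - 2 + 2 * ρ)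
        * ⟪x, gradient w x⟫ - lam * (‖x‖ * ‖gradient w x‖) ^ (1 - τ)
        + Real.exp ((q - 1) * (w x + (θ + 2) / (q - 1) * Real.log ‖x‖)))
      = -‖gradient w x‖ ^ 2 + ((N : ℝ) - 2 + 2 * ρ) * ((‖x‖ ^ 2)⁻¹ * ⟪x, gradient w x⟫)
        - lam * ((‖x‖ ^ 2)⁻¹ * (‖x‖ * ‖gradient w x‖) ^ (1 - τ))
        + (‖x‖ ^ 2)⁻¹ * Real.exp ((q - 1) * (w x + (θ + 2) / (q - 1) * Real.log ‖x‖)) := by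
    intro x hx
    have hpos : 0 < ‖x‖ := norm_pos_iff.mpr hx
    rw [hfin]
    have h1 : (‖x‖ ^ 2)⁻¹ * (‖x‖ * ‖gradient w x‖) ^ 2 = ‖gradient w x‖ ^ 2 := by field_simp
    rw [← h1]
    ring
  refine ⟨hw1, ContinuousOn.congr (((hG₁.neg.add (continuousOn_const.mul hG₂)).sub
    (continuousOn_const.mul hG₃)).add hG₄) hF, fun φ hφ hφc hφs => ?_⟩
  have hψ := hweak (fun x => φ x * (u x)⁻¹) ⟨contDiff_of_contDiffAt_tsupport fun x hx => by
      have hx' : x ∈ ({0}ᶜ : Set (EuclideanSpace ℝ (Fin N))) := hφs (tsupport_mul_subset_left hx)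
      exact hφ.contDiffAt.mul ((hu1.contDiffAt (hopen.mem_nhds hx')).inv (hu0 x hx').ne'),
    hφc.mul_right, tsupport_mul_subset_left.trans hφs⟩
  simp only [Measure.restrict_eq_self_of_ae_mem hae] at hψ
  have hgw : ∀ x ∈ ({0}ᶜ : Set (EuclideanSpace ℝ (Fin N))), gradient u x = u x • gradient w x := by
    intro x hx
    have h1 := ((Real.hasDerivAt_log (hu0 x hx).ne').comp_hasGradientAt
      (hu1.hasGradientAt hopen hx)).gradient
    change gradient u x = u x • gradient (fun y => Real.log (u y)) x
    rw [h1, smul_smul, mul_inv_cancel₀ (hu0 x hx).ne', one_smul]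
  have hgψ : ∀ x ∈ ({0}ᶜ : Set (EuclideanSpace ℝ (Fin N))),
      gradient (fun x => φ x * (u x)⁻¹) x
        = (u x)⁻¹ • (gradient φ x - φ x • gradient w x) := by
    intro x hx
    have h1 := (hasDerivAt_inv (hu0 x hx).ne').comp_hasGradientAt (hu1.hasGradientAt hopen hx)
    have h2 : HasGradientAt φ (gradient φ x) x := (hφ.differentiable one_ne_zero x).hasGradientAt
    rw [(h2.fun_mul h1).gradient, hgw x hx, smul_smul (-(u x ^ 2)⁻¹)]
    have h3 : -(u x ^ 2)⁻¹ * u x = -(u x)⁻¹ := by have := hu0 x hx; field_simp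
    rw [h3]
    module
  have hi₀ := integrable_inner_gradient hopen hgc hφ hφc hφs
  have hi₁ := integrable_mul_of_tsupport_subset hopen hG₁ hφ.continuous hφc hφs
  have hi₂ := integrable_mul_of_tsupport_subset hopen hG₂ hφ.continuous hφc hφs
  have hi₃ := integrable_mul_of_tsupport_subset hopen hG₃ hφ.continuous hφc hφs
  have hi₄ := integrable_mul_of_tsupport_subset hopen hG₄ hφ.continuous hφc hφs
  have e₁ : ∫ x, ⟪gradient u x, gradient (fun x => φ x * (u x)⁻¹) x⟫
      = (∫ x, ⟪gradient w x, gradient φ x⟫) - ∫ x, ‖gradient w x‖ ^ 2 * φ x := by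
    rw [← integral_sub hi₀ hi₁]
    refine integral_congr_ae (hae.mono fun x hx => ?_)
    have := hu0 x hx
    simp only [hgw x hx, hgψ x hx, real_inner_smul_left, real_inner_smul_right, inner_sub_right,
      real_inner_self_eq_norm_sq]
    field_simp
  have e₂ : ∫ x, ⟪x, gradient u x⟫ / ‖x‖ ^ 2 * (φ x * (u x)⁻¹)
      = ∫ x, (‖x‖ ^ 2)⁻¹ * ⟪x, gradient w x⟫ * φ x := by
    refine integral_congr_ae (hae.mono fun x hx => ?_)
    have := hu0 x hx
    simp only [hgw x hx, real_inner_smul_right]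
    field_simp
  have e₃ : ∫ x, Gt τ x (u x) (gradient u x) * (φ x * (u x)⁻¹)
      = ∫ x, (‖x‖ ^ 2)⁻¹ * (‖x‖ * ‖gradient w x‖) ^ (1 - τ) * φ x := by
    refine integral_congr_ae (hae.mono fun x hx => ?_)
    simp only [Gt, hgw x hx, norm_smul, Real.norm_eq_abs, abs_of_pos (hu0 x hx)]
    rw [← gradient_term_div (hu0 x hx) (norm_pos_iff.mpr hx) (norm_nonneg _)]
    ring
  have e₄ : ∫ x, ‖x‖ ^ θ * u x ^ q * (φ x * (u x)⁻¹)
      = ∫ x, (‖x‖ ^ 2)⁻¹ * Real.exp ((q - 1) *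
        (w x + (θ + 2) / (q - 1) * Real.log ‖x‖)) * φ x := by
    refine integral_congr_ae (hae.mono fun x hx => ?_)
    simp only [hw_def]
    rw [← absorption_term_div hq (hu0 x hx) (norm_pos_iff.mpr hx)]
    ring
  rw [e₁, e₂, e₃, e₄] at hψ
  have e₅ : ∫ x, (‖x‖ ^ 2)⁻¹ *
      (-(‖x‖ * ‖gradient w x‖) ^ 2 + (Module.finrank ℝ (EuclideanSpace ℝ (Fin N)) - 2 + 2 * ρ)
        * ⟪x, gradient w x⟫ - lam * (‖x‖ * ‖gradient w x‖) ^ (1 - τ)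
        + Real.exp ((q - 1) * (w x + (θ + 2) / (q - 1) * Real.log ‖x‖))) * φ x
      = -(∫ x, ‖gradient w x‖ ^ 2 * φ x)
        + ((N : ℝ) - 2 + 2 * ρ) * (∫ x, (‖x‖ ^ 2)⁻¹ * ⟪x, gradient w x⟫ * φ x)
        + -lam * (∫ x, (‖x‖ ^ 2)⁻¹ * (‖x‖ * ‖gradient w x‖) ^ (1 - τ) * φ x)
        + ∫ x, (‖x‖ ^ 2)⁻¹ * Real.exp ((q - 1) *
          (w x + (θ + 2) / (q - 1) * Real.log ‖x‖)) * φ x := by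
    rw [← integral_neg, ← integral_const_mul, ← integral_const_mul,
      ← integral_add hi₁.fun_neg (hi₂.const_mul _),
      ← integral_add (hi₁.fun_neg.fun_add (hi₂.const_mul _)) (hi₃.const_mul _),
      ← integral_add ((hi₁.fun_neg.fun_add (hi₂.const_mul _)).fun_add (hi₃.const_mul _)) hi₄]
    refine integral_congr_ae (hae.mono fun x hx => ?_)
    simp only [hF x hx]
    ring
  rw [e₅]
  linarith

end LogTransform

section Monotone

lemma HasDerivAt.nonneg_of_forall_lt_le {f : ℝ → ℝ} {d r₀ : ℝ} (hf : HasDerivAt f d r₀)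
    {a : ℝ} (ha : a < r₀) (h : ∀ r, a < r → r < r₀ → f r ≤ f r₀) : 0 ≤ d := by
  have ht := (hasDerivAt_iff_tendsto_slope.mp hf).mono_left
    (nhdsWithin_mono r₀ (s := Set.Iio r₀) fun r hr => (Set.mem_Iio.mp hr).ne)
  refine ge_of_tendsto ht ?_
  filter_upwards [Ioo_mem_nhdsLT ha] with r hr
  rw [slope_def_field]
  exact div_nonneg_of_nonpos (by linarith [h r hr.1 hr.2]) (by linarith [hr.2])

variable {E : Type*} [NormedAddCommGroup E] [InnerProductSpace ℝ E] [FiniteDimensional ℝ E]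
  {ρ lam τ q β : ℝ} {w : E → ℝ}

/-- A non-positive radial derivative at `r₀` forces interior maxima of `w - ε log ‖x‖` in a fixed
annulus, for all small `ε > 0`. -/
lemma exists_isLocalMax_of_deriv_nonpos [Nontrivial E] (hβ : β < 0) {c : ℝ}
    (hc : ∀ x ≠ 0, w x + β * Real.log ‖x‖ ≤ c) (hcont : ContinuousOn w {0}ᶜ) {V : ℝ → ℝ}
    (hV : ∀ x ≠ 0, w x = V ‖x‖) {r₀ d : ℝ} (hr₀ : 0 < r₀) (hd : HasDerivAt V d r₀) (hd0 : d ≤ 0) :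
    ∃ R, ∀ ε, 0 < ε → ε < -β / 2 → ∃ x, Real.exp (-R) ≤ ‖x‖ ∧ ‖x‖ < r₀ ∧
      IsLocalMax (fun x => w x - ε * Real.log ‖x‖) x := by
  set m := V r₀ + β * |Real.log r₀| with hm
  set R := |Real.log r₀| + 2 * (|c| + |m|) / (-β) with hR
  have hfrac : 0 ≤ 2 * (|c| + |m|) / (-β) := div_nonneg (by positivity) (by linarith)
  refine ⟨R, fun ε hε0 hε => ?_⟩
  have hopen : IsOpen ({0}ᶜ : Set E) := isOpen_compl_singleton
  set K : Set E := {x : E | Real.exp (-R) ≤ ‖x‖ ∧ ‖x‖ ≤ r₀} with hK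
  have hne : ∀ x ∈ K, x ≠ 0 := fun x hx => norm_pos_iff.mp ((Real.exp_pos _).trans_le hx.1)
  obtain ⟨x₁, hx₁⟩ : ∃ x₁ : E, ‖x₁‖ = r₀ := exists_norm_eq E hr₀.le
  have hx₁K : x₁ ∈ K := by
    refine ⟨?_, hx₁.le⟩
    rw [hx₁, ← Real.le_log_iff_exp_le hr₀]
    linarith [neg_abs_le (Real.log r₀)]
  obtain ⟨x₀, hx₀K, hmaxK⟩ := (isCompact_norm_mem_Icc (E := E) (Real.exp (-R)) r₀).exists_isMaxOn
    ⟨x₁, hx₁K⟩ ((hcont.sub (continuousOn_const.mul continuousOn_log_norm)).mono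
      (t := K) hne : ContinuousOn (fun x => w x - ε * Real.log ‖x‖) K)
  have hx₀ : x₀ ≠ 0 := hne x₀ hx₀K
  have hbase : m ≤ w x₁ - ε * Real.log ‖x₁‖ := by
    rw [hV x₁ (hne x₁ hx₁K), hx₁, hm]
    have h1 : ε * Real.log r₀ ≤ ε * |Real.log r₀| :=
      mul_le_mul_of_nonneg_left (le_abs_self _) hε0.le
    have h2 : ε * |Real.log r₀| ≤ -β * |Real.log r₀| :=
      mul_le_mul_of_nonneg_right (by linarith) (abs_nonneg _)
    linarith
  have hmax : ∀ x : E, x ≠ 0 → ‖x‖ ≤ r₀ →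
      w x - ε * Real.log ‖x‖ ≤ w x₀ - ε * Real.log ‖x₀‖ := by
    intro x hx hxr
    by_cases hxK : Real.exp (-R) ≤ ‖x‖
    · exact hmaxK ⟨hxK, hxr⟩
    · refine le_trans ?_ (hmaxK hx₁K)
      refine le_trans ?_ hbase
      push Not at hxK
      have hs : Real.log ‖x‖ < -R := (Real.log_lt_iff_lt_exp (norm_pos_iff.mpr hx)).mpr hxK
      have h1 := hc x hx
      have hR0 : 0 ≤ R := by positivity
      have h2 : (-β - ε) * Real.log ‖x‖ ≤ (-β / 2) * Real.log ‖x‖ :=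
        mul_le_mul_of_nonpos_right (by linarith) (by linarith)
      have h3 : (-β / 2) * Real.log ‖x‖ ≤ (-β / 2) * (-(2 * (|c| + |m|) / (-β))) :=
        mul_le_mul_of_nonneg_left (by linarith [abs_nonneg (Real.log r₀)]) (by linarith)
      have h4 : (-β / 2) * (-(2 * (|c| + |m|) / (-β))) = -(|c| + |m|) := by
        have : β ≠ 0 := hβ.ne
        field_simp
      linarith [le_abs_self c, neg_abs_le m]
  have hlt : ‖x₀‖ < r₀ := by
    refine lt_of_le_of_ne hx₀K.2 fun heq => ?_
    have hder : HasDerivAt (fun r => V r - ε * Real.log r) (d - ε * r₀⁻¹) r₀ :=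
      hd.sub ((Real.hasDerivAt_log hr₀.ne').const_mul ε)
    have h1 := hder.nonneg_of_forall_lt_le hr₀ fun r hr0 hr => by
      obtain ⟨x, hx⟩ : ∃ x : E, ‖x‖ = r := exists_norm_eq E hr0.le
      have hxne : x ≠ 0 := norm_pos_iff.mp (by rw [hx]; exact hr0)
      have h2 := hmax x hxne (by rw [hx]; exact hr.le)
      rwa [hV x hxne, hV x₀ hx₀, hx, heq] at h2
    have h3 : 0 < ε * r₀⁻¹ := by positivity
    linarith
  refine ⟨x₀, hx₀K.1, hlt, ?_⟩
  have hball : ∀ᶠ x : E in 𝓝 x₀, ‖x‖ < r₀ := continuous_norm.continuousAt.eventually_lt_const hlt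
  filter_upwards [hball, hopen.mem_nhds hx₀] with x hx1 hx2
  exact hmax x hx2 hx1.le

variable [MeasurableSpace E] [BorelSpace E]

lemma IsLogSolution.deriv_pos [Nontrivial E] (hw : IsLogSolution ρ lam τ q β w) (hτ0 : 0 ≤ τ)
    (hτ1 : τ < 1) (hq : 1 < q) (hβ : β < 0) {V : ℝ → ℝ} (hV : ∀ x ≠ 0, w x = V ‖x‖) {r₀ d : ℝ}
    (hr₀ : 0 < r₀) (hd : HasDerivAt V d r₀) : 0 < d := by
  by_contra! hd0
  obtain ⟨c, hc⟩ := hw.exists_upper_bound hτ0 hτ1 hq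
  have hcont : ContinuousOn w {0}ᶜ := hw.1.continuousOn
  obtain ⟨R, hR⟩ := exists_isLocalMax_of_deriv_nonpos hβ hc hcont hV hr₀ hd hd0
  obtain ⟨ζ, hζ⟩ := ((isCompact_norm_mem_Icc (E := E) (Real.exp (-R)) r₀).bddBelow_image
    ((hcont.add (continuousOn_const.mul continuousOn_log_norm)).mono fun x hx =>
      norm_pos_iff.mp ((Real.exp_pos _).trans_le hx.1) :
      ContinuousOn (fun x => w x + β * Real.log ‖x‖) _))
  have key : ∀ ε ∈ Set.Ioo 0 (-β / 2), Real.exp ((q - 1) * ζ)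
      ≤ ε ^ 2 - 2 * ρ * ε + lam * |ε| ^ (1 - τ) := by
    rintro ε ⟨hε0, hε⟩
    obtain ⟨x, hx1, hx2, hmax⟩ := hR ε hε0 hε
    have hx : x ≠ 0 := norm_pos_iff.mp ((Real.exp_pos _).trans_le hx1)
    have h1 := hw.exp_le_of_isLocalMax hx (g := fun s => ε * s) (g₁ := fun _ => ε) (g₂ := 0)
      (Eventually.of_forall fun s => by simpa using (hasDerivAt_id s).const_mul ε)
      contDiffAt_const (hasDerivAt_const _ _) hmax
    have h2 : ζ ≤ w x + β * Real.log ‖x‖ := hζ ⟨x, ⟨hx1, hx2.le⟩, rfl⟩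
    have h3 := Real.exp_le_exp.mpr (mul_le_mul_of_nonneg_left h2 (by linarith : 0 ≤ q - 1))
    linarith
  have ht : Tendsto (fun ε : ℝ => ε ^ 2 - 2 * ρ * ε + lam * |ε| ^ (1 - τ)) (𝓝[>] 0) (𝓝 0) := by
    have hr : ContinuousAt (fun ε : ℝ => |ε| ^ (1 - τ)) 0 :=
      ContinuousAt.rpow_const (by fun_prop) (Or.inr (by linarith))
    have h : ContinuousAt (fun ε : ℝ => ε ^ 2 - 2 * ρ * ε + lam * |ε| ^ (1 - τ)) 0 := by fun_prop
    have h' := h.tendsto.mono_left (nhdsWithin_le_nhds (s := Set.Ioi 0))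
    simpa [Real.zero_rpow (by linarith : 1 - τ ≠ 0)] using h'
  have hev : ∀ᶠ ε : ℝ in 𝓝[>] 0, ε ∈ Set.Ioo 0 (-β / 2) := Ioo_mem_nhdsGT (by linarith)
  have := ge_of_tendsto ht (hev.mono key)
  linarith [Real.exp_pos ((q - 1) * ζ)]

end Monotone

/-- For `θ < -2` and `f_ρ(β) > 0`, every positive solution of (E) in
`ℝ^N \ {0}` is radially symmetric: `u(x) = v(‖x‖)` for a `C¹` function `v` on `(0,∞)`
with `v' > 0` on `(0,∞)` and `v(r) → 0` as `r → 0⁺`. -/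
theorem stmt1_radial_symmetry
    (N : ℕ) (hN : 2 ≤ N) (ρ lam τ θ q : ℝ)
    (hτ0 : 0 ≤ τ) (hτ1 : τ < 1) (hq : 1 < q)
    (hθ : θ < -2) (hf : 0 < fRho ρ lam τ ((θ + 2) / (q - 1)))
    (u : EuclideanSpace ℝ (Fin N) → ℝ)
    (hu : IsSolutionE N ρ lam τ θ q Set.univ u) :
    ∃ v : ℝ → ℝ, ContDiffOn ℝ 1 v (Set.Ioi 0) ∧
      (∀ x : EuclideanSpace ℝ (Fin N), x ≠ 0 → u x = v ‖x‖) ∧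
      (∀ r : ℝ, 0 < r → 0 < deriv v r) ∧
      Filter.Tendsto v (𝓝[>] (0 : ℝ)) (𝓝 0) := by
  have hw := hu.isLogSolution hN hτ1 hq
  have hfin : Module.finrank ℝ (EuclideanSpace ℝ (Fin N)) = N := by simp
  have : Nontrivial (EuclideanSpace ℝ (Fin N)) :=
    Module.nontrivial_of_finrank_pos (R := ℝ) (by omega)
  have hβ : (θ + 2) / (q - 1) < 0 := div_neg_of_neg_of_pos (by linarith) (by linarith)
  have hmem : ∀ x : EuclideanSpace ℝ (Fin N), x ≠ 0 → x ∈ Set.univ \ {0} :=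
    fun x hx => ⟨trivial, hx⟩
  have hpos : ∀ x : EuclideanSpace ℝ (Fin N), x ≠ 0 → 0 < u x := fun x hx => hu.1.2 x (hmem x hx)
  obtain ⟨e, he⟩ : ∃ e : EuclideanSpace ℝ (Fin N), ‖e‖ = 1 := exists_norm_eq _ zero_le_one
  have he0 : e ≠ 0 := norm_pos_iff.mp (by rw [he]; exact one_pos)
  have hre : ∀ r : ℝ, 0 < r → r • e ≠ 0 := fun r hr => smul_ne_zero hr.ne' he0
  have hnorm : ∀ r : ℝ, 0 < r → ‖r • e‖ = r := fun r hr => by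
    rw [norm_smul, he, mul_one, Real.norm_eq_abs, abs_of_pos hr]
  set v : ℝ → ℝ := fun r => u (r • e) with hv
  have hvpos : ∀ r : ℝ, 0 < r → 0 < v r := fun r hr => hpos _ (hre r hr)
  have hC1 : ContDiffOn ℝ 1 v (Set.Ioi 0) :=
    hu.1.1.comp ((contDiff_id.smul contDiff_const).contDiffOn) fun r hr => hmem _ (hre r hr)
  have hrad : ∀ x : EuclideanSpace ℝ (Fin N), x ≠ 0 → Real.log (u x) = Real.log (v ‖x‖) :=
    fun x hx => hw.eq_of_norm_eq (by omega) hτ0 hτ1 hq hx (hnorm _ (norm_pos_iff.mpr hx))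
  refine ⟨v, hC1, fun x hx => ?_, fun r hr => ?_, ?_⟩
  · exact Real.log_injOn_pos (hpos x hx) (hvpos _ (norm_pos_iff.mpr hx)) (hrad x hx)
  · have hd : HasDerivAt v (deriv v r) r :=
      ((hC1.contDiffAt (Ioi_mem_nhds hr)).differentiableAt one_ne_zero).hasDerivAt
    have h1 := hw.deriv_pos hτ0 hτ1 hq hβ (V := fun r => Real.log (v r)) hrad hr
      (hd.log (hvpos r hr).ne')
    exact (div_pos_iff_of_pos_right (hvpos r hr)).mp h1
  · obtain ⟨c, hc⟩ := hw.exists_upper_bound hτ0 hτ1 hq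
    have hlim : Tendsto (fun r => Real.exp (c + -((θ + 2) / (q - 1)) * Real.log r)) (𝓝[>] 0)
        (𝓝 0) := by
      refine Real.tendsto_exp_atBot.comp (tendsto_atBot_add_const_left _ c ?_)
      exact Real.tendsto_log_nhdsGT_zero.const_mul_atBot (by linarith)
    refine tendsto_of_tendsto_of_tendsto_of_le_of_le' tendsto_const_nhds hlim ?_ ?_
    · filter_upwards [self_mem_nhdsWithin] with r hr using (hvpos r hr).le
    · filter_upwards [self_mem_nhdsWithin] with r hr
      have h1 := hc (r • e) (hre r hr)
      rw [hnorm r hr] at h1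
      rw [← Real.log_le_iff_le_exp (hvpos r hr)]
      linarith

end
end
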